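/- Let n ≥ 2 be an integer, α > 0, p ∈ {1,…,n−1} coprime to n, and let g be a type (i) coupling satisfying the quantisation condition M ∈ ℤ ∖ {0}. Then there exists a family (Ψ_λ)_{λ∈Λ⁺_{p,|M|}} of complex-valued functions on the lattice ρ_p+sgn(M)Λ⁺_{p,|M|} such that: (i) (Ψ_λ, Ψ_μ)_{p,M} = 1 if λ = μ and 0 otherwise, for all λ, μ ∈ Λ⁺_{p,|M|} — in particular, the Ψ_λ form an orthonormal basis of the C(n−1+|M|,|M|)-dimensional space of all complex-valued functions on the lattice; and (ii) Ŝ_{r,M}Ψ_λ = ℰ_r(ρ(sgn(M)g) + σ_p(λ)) · Ψ_λ for all r = 1,…,n−1 and λ ∈ Λ⁺_{p,|M|}, where σ_p is the unique permutation of the n coordinates of ℝⁿ that maps the set {ω_{1,p},…,ω_{n−1,p}} onto {ω_1,…,ω_{n−1}}, ω_k = e_1+…+e_k − (k/n)(e_1+…+e_n), and ρ(g) = g·(ω_1+…+ω_{n−1}). -/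

import Mathlib

noncomputable section
open Real Finset
open scoped Classical

/-- The standard basis vector `e_j` of `ℝⁿ` (1-based index), extended `n`-periodically
(`e_{n+j} = e_j`). -/
def ee (n j : ℕ) : Fin n → ℝ := fun i => if ((i : ℕ) + 1) % n = j % n then 1 else 0

/-- The standard inner product on `ℝⁿ`. -/
def inn {n : ℕ} (x y : Fin n → ℝ) : ℝ := ∑ i, x i * y i

/-- The coordinate `x_j` (1-based index) with the convention `x_{n+k} = x_k - 2π/α`. -/
def coord {n : ℕ} (α : ℝ) (x : Fin n → ℝ) (j : ℕ) : ℝ :=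
  if h : 0 < n then x ⟨(j - 1) % n, Nat.mod_lt _ h⟩ - 2 * π / α * (((j - 1) / n : ℕ) : ℝ)
  else 0

/-- The simple roots `a_{j,p} = e_j - e_{j+p}`. -/
def aa (n p j : ℕ) : Fin n → ℝ := ee n j - ee n (j + p)

/-- The closed simplex `Σ̄_{g,p} = {x ∈ E_n : sgn(M)(x_j - x_{j+p} - g) ≥ 0, j = 1,…,n}`,
where `M = 2πp/α - ng`. -/
def SigmaBar (n p : ℕ) (α g : ℝ) : Set (Fin n → ℝ) :=
  {x | (∑ i, x i) = 0 ∧ ∀ j ∈ Icc 1 n,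
    0 ≤ Real.sign (2 * π * p / α - n * g) * (coord α x j - coord α x (j + p) - g)}

/-- The interior `Σ_{g,p}` of the simplex, cut out by the strict inequalities. -/
def SigmaInt (n p : ℕ) (α g : ℝ) : Set (Fin n → ℝ) :=
  {x | (∑ i, x i) = 0 ∧ ∀ j ∈ Icc 1 n,
    0 < Real.sign (2 * π * p / α - n * g) * (coord α x j - coord α x (j + p) - g)}

/-- `g` is a type (i) coupling, with `q ∈ {1,…,n-1}` the multiplicative inverse of `p` mod `n`. -/
def TypeI (n p q : ℕ) (α g : ℝ) : Prop :=
  1 ≤ q ∧ q ≤ n - 1 ∧ (p * q) % n = 1 % n ∧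
  ((2 * π / α * ((p : ℝ) / n - 1 / ((n : ℝ) * q)) < g ∧ g < 2 * π / α * ((p : ℝ) / n)) ∨
   (2 * π / α * ((p : ℝ) / n) < g ∧
      g < 2 * π / α * ((p : ℝ) / n + 1 / ((n : ℝ) * ((n : ℝ) - q)))))

/-- `ρ_p = g(ω_{1,p}+…+ω_{n-p,p}) + (g - 2π/α)(ω_{n-p+1,p}+…+ω_{n-1,p})`. -/
def rhoP (n p : ℕ) (α g : ℝ) (ω : ℕ → Fin n → ℝ) : Fin n → ℝ :=
  g • (∑ j ∈ Icc 1 (n - p), ω j) + (g - 2 * π / α) • (∑ j ∈ Icc (n - p + 1) (n - 1), ω j)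

/-- `Λ⁺_{p,|M|}`: nonnegative integral combinations of the `ω_{j,p}` with coefficient sum `≤ |M|`. -/
def Lam (n : ℕ) (Mabs : ℝ) (ω : ℕ → Fin n → ℝ) : Set (Fin n → ℝ) :=
  {μ | ∃ m : ℕ → ℕ, (∑ j ∈ Icc 1 (n - 1), (m j : ℝ)) ≤ Mabs ∧
    μ = ∑ j ∈ Icc 1 (n - 1), (m j : ℝ) • ω j}

/-- The fundamental weight `ω_r = e_1+…+e_r - (r/n)(e_1+…+e_n)`. -/
def omegaStd (n r : ℕ) : Fin n → ℝ :=
  fun i => (if (i : ℕ) + 1 ≤ r then 1 else 0) - (r : ℝ) / n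

/-- Membership in the orbit `S_n(ω_r)` of `ω_r` under coordinate permutations. -/
def inOrbit (n r : ℕ) (ν : Fin n → ℝ) : Prop :=
  ∃ σ : Equiv.Perm (Fin n), ν = fun i => omegaStd n r (σ i)

/-- The orbit `S_n(ω_r)` as a finite set. -/
def orbitF (n r : ℕ) : Finset (Fin n → ℝ) :=
  Finset.image (fun σ : Equiv.Perm (Fin n) => fun i => omegaStd n r (σ i)) Finset.univ

/-- `V_ν(g;x) = ∏_{a ∈ A_{n-1}, ⟨a,ν⟩=1} sin(α(⟨a,x⟩+g)/2)/sin(α⟨a,x⟩/2)`. -/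
def Vnu (n : ℕ) (α g : ℝ) (ν x : Fin n → ℝ) : ℝ :=
  ∏ j ∈ Icc 1 n, ∏ k ∈ Icc 1 n,
    if j ≠ k ∧ inn (ee n j - ee n k) ν = 1 then
      Real.sin (α * (inn (ee n j - ee n k) x + g) / 2) /
        Real.sin (α * inn (ee n j - ee n k) x / 2)
    else 1

/-- `V_J(g;x) = ∏_{j∈J, k∉J} sin(α(x_j-x_k+g)/2)/sin(α(x_j-x_k)/2)`. -/
def VJ (n : ℕ) (α g : ℝ) (J : Finset ℕ) (x : Fin n → ℝ) : ℝ :=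
  ∏ j ∈ J, ∏ k ∈ Icc 1 n \ J,
    Real.sin (α * (coord α x j - coord α x k + g) / 2) /
      Real.sin (α * (coord α x j - coord α x k) / 2)

/-- `F_J(g;x) = ∏_{j,k∈J, j≠k} sin(α(x_j-x_k)/2)/sin(α(x_j-x_k+g)/2)`. -/
def FJ (n : ℕ) (α g : ℝ) (J : Finset ℕ) (x : Fin n → ℝ) : ℝ :=
  ∏ j ∈ J, ∏ k ∈ J,
    if j ≠ k then
      Real.sin (α * (coord α x j - coord α x k) / 2) /
        Real.sin (α * (coord α x j - coord α x k + g) / 2)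
    else 1

/-- The trigonometric Pochhammer symbol `(z : sin_α)_m`. -/
def poch (α z : ℝ) (m : ℤ) : ℝ :=
  if 0 ≤ m then ∏ l ∈ Finset.range m.toNat, Real.sin (α * (z + l) / 2)
  else 1 / ∏ l ∈ Finset.Icc 1 (-m).toNat, Real.sin (α * (z - l) / 2)

/-- Membership in the set of positive roots `A⁺_{n-1,p}`. -/
def inPosRoots (n p : ℕ) (v : Fin n → ℝ) : Prop :=
  (∃ j ∈ Icc 1 n, ∃ k ∈ Icc 1 n, j ≠ k ∧ v = ee n j - ee n k) ∧
  ∃ c : ℕ → ℕ, v = ∑ j ∈ Icc 1 (n - 1), (c j : ℝ) • aa n p j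

/-- The lattice function `Δ_p(μ)`. -/
def Delta (n p : ℕ) (α g : ℝ) (ω : ℕ → Fin n → ℝ) (μ : Fin n → ℝ) : ℝ :=
  ∏ j ∈ Icc 1 n, ∏ k ∈ Icc 1 n,
    if inPosRoots n p (ee n j - ee n k) then
      Real.sin (α * inn (ee n j - ee n k)
          (rhoP n p α g ω + Real.sign (2 * π * p / α - n * g) • μ) / 2) /
        Real.sin (α * inn (ee n j - ee n k) (rhoP n p α g ω) / 2) *
      (poch α (inn (ee n j - ee n k) (rhoP n p α g ω) +
            Real.sign (2 * π * p / α - n * g) * g)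
          ⌊Real.sign (2 * π * p / α - n * g) * inn (ee n j - ee n k) μ⌋ /
        poch α (inn (ee n j - ee n k) (rhoP n p α g ω) + 1 -
            Real.sign (2 * π * p / α - n * g) * g)
          ⌊Real.sign (2 * π * p / α - n * g) * inn (ee n j - ee n k) μ⌋)
    else 1

/-- The coefficient `W_ν(ρ_p + sgn(M)μ)` (equal to `0` when `μ + ν ∉ Λ⁺_{p,|M|}`). -/
def Wmu (n p : ℕ) (α g : ℝ) (ω : ℕ → Fin n → ℝ) (s : (Fin n → ℝ) → ℝ)
    (μ ν : Fin n → ℝ) : ℝ :=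
  if μ + ν ∈ Lam n |2 * π * p / α - n * g| ω then
    s ν * Real.sqrt
      (Vnu n α g ν (rhoP n p α g ω + Real.sign (2 * π * p / α - n * g) • μ) *
       Vnu n α g ν (-(rhoP n p α g ω) - Real.sign (2 * π * p / α - n * g) • (μ + ν)))
  else 0

/-- The discrete difference operator `Ŝ_{r,M}` acting on lattice functions. -/
def SOp (n p r : ℕ) (α g : ℝ) (ω : ℕ → Fin n → ℝ) (s : (Fin n → ℝ) → ℝ)
    (φ : (Fin n → ℝ) → ℂ) : (Fin n → ℝ) → ℂ :=
  fun x => ∑ ν ∈ orbitF n r,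
    (Wmu n p α g ω s (Real.sign (2 * π * p / α - n * g) • (x - rhoP n p α g ω)) ν : ℂ) *
      φ (x + Real.sign (2 * π * p / α - n * g) • ν)

/-- The inner product `(φ, ψ)_{p,M}` on lattice functions. -/
def ip (n p : ℕ) (α g : ℝ) (ω : ℕ → Fin n → ℝ) (φ ψ : (Fin n → ℝ) → ℂ) : ℂ :=
  ∑ᶠ μ ∈ Lam n |2 * π * p / α - n * g| ω,
    φ (rhoP n p α g ω + Real.sign (2 * π * p / α - n * g) • μ) *
      starRingEnd ℂ (ψ (rhoP n p α g ω + Real.sign (2 * π * p / α - n * g) • μ))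

/-- The elementary symmetric function `ℰ_r(u) = Σ_{ν ∈ S_n(ω_r)} exp(iα⟨ν,u⟩)`. -/
def calE (n r : ℕ) (α : ℝ) (u : Fin n → ℝ) : ℂ :=
  ∑ ν ∈ orbitF n r, Complex.exp (Complex.I * (α : ℂ) * (inn ν u : ℂ))

/-- The alternating exponential sum `∑_w sgn(w) exp(i ∑_j l_{w j} θ_j)`. -/
def altSum {n : ℕ} (l θ : Fin n → ℝ) : ℂ :=
  ∑ w : Equiv.Perm (Fin n), ((Equiv.Perm.sign w : ℤ) : ℂ) *
    Complex.exp (Complex.I * ((∑ i, l (w i) * θ i : ℝ) : ℂ))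

/-- The symmetric exponential sum `∑_w exp(i ∑_j κ_{w j} θ_j)`. -/
def symSum {n : ℕ} (κ θ : Fin n → ℝ) : ℂ :=
  ∑ w : Equiv.Perm (Fin n), Complex.exp (Complex.I * ((∑ i, κ (w i) * θ i : ℝ) : ℂ))

/-- The half sum of the positive roots. -/
def weylVec (n : ℕ) : Fin n → ℝ := fun i => ((n : ℝ) - 1) / 2 - (i : ℝ)

/-- The elementary symmetric function of degree `r` in the variables `exp(i u_j)`. -/
def elemExp {n : ℕ} (r : ℕ) (u : Fin n → ℝ) : ℂ :=
  ∑ J ∈ powersetCard r (univ : Finset (Fin n)),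
    Complex.exp (Complex.I * ((∑ j ∈ J, u j : ℝ) : ℂ))

/-- The indicator vector of `J`. -/
def indVec {n : ℕ} (J : Finset (Fin n)) : Fin n → ℝ := fun i => if i ∈ J then 1 else 0

lemma sum_mul_indVec {n : ℕ} (J : Finset (Fin n)) (f : Fin n → ℝ) :
    ∑ i, f i * indVec J i = ∑ i ∈ J, f i := by
  simp [indVec]

lemma altSum_comp_perm {n : ℕ} (l θ : Fin n → ℝ) (σ : Equiv.Perm (Fin n)) :
    altSum (l ∘ σ) θ = ((Equiv.Perm.sign σ : ℤ) : ℂ) * altSum l θ := by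
  symm
  unfold altSum
  rw [Finset.mul_sum, ← Equiv.sum_comp (Equiv.mulLeft σ)]
  refine Finset.sum_congr rfl fun w _ => ?_
  have h : ((Equiv.Perm.sign σ : ℤ) : ℂ) * ((Equiv.Perm.sign σ : ℤ) : ℂ) = 1 := by
    rw [← Int.cast_mul, ← Units.val_mul, Int.units_mul_self, Units.val_one, Int.cast_one]
  simp only [Function.comp_apply, Equiv.coe_mulLeft, Equiv.Perm.sign_mul, Equiv.Perm.coe_mul,
    Units.val_mul, Int.cast_mul, ← mul_assoc, h, one_mul]

lemma altSum_eq_zero_of_not_injective {n : ℕ} (l θ : Fin n → ℝ) (h : ¬ Function.Injective l) :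
    altSum l θ = 0 := by
  simp only [Function.Injective, not_forall] at h
  obtain ⟨a, b, hab, hne⟩ := h
  have h1 : l ∘ (Equiv.swap a b) = l := by
    funext i
    by_cases hia : i = a
    · simp [hia, hab]
    · by_cases hib : i = b
      · simp [hib, hab]
      · simp [Equiv.swap_apply_of_ne_of_ne hia hib]
  have h2 := altSum_comp_perm l θ (Equiv.swap a b)
  rw [h1, Equiv.Perm.sign_swap hne] at h2
  push_cast at h2
  linear_combination h2 / 2

lemma altSum_add_const {n : ℕ} (l θ : Fin n → ℝ) (c : ℝ) (hθ : ∑ i, θ i = 0) :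
    altSum (fun i => l i + c) θ = altSum l θ := by
  unfold altSum
  refine Finset.sum_congr rfl fun w _ => ?_
  have : ∑ i, (l (w i) + c) * θ i = ∑ i, l (w i) * θ i := by
    simp only [add_mul, Finset.sum_add_distrib, ← Finset.mul_sum, hθ, mul_zero, add_zero]
  rw [this]

lemma altSum_neg_neg {n : ℕ} (l θ : Fin n → ℝ) :
    altSum (fun i => -l i) (fun i => -θ i) = altSum l θ := by
  simp [altSum]

lemma two_I_sin (a b : ℝ) :
    Complex.exp (Complex.I * a) - Complex.exp (Complex.I * b) =
      2 * Complex.I * ((Real.sin ((a - b) / 2) : ℝ) : ℂ) *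
        Complex.exp (Complex.I * (((a + b) / 2 : ℝ) : ℂ)) := by
  have h1 : Complex.exp (Complex.I * a) = Complex.exp ((((a - b) / 2 : ℝ) : ℂ) * Complex.I) *
      Complex.exp (Complex.I * (((a + b) / 2 : ℝ) : ℂ)) := by
    rw [← Complex.exp_add]; congr 1; push_cast; ring
  have h2 : Complex.exp (Complex.I * b) = Complex.exp (-(((a - b) / 2 : ℝ) : ℂ) * Complex.I) *
      Complex.exp (Complex.I * (((a + b) / 2 : ℝ) : ℂ)) := by
    rw [← Complex.exp_add]; congr 1; push_cast; ring
  rw [h1, h2, Complex.ofReal_sin, Complex.sin]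
  linear_combination (Complex.exp (-(((a - b) / 2 : ℝ) : ℂ) * Complex.I) -
    Complex.exp ((((a - b) / 2 : ℝ) : ℂ) * Complex.I)) *
    Complex.exp (Complex.I * (((a + b) / 2 : ℝ) : ℂ)) * -Complex.I_sq

lemma sum_sum_Ioi_add {n : ℕ} (f : Fin n → ℝ) :
    ∑ i, ∑ j ∈ Ioi i, (f i + f j) = ((n : ℝ) - 1) * ∑ i, f i := by
  have h := Finset.sum_sum_Ioi_add_eq_sum_sum_off_diag (fun i _ : Fin n => f i)
  have h2 : ∀ i : Fin n, ∑ j ∈ ({i}ᶜ : Finset (Fin n)), f j = ∑ j, f j - f i := by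
    intro i
    rw [eq_sub_iff_add_eq, ← Finset.sum_compl_add_sum {i}]; simp
  simp only [h2, Finset.sum_sub_distrib, Finset.sum_const, Finset.card_univ, Fintype.card_fin,
    nsmul_eq_mul] at h
  calc _ = ∑ i, ∑ j ∈ Ioi i, (f j + f i) := by
        refine Finset.sum_congr rfl fun i _ => Finset.sum_congr rfl fun j _ => add_comm _ _
    _ = _ := by rw [h]; ring

/-- Weyl's denominator formula. -/
lemma altSum_weylVec {n : ℕ} (θ : Fin n → ℝ) :
    altSum (weylVec n) θ =
      ∏ i, ∏ j ∈ Ioi i, (2 * Complex.I * ((Real.sin ((θ i - θ j) / 2) : ℝ) : ℂ)) := by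
  rw [← altSum_neg_neg]
  have hdet := Matrix.det_vandermonde (fun i : Fin n => Complex.exp (Complex.I * ((-θ i : ℝ) : ℂ)))
  rw [← Matrix.det_transpose, Matrix.det_apply'] at hdet
  have hL : altSum (fun i => -weylVec n i) (fun i => -θ i) =
      Complex.exp (Complex.I * (((n : ℝ) - 1) / 2 * ∑ i, θ i : ℝ)) *
      ∏ i, ∏ j ∈ Ioi i, (Complex.exp (Complex.I * ((-θ j : ℝ) : ℂ)) -
        Complex.exp (Complex.I * ((-θ i : ℝ) : ℂ))) := by
    rw [← hdet, Finset.mul_sum]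
    unfold altSum
    refine Finset.sum_congr rfl fun w _ => ?_
    rw [mul_left_comm]
    congr 1
    simp only [Matrix.transpose_apply, Matrix.vandermonde_apply, ← Complex.exp_nat_mul]
    rw [← Complex.exp_sum, ← Complex.exp_add]
    congr 1
    push_cast
    simp only [weylVec, Finset.mul_sum, ← Finset.sum_add_distrib]
    refine Finset.sum_congr rfl fun i _ => ?_
    push_cast
    ring
  rw [hL]
  have hterm : ∀ i j : Fin n, Complex.exp (Complex.I * ((-θ j : ℝ) : ℂ)) -
        Complex.exp (Complex.I * ((-θ i : ℝ) : ℂ)) =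
      (2 * Complex.I * ((Real.sin ((θ i - θ j) / 2) : ℝ) : ℂ)) *
        Complex.exp (Complex.I * ((-(θ i + θ j) / 2 : ℝ) : ℂ)) := by
    intro i j
    rw [two_I_sin]
    congr 4 <;> ring_nf
  simp only [hterm, Finset.prod_mul_distrib, ← Complex.exp_sum]
  rw [mul_comm, mul_assoc, ← Complex.exp_add]
  have h0 : ∑ i, ∑ j ∈ Ioi i, Complex.I * ((-(θ i + θ j) / 2 : ℝ) : ℂ) =
      -(Complex.I * (((n : ℝ) - 1) / 2 * ∑ i, θ i : ℝ)) := by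
    have := sum_sum_Ioi_add θ
    rw [show ((n : ℝ) - 1) / 2 * ∑ i, θ i = (((n : ℝ) - 1) * ∑ i, θ i) / 2 by ring, ← this]
    push_cast
    simp only [Finset.mul_sum, Finset.sum_div, ← Finset.sum_neg_distrib]
    refine Finset.sum_congr rfl fun i _ => Finset.sum_congr rfl fun j _ => by ring
  rw [h0]
  simp

/-- The coefficient `V_J` in terms of angles. -/
def coefV {n : ℕ} (γ : ℝ) (J : Finset (Fin n)) (θ : Fin n → ℝ) : ℝ :=
  ∏ j ∈ J, ∏ k ∈ Jᶜ, Real.sin ((θ j - θ k + γ) / 2) / Real.sin ((θ j - θ k) / 2)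

/-- The pair factor in the coefficient `V_J`. -/
def pairV {n : ℕ} (γ : ℝ) (J : Finset (Fin n)) (θ : Fin n → ℝ) (i j : Fin n) : ℝ :=
  if i ∈ J ∧ j ∉ J then Real.sin ((θ i - θ j + γ) / 2) / Real.sin ((θ i - θ j) / 2) else 1

lemma coefV_eq_prod_pairs {n : ℕ} (γ : ℝ) (J : Finset (Fin n)) (θ : Fin n → ℝ) :
    coefV γ J θ = ∏ i, ∏ j ∈ Ioi i, (pairV γ J θ i j * pairV γ J θ j i) := by
  have h := Finset.prod_prod_Ioi_mul_eq_prod_prod_off_diag (fun j i => pairV γ J θ i j)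
  rw [h]
  have h2 : ∀ i : Fin n, ∏ j ∈ ({i}ᶜ : Finset (Fin n)), pairV γ J θ i j =
      ∏ j, pairV γ J θ i j := by
    intro i
    rw [← Finset.prod_compl_mul_prod {i}]; simp [pairV]
  simp only [h2]
  unfold coefV
  rw [← Finset.prod_subset (Finset.subset_univ J)]
  · refine Finset.prod_congr rfl fun i hi => ?_
    rw [← Finset.prod_subset (Finset.subset_univ Jᶜ)]
    · refine Finset.prod_congr rfl fun j hj => ?_
      rw [Finset.mem_compl] at hj
      simp [pairV, hi, hj]
    · intro j _ hj
      rw [Finset.mem_compl, not_not] at hj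
      simp [pairV, hj]
  · intro i _ hi
    simp [pairV, hi]

lemma pairV_mul_pairV {n : ℕ} (γ : ℝ) (J : Finset (Fin n)) (θ : Fin n → ℝ) (i j : Fin n)
    (h : Real.sin ((θ i - θ j) / 2) ≠ 0) :
    pairV γ J θ i j * pairV γ J θ j i * Real.sin ((θ i - θ j) / 2) =
      Real.sin (((θ i + γ * indVec J i) - (θ j + γ * indVec J j)) / 2) := by
  have h' : Real.sin ((θ j - θ i) / 2) = - Real.sin ((θ i - θ j) / 2) := by
    rw [← Real.sin_neg]; congr 1; ring
  by_cases hi : i ∈ J <;> by_cases hj : j ∈ J <;> simp only [pairV, indVec, hi, hj, not_true,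
    not_false_iff, and_true, and_false, if_true, if_false, mul_one, one_mul, mul_zero, add_zero,
    and_self]
  · congr 1; ring
  · rw [div_mul_cancel₀ _ h]; congr 1; ring
  · rw [h', div_neg, neg_mul, div_mul_cancel₀ _ h, ← Real.sin_neg]; congr 1; ring

lemma coefV_mul_altSum {n : ℕ} (γ : ℝ) (J : Finset (Fin n)) (θ : Fin n → ℝ)
    (h : ∀ i j : Fin n, i < j → Real.sin ((θ i - θ j) / 2) ≠ 0) :
    (coefV γ J θ : ℂ) * altSum (weylVec n) θ =
      altSum (weylVec n) (fun i => θ i + γ * indVec J i) := by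
  rw [altSum_weylVec, altSum_weylVec, coefV_eq_prod_pairs]
  simp only [Complex.ofReal_prod, ← Finset.prod_mul_distrib]
  refine Finset.prod_congr rfl fun i _ => Finset.prod_congr rfl fun j hj => ?_
  rw [← pairV_mul_pairV γ J θ i j (h i j (Finset.mem_Ioi.1 hj))]
  simp only [Complex.ofReal_mul]
  ring

/-- The action of the Ruijsenaars-Macdonald operators on symmetric exponential sums. -/
lemma sum_altSum_mul_symSum {n : ℕ} (r : ℕ) (α γ : ℝ) (κ θ : Fin n → ℝ) :
    ∑ J ∈ powersetCard r (univ : Finset (Fin n)),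
      altSum (weylVec n) (fun i => θ i + γ * indVec J i) *
        symSum κ (fun i => θ i + α * indVec J i) =
    ∑ v : Equiv.Perm (Fin n), elemExp r (fun i => γ * weylVec n i + α * κ (v i)) *
      altSum (fun i => weylVec n i + κ (v i)) θ := by
  have hE : ∀ (u : Fin n → ℝ) (w : Equiv.Perm (Fin n)),
      elemExp r u = ∑ J ∈ powersetCard r (univ : Finset (Fin n)),
        Complex.exp (Complex.I * ((∑ j ∈ J, u (w j) : ℝ) : ℂ)) := by
    intro u w
    unfold elemExp
    refine (Finset.sum_bij' (fun J _ => J.map w.toEmbedding) (fun J _ => J.map w.symm.toEmbedding)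
      ?_ ?_ ?_ ?_ ?_).symm
    · intro J hJ; simpa [Finset.mem_powersetCard] using hJ
    · intro J hJ; simpa [Finset.mem_powersetCard] using hJ
    · intro J _; simp [Finset.map_map]
    · intro J _; simp [Finset.map_map]
    · intro J _; simp [Finset.sum_map]
  have hR : ∀ v : Equiv.Perm (Fin n), elemExp r (fun i => γ * weylVec n i + α * κ (v i)) *
      altSum (fun i => weylVec n i + κ (v i)) θ =
      ∑ w : Equiv.Perm (Fin n), ∑ J ∈ powersetCard r (univ : Finset (Fin n)),
        ((Equiv.Perm.sign w : ℤ) : ℂ) * Complex.exp (Complex.I *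
          ((∑ i, (weylVec n (w i) + κ (v (w i))) * θ i +
            ∑ j ∈ J, (γ * weylVec n (w j) + α * κ (v (w j))) : ℝ) : ℂ)) := by
    intro v
    unfold altSum
    rw [Finset.mul_sum]
    refine Finset.sum_congr rfl fun w _ => ?_
    rw [hE _ w, Finset.sum_mul]
    refine Finset.sum_congr rfl fun J _ => ?_
    rw [mul_left_comm, ← Complex.exp_add]
    congr 2
    push_cast
    ring
  simp only [hR]
  rw [Finset.sum_comm]
  have hL : ∀ J : Finset (Fin n), altSum (weylVec n) (fun i => θ i + γ * indVec J i) *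
        symSum κ (fun i => θ i + α * indVec J i) =
      ∑ w : Equiv.Perm (Fin n), ∑ v : Equiv.Perm (Fin n),
        ((Equiv.Perm.sign w : ℤ) : ℂ) * Complex.exp (Complex.I *
          ((∑ i, (weylVec n (w i) + κ (v (w i))) * θ i +
            ∑ j ∈ J, (γ * weylVec n (w j) + α * κ (v (w j))) : ℝ) : ℂ)) := by
    intro J
    unfold altSum symSum
    rw [Finset.sum_mul]
    refine Finset.sum_congr rfl fun w _ => ?_
    rw [Finset.mul_sum, ← Equiv.sum_comp (Equiv.mulRight w)]
    refine Finset.sum_congr rfl fun v _ => ?_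
    rw [mul_assoc, ← Complex.exp_add, ← mul_add, ← Complex.ofReal_add]
    congr 4
    simp only [Equiv.coe_mulRight, Equiv.Perm.coe_mul, Function.comp_apply]
    rw [← sum_mul_indVec J, ← Finset.sum_add_distrib, ← Finset.sum_add_distrib]
    refine Finset.sum_congr rfl fun i _ => by ring
  simp only [hL]
  rw [Finset.sum_comm]
  refine Finset.sum_congr rfl fun w _ => Finset.sum_comm

lemma prod_sub_exp_mul_altSum {n : ℕ} (ξ : ℂ) (l θ : Fin n → ℝ) :
    (∏ i, (ξ - Complex.exp (Complex.I * θ i))) * altSum l θ =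
      ∑ J : Finset (Fin n), (-1) ^ J.card * ξ ^ (n - J.card) *
        altSum (fun i => l i + indVec J i) θ := by
  have hR : ∀ J : Finset (Fin n), (-1 : ℂ) ^ J.card * ξ ^ (n - J.card) *
        altSum (fun i => l i + indVec J i) θ =
      ∑ w : Equiv.Perm (Fin n), (-1 : ℂ) ^ J.card * ξ ^ (n - J.card) *
        (((Equiv.Perm.sign w : ℤ) : ℂ) *
        Complex.exp (Complex.I * ((∑ i, (l (w i) + indVec J (w i)) * θ i : ℝ) : ℂ))) := by
    intro J
    unfold altSum
    rw [Finset.mul_sum]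
  simp only [hR]
  rw [Finset.sum_comm]
  unfold altSum
  rw [Finset.mul_sum]
  refine Finset.sum_congr rfl fun w _ => ?_
  rw [← Equiv.sum_comp (Equiv.finsetCongr w)]
  have hp : (∏ i, (ξ - Complex.exp (Complex.I * θ i))) = ∑ J : Finset (Fin n),
      (-1 : ℂ) ^ J.card * ξ ^ (n - J.card) * Complex.exp (Complex.I * ((∑ i ∈ J, θ i : ℝ) : ℂ)) := by
    have := Finset.prod_add (fun i => -Complex.exp (Complex.I * θ i)) (fun _ => ξ)
      (univ : Finset (Fin n))
    rw [show (∏ i, (ξ - Complex.exp (Complex.I * θ i))) =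
      ∏ i, (-Complex.exp (Complex.I * θ i) + ξ) from
        Finset.prod_congr rfl fun i _ => by ring, this, Finset.powerset_univ]
    refine Finset.sum_congr rfl fun J _ => ?_
    rw [Finset.prod_neg, Finset.prod_const, ← Finset.compl_eq_univ_sdiff, Finset.card_compl,
      Fintype.card_fin, ← Complex.exp_sum, ← Finset.mul_sum, Complex.ofReal_sum]
    ring
  rw [hp, Finset.sum_mul]
  refine Finset.sum_congr rfl fun J _ => ?_
  have hc : ((Equiv.finsetCongr w) J).card = J.card := by simp
  rw [hc]
  have hi : ∀ i, indVec (Equiv.finsetCongr w J) (w i) = indVec J i := by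
    intro i; simp [indVec]
  have hs : ∑ i, (l (w i) + indVec (Equiv.finsetCongr w J) (w i)) * θ i =
      ∑ i, l (w i) * θ i + ∑ i ∈ J, θ i := by
    simp only [hi, add_mul, Finset.sum_add_distrib]
    congr 1
    rw [← sum_mul_indVec J]
    exact Finset.sum_congr rfl fun i _ => mul_comm _ _
  rw [hs, Complex.ofReal_add, mul_add, Complex.exp_add]
  ring

/-- Compositions of `K` into `n` nonnegative parts. -/
abbrev Compos (n K : ℕ) := ↥(piAntidiag (univ : Finset (Fin n)) K)

lemma Compos.sum_eq {n K : ℕ} (m : Compos n K) : ∑ i, m.1 i = K := by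
  have := m.2
  rw [Finset.mem_piAntidiag] at this
  exact this.1

/-- The composition with prescribed parts. -/
def Compos.mk' {n K : ℕ} (f : Fin n → ℕ) (h : ∑ i, f i = K) : Compos n K :=
  ⟨f, by rw [Finset.mem_piAntidiag]; exact ⟨h, fun i _ => Finset.mem_univ i⟩⟩

/-- The mean-zero normalisation of a vector. -/
def centre {n : ℕ} (f : Fin n → ℝ) : Fin n → ℝ := fun i => f i - (∑ j, f j) / n

lemma sum_centre {n : ℕ} [NeZero n] (f : Fin n → ℝ) : ∑ i, centre f i = 0 := by
  have : (n : ℝ) ≠ 0 := by exact_mod_cast NeZero.ne n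
  simp only [centre, Finset.sum_sub_distrib, Finset.sum_const, Finset.card_univ, Fintype.card_fin,
    nsmul_eq_mul]
  field_simp
  ring

lemma eq_of_sum_eq_zero_of_sub_eq {n : ℕ} [NeZero n] {f g : Fin n → ℝ} (hf : ∑ i, f i = 0)
    (hg : ∑ i, g i = 0) (c : ℝ) (h : ∀ i, f i = g i + c) : f = g := by
  have hn : (n : ℝ) ≠ 0 := by exact_mod_cast NeZero.ne n
  have h1 : ∑ i, f i = ∑ i, g i + n * c := by
    simp [h, Finset.sum_add_distrib]
  have hc : c = 0 := by
    rw [hf, hg] at h1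
    have : (n : ℝ) * c = 0 := by linarith
    exact (mul_eq_zero.1 this).resolve_left hn
  funext i
  rw [h i, hc, add_zero]

/-- The dominant weight with Dynkin labels `m_0, m_1, …`. -/
def domWeight {n : ℕ} (m : Fin n → ℕ) : Fin n → ℝ :=
  centre fun i => ∑ k ∈ Ici i, (m k : ℝ)

lemma sum_domWeight {n : ℕ} [NeZero n] (m : Fin n → ℕ) : ∑ i, domWeight m i = 0 := sum_centre _

lemma sum_weylVec {n : ℕ} : ∑ i, weylVec n i = 0 := by
  have h : ∑ i : Fin n, (i : ℝ) = (n : ℝ) * ((n : ℝ) - 1) / 2 := by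
    rw [Fin.sum_univ_eq_sum_range (fun i => (i : ℝ)) n]
    have := Finset.sum_range_id_mul_two n
    rcases n with _ | n
    · simp
    · have h2 : (((∑ i ∈ Finset.range (n + 1), i) * 2 : ℕ) : ℝ) = ((n + 1) * n : ℕ) := by
        rw [this]; simp
      push_cast at h2 ⊢
      linarith
  simp only [weylVec, Finset.sum_sub_distrib, Finset.sum_const, Finset.card_univ,
    Fintype.card_fin, nsmul_eq_mul, h]
  ring

lemma domWeight_sub {n : ℕ} (m : Fin n → ℕ) (i j : Fin n) :
    domWeight m i - domWeight m j = ∑ k ∈ Ici i, (m k : ℝ) - ∑ k ∈ Ici j, (m k : ℝ) := by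
  simp [domWeight, centre]

lemma domWeight_antitone {n : ℕ} (m : Fin n → ℕ) : Antitone (domWeight m) := by
  intro i j hij
  rw [← sub_nonneg, domWeight_sub, sub_nonneg]
  exact Finset.sum_le_sum_of_subset_of_nonneg (Finset.Ici_subset_Ici.2 hij)
    fun _ _ _ => Nat.cast_nonneg _

lemma domWeight_sub_le {n K : ℕ} (m : Compos n K) (i j : Fin n) :
    domWeight m.1 i - domWeight m.1 j ≤ K := by
  rw [domWeight_sub]
  have h1 : ∑ k ∈ Ici i, (m.1 k : ℝ) ≤ K := by
    calc _ ≤ ∑ k, (m.1 k : ℝ) := Finset.sum_le_sum_of_subset_of_nonneg (Finset.subset_univ _)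
          fun _ _ _ => Nat.cast_nonneg _
      _ = K := by exact_mod_cast m.sum_eq
  have h2 : 0 ≤ ∑ k ∈ Ici j, (m.1 k : ℝ) := Finset.sum_nonneg fun _ _ => Nat.cast_nonneg _
  linarith

lemma weylVec_strictAnti (n : ℕ) : StrictAnti (weylVec n) := by
  intro i j hij
  have : (i : ℝ) < (j : ℝ) := by exact_mod_cast hij
  simp only [weylVec]; linarith

lemma weylVec_sub_le {n : ℕ} (i j : Fin n) : weylVec n i - weylVec n j ≤ (n : ℝ) - 1 := by
  have h1 : (j : ℝ) + 1 ≤ n := by exact_mod_cast j.2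
  have h2 : (0 : ℝ) ≤ i := Nat.cast_nonneg _
  simp only [weylVec]; linarith

lemma sum_Ici_sub_succ {n : ℕ} (D : ℕ → ℝ) (i : Fin n) :
    ∑ k ∈ Ici i, (D k - D (k + 1)) = D i - D n := by
  have h1 : ∑ k ∈ Ici i, (D k - D (k + 1)) = ∑ k ∈ Finset.Ico (i : ℕ) n, (D k - D (k + 1)) := by
    rw [← Fin.map_valEmbedding_Ici, Finset.sum_map]; rfl
  rw [h1]
  have h2 := Finset.sum_Ico_sub D i.2.le
  rw [show D i - D n = -(D n - D i) by ring, ← h2, ← Finset.sum_neg_distrib]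
  exact Finset.sum_congr rfl fun k _ => by ring

/-- Straightening: an alternant with integral, pairwise distinct and moderately spread exponents is
a permutation of one attached to a dominant weight. -/
lemma exists_perm_eq_weylVec_add_domWeight {n K k : ℕ} [NeZero n] (hk : k ≤ K) (l : Fin n → ℝ)
    (hl : ∑ i, l i = 0) (t : Fin n → ℤ) (c : ℝ) (hlt : ∀ i, l i = t i + c)
    (hs : ∀ i j, l i - l j ≤ (n : ℝ) - 1 + k) (hinj : Function.Injective l) :
    ∃ (m : Compos n K) (σ : Equiv.Perm (Fin n)),
      (l ∘ σ = fun i => weylVec n i + domWeight m.1 i) ∧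
      ∀ i j, domWeight m.1 i - domWeight m.1 j ≤ k := by
  have hn : 0 < n := Nat.pos_of_ne_zero (NeZero.ne n)
  set σ := Tuple.sort (fun i => -t i) with hσ
  have hmono : Monotone ((fun i => -t i) ∘ σ) := Tuple.monotone_sort _
  set u : Fin n → ℤ := t ∘ σ with hu
  have hanti : StrictAnti u := by
    have h1 : Antitone u := fun i j hij => by
      have := hmono hij
      simp only [Function.comp_apply, neg_le_neg_iff] at this
      exact this
    refine h1.strictAnti_of_injective ?_
    have htinj : Function.Injective t := fun i j hij => hinj (by rw [hlt, hlt, hij])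
    exact htinj.comp σ.injective
  let z : Fin n := ⟨0, hn⟩
  let D : ℕ → ℤ := fun i => if h : i < n then u ⟨i, h⟩ + i else u z - K
  have hspr : ∀ i j, u i - u j ≤ (n : ℤ) - 1 + k := by
    intro i j
    have := hs (σ i) (σ j)
    rw [hlt, hlt] at this
    have h2 : ((t (σ i) - t (σ j) : ℤ) : ℝ) ≤ (((n : ℤ) - 1 + k : ℤ) : ℝ) := by
      push_cast; linarith
    exact_mod_cast h2
  have hD : ∀ i, i < n → 0 ≤ D i - D (i + 1) := by
    intro i hi
    by_cases h1 : i + 1 < n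
    · simp only [D, hi, h1, dif_pos]
      have : u ⟨i + 1, h1⟩ < u ⟨i, hi⟩ := hanti (by simp [Fin.lt_def])
      push_cast; omega
    · simp only [D, hi, h1, dif_pos, dif_neg, not_false_iff]
      have := hspr z ⟨i, hi⟩
      omega
  have hDR : ∀ i, i < n → (((D i - D (i + 1)).toNat : ℕ) : ℝ) = (D i : ℝ) - (D (i + 1) : ℝ) := by
    intro i hi
    have := Int.toNat_of_nonneg (hD i hi)
    have h2 : ((((D i - D (i + 1)).toNat : ℕ) : ℤ) : ℝ) = ((D i - D (i + 1) : ℤ) : ℝ) := by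
      rw [this]
    push_cast at h2; exact h2
  have hIci : ∀ i : Fin n, ∑ j ∈ Ici i, (((D j - D (j + 1)).toNat : ℕ) : ℝ) =
      (D i : ℝ) - (D n : ℝ) := by
    intro i
    rw [← sum_Ici_sub_succ (fun k => (D k : ℝ)) i]
    exact Finset.sum_congr rfl fun j _ => hDR j j.2
  have hDi : ∀ i : Fin n, D i = u i + (i : ℕ) := fun i => by simp [D]
  have hDn : D n = u z - K := by simp [D]
  have hsum : ∑ i : Fin n, (D i - D (i + 1)).toNat = K := by
    have h1 := hIci z
    rw [show Ici z = univ from Finset.eq_univ_of_forall fun i => by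
      simp [z], hDi, hDn] at h1
    have h2 : ((∑ i : Fin n, (D i - D (i + 1)).toNat : ℕ) : ℝ) = (K : ℝ) := by
      push_cast; rw [h1]; simp [z]
    exact_mod_cast h2
  refine ⟨Compos.mk' (fun i => (D i - D (i + 1)).toNat) hsum, σ, ?_, ?_⟩
  · refine eq_of_sum_eq_zero_of_sub_eq ?_ ?_ (c - ((n : ℝ) - 1) / 2 + D n +
      (∑ j : Fin n, ∑ k ∈ Ici j, (((D k - D (k + 1)).toNat : ℕ) : ℝ)) / n) ?_
    · rw [← hl]; exact Equiv.sum_comp σ l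
    · rw [Finset.sum_add_distrib, sum_weylVec, sum_domWeight, add_zero]
    · intro i
      simp only [Function.comp_apply, domWeight, centre, Compos.mk', weylVec, hIci, hlt]
      rw [hDi]
      simp only [hu, Function.comp_apply]
      push_cast
      ring
  · intro i j
    rw [domWeight_sub]
    simp only [Compos.mk', hIci]
    have h1 : D i ≤ u z := by
      rw [hDi]
      have : ∀ k : ℕ, ∀ hk : k < n, u ⟨k, hk⟩ + k ≤ u z := by
        intro k
        induction k with
        | zero => intro hk; simp [z]
        | succ k ih =>
          intro hk
          have h3 := ih (by omega)
          have h4 := hD k (by omega)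
          simp only [D, hk, show k < n by omega, dif_pos] at h4
          omega
      exact this i i.2
    have h2 : u z - k ≤ D j := by
      have hlast : ∀ d : ℕ, ∀ hd : n - 1 - d < n, d ≤ n - 1 → u z - k ≤ D (n - 1 - d) := by
        intro d
        induction d with
        | zero =>
          intro hd _
          have := hspr z ⟨n - 1, by omega⟩
          simp only [D, Nat.sub_zero, show n - 1 < n by omega, dif_pos]
          omega
        | succ d ih =>
          intro hd hd'
          have h3 := ih (by omega) (by omega)
          have h4 := hD (n - 1 - (d + 1)) hd
          rw [show n - 1 - (d + 1) + 1 = n - 1 - d by omega] at h4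
          omega
      have := hlast (n - 1 - j) (by omega) (by omega)
      rwa [show n - 1 - (n - 1 - (j : ℕ)) = j by omega] at this
    have h3 : ((D i - D j : ℤ) : ℝ) ≤ ((k : ℤ) : ℝ) := by
      exact_mod_cast (by omega : D i - D j ≤ (k : ℤ))
    push_cast at h3
    linarith

lemma sum_sq_weylVec_add_comp_lt {n : ℕ} (m : Fin n → ℕ) (v : Equiv.Perm (Fin n))
    (hv : domWeight m ∘ v ≠ domWeight m) :
    ∑ i, (weylVec n i + domWeight m (v i)) ^ 2 < ∑ i, (weylVec n i + domWeight m i) ^ 2 := by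
  have hmv : Monovary (weylVec n) (domWeight m) :=
    (weylVec_strictAnti n).antitone.monovary (domWeight_antitone m)
  have h1 : ∑ i, weylVec n i * domWeight m (v i) < ∑ i, weylVec n i * domWeight m i := by
    rw [hmv.sum_mul_comp_perm_lt_sum_mul_iff]
    intro hmono
    apply hv
    have ha : Monotone ((fun i => -domWeight m i) ∘ v) := by
      intro i j hij
      rcases hij.eq_or_lt with rfl | hlt
      · exact le_rfl
      · simp only [Function.comp_apply, neg_le_neg_iff]
        by_contra hcon
        push Not at hcon
        exact absurd (hmono hcon) (not_le.2 (weylVec_strictAnti n hlt))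
    have hb : Monotone ((fun i => -domWeight m i) ∘ (1 : Equiv.Perm (Fin n))) := by
      intro i j hij
      simpa using domWeight_antitone m hij
    have := Tuple.unique_monotone ha hb
    funext i
    simpa using congrFun this i
  have h2 : ∑ i, domWeight m (v i) ^ 2 = ∑ i, domWeight m i ^ 2 :=
    Equiv.sum_comp v (fun i => domWeight m i ^ 2)
  simp only [add_sq, Finset.sum_add_distrib, h2, mul_assoc, ← Finset.mul_sum]
  linarith

open InnerProductSpace in
/-- A triangular family of operators on a finite-dimensional inner product space which is closed
under taking adjoints is simultaneously diagonalised by Gram-Schmidt orthonormalisation. -/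
lemma exists_orthonormal_eigenvectors_of_triangular {E ι ℛ : Type*} [NormedAddCommGroup E]
    [InnerProductSpace ℂ E] [Fintype ι] (T : ℛ → E →ₗ[ℂ] E) (τ : ℛ → ℛ)
    (hadj : ∀ r x y, inner ℂ (T r x) y = inner ℂ x (T (τ r) y)) (v : ι → E)
    (hv : LinearIndependent ℂ v) (h : ι → ℝ) (e : ℛ → ι → ℂ)
    (htri : ∀ r a, T r (v a) - e r a • v a ∈ Submodule.span ℂ (v '' {b | h b < h a})) :
    ∃ Ψ : ι → E, Orthonormal ℂ Ψ ∧ ∀ r a, T r (Ψ a) = e r a • Ψ a := by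
  set N := Fintype.card ι
  let e0 : Fin N ≃ ι := (Fintype.equivFin ι).symm
  let σ := Tuple.sort (h ∘ e0)
  let ε : Fin N ≃ ι := σ.trans e0
  have hmono : Monotone (h ∘ ε) := Tuple.monotone_sort (h ∘ e0)
  let f : Fin N → E := v ∘ ε
  have hf : LinearIndependent ℂ f := hv.comp ε ε.injective
  let u : Fin N → E := gramSchmidtNormed ℂ f
  have hu : Orthonormal ℂ u := gramSchmidtNormed_orthonormal hf
  let S : Fin N → Submodule ℂ E := fun i => Submodule.span ℂ (f '' Set.Iio i)
  have hSu : ∀ i, S i = Submodule.span ℂ (u '' Set.Iio i) := fun i => by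
    rw [span_gramSchmidtNormed, span_gramSchmidt_Iio]
  have hTf : ∀ r i, T r (f i) - e r (ε i) • f i ∈ S i := by
    intro r i
    refine Submodule.span_mono ?_ (htri r (ε i))
    rintro _ ⟨b, hb, rfl⟩
    refine ⟨ε.symm b, ?_, by simp [f]⟩
    by_contra hcon
    have := hmono (not_lt.1 hcon)
    simp only [Function.comp_apply, Equiv.apply_symm_apply] at this
    exact absurd hb (not_lt.2 this)
  have hTS : ∀ r i, ∀ x ∈ S i, T r x ∈ S i := by
    intro r i x hx
    refine Submodule.span_induction (p := fun x _ => T r x ∈ S i) ?_ ?_ ?_ ?_ hx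
    · rintro _ ⟨j, hj, rfl⟩
      have h1 : S j ≤ S i := Submodule.span_mono
        (Set.image_mono (Set.Iio_subset_Iio (le_of_lt hj)))
      have h2 : f j ∈ S i := Submodule.subset_span ⟨j, hj, rfl⟩
      have := (S i).add_mem (h1 (hTf r j)) ((S i).smul_mem (e r (ε j)) h2)
      simpa using this
    · simp
    · intro x y _ _ hx hy; rw [map_add]; exact (S i).add_mem hx hy
    · intro c x _ hx; rw [map_smul]; exact (S i).smul_mem c hx
  have horth : ∀ i, ∀ x ∈ S i, inner ℂ (u i) x = 0 := by
    intro i x hx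
    rw [hSu] at hx
    refine Submodule.span_induction (p := fun x _ => inner ℂ (u i) x = 0) ?_ ?_ ?_ ?_ hx
    · rintro _ ⟨j, hj, rfl⟩
      exact hu.2 (ne_of_gt hj)
    · simp
    · intro x y _ _ hx hy; rw [inner_add_right, hx, hy, add_zero]
    · intro c x _ hx; rw [inner_smul_right, hx, mul_zero]
  have hz : ∀ r i, T r (u i) - e r (ε i) • u i ∈ S i := by
    intro r i
    obtain ⟨w, hw, hfw⟩ : ∃ w ∈ S i, f i = gramSchmidt ℂ f i + w := by
      refine ⟨_, ?_, gramSchmidt_def' ℂ f i⟩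
      refine Submodule.sum_mem _ fun j hj => ?_
      rw [Submodule.starProjection_singleton]
      refine Submodule.smul_mem _ _ ?_
      change gramSchmidt ℂ f j ∈ Submodule.span ℂ (f '' Set.Iio i)
      rw [← span_gramSchmidt_Iio ℂ f i]
      exact Submodule.subset_span ⟨j, Finset.mem_Iio.1 hj, rfl⟩
    have hg : gramSchmidt ℂ f i = f i - w := by rw [hfw, add_sub_cancel_right]
    have h1 : T r (gramSchmidt ℂ f i) - e r (ε i) • gramSchmidt ℂ f i ∈ S i := by
      rw [hg, map_sub, smul_sub]
      have := (S i).sub_mem (hTf r i)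
        ((S i).sub_mem (hTS r i w hw) ((S i).smul_mem (e r (ε i)) hw))
      convert this using 1
      abel
    simp only [u, gramSchmidtNormed, map_smul]
    rw [smul_comm, ← smul_sub]
    exact (S i).smul_mem _ h1
  refine ⟨u ∘ ε.symm, hu.comp _ ε.symm.injective, fun r a => ?_⟩
  obtain ⟨i, rfl⟩ := ε.surjective a
  simp only [Function.comp_apply, Equiv.symm_apply_apply]
  rw [← sub_eq_zero, ← inner_self_eq_zero (𝕜 := ℂ)]
  nth_rewrite 1 [inner_sub_left]
  rw [inner_smul_left, horth i _ (hz r i), hadj, horth i _ (hTS _ i _ (hz r i)), mul_zero, sub_zero]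

/-- Arithmetic data of a type (i) coupling: `q` is a positive inverse of `P` modulo `n`. -/
structure CouplingData (n K q : ℕ) (P : ℤ) : Prop where
  two_le : 2 ≤ n
  one_le_level : 1 ≤ K
  one_le_inv : 1 ≤ q
  dvd : (n : ℤ) ∣ P * q - 1

/-- The rescaled coupling `γ = (2πP - αK)/n`. -/
def gam (n K : ℕ) (P : ℤ) (α : ℝ) : ℝ := (2 * π * P - α * K) / n

/-- The sign of `sin((dγ + αS)/2)`. -/
def sgnSin (n : ℕ) (P : ℤ) (d : ℕ) : ℝ :=
  if d = n then (-1) ^ (P - 1) else (-1) ^ ((d : ℤ) * P / n)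

lemma negOne_zpow_mul_self (a : ℤ) : (-1 : ℝ) ^ a * (-1) ^ a = 1 := by
  rw [← mul_zpow]; simp

lemma sgnSin_mul_self (n : ℕ) (P : ℤ) (d : ℕ) : sgnSin n P d * sgnSin n P d = 1 := by
  unfold sgnSin; split_ifs <;> exact negOne_zpow_mul_self _

lemma sgnSin_ne_zero (n : ℕ) (P : ℤ) (d : ℕ) : sgnSin n P d ≠ 0 := fun h => by
  have := sgnSin_mul_self n P d
  rw [h, mul_zero] at this
  exact zero_ne_one this

section Signs

variable {n K q : ℕ} {P : ℤ} {α : ℝ}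

lemma le_mul_of_dvd_sub {n d a : ℤ} (hdn : d < n) (ha : 0 < a) (h : n ∣ a - d) : d ≤ a := by
  by_contra hcon
  push Not at hcon
  have h1 : n ∣ d - a := by rw [← neg_sub]; exact h.neg_right
  have := Int.le_of_dvd (by omega) h1
  omega

lemma CouplingData.sgnSin_mul_sin_pos (D : CouplingData n K q P) (hα : 0 < α)
    (hαK : α * K * q < 2 * π) {d : ℕ} (hd : 1 ≤ d) (hdn : d < n) {S : ℝ} (hS : 0 ≤ S)
    (hSK : S ≤ K) : 0 < sgnSin n P d * Real.sin ((d * gam n K P α + α * S) / 2) := by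
  have hn0 : (0 : ℤ) < n := by exact_mod_cast (by omega : 0 < n)
  have hnR : (0 : ℝ) < n := by exact_mod_cast hn0
  set f : ℤ := (d : ℤ) * P / n with hf
  set e : ℤ := (d : ℤ) * P % n with he
  have hfe : (d : ℤ) * P = n * f + e := (Int.mul_ediv_add_emod _ _).symm
  have he0 : 0 ≤ e := Int.emod_nonneg _ hn0.ne'
  have hen : e < n := Int.emod_lt_of_pos _ hn0
  obtain ⟨c, hc⟩ := D.dvd
  have hcong : (n : ℤ) ∣ e * q - d := ⟨d * c - f * q, by
    have : e = d * P - n * f := by linarith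
    rw [this]; linear_combination (d : ℤ) * hc⟩
  have hq : (0 : ℤ) < q := by exact_mod_cast D.one_le_inv
  have he1 : 0 < e := by
    rcases he0.eq_or_lt with h | h
    · rw [← h, zero_mul, zero_sub, dvd_neg] at hcong
      have := Int.le_of_dvd (by exact_mod_cast hd) hcong
      omega
    · exact h
  have h1 : (d : ℤ) ≤ e * q := le_mul_of_dvd_sub (n := n) (by exact_mod_cast hdn)
    (mul_pos he1 hq) hcong
  have h2 : (n : ℤ) - d ≤ (n - e) * q := le_mul_of_dvd_sub (n := n) (by omega)
    (mul_pos (by omega) hq) (by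
      obtain ⟨b, hb⟩ := hcong
      exact ⟨q - 1 - b, by linear_combination -hb⟩)
  have h1R : (d : ℝ) ≤ e * q := by exact_mod_cast h1
  have h2R : (n : ℝ) - d ≤ (n - e) * q := by exact_mod_cast h2
  have hKR : (0 : ℝ) < K := by exact_mod_cast D.one_le_level
  have hfeR : (d : ℝ) * P = n * f + e := by exact_mod_cast hfe
  have heR : (0 : ℝ) < e := by exact_mod_cast he1
  have henR : (0 : ℝ) < (n : ℝ) - e := by
    have : (e : ℝ) < n := by exact_mod_cast hen
    linarith
  set y : ℝ := (2 * π * e + α * (n * S - d * K)) / (2 * n) with hy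
  have hdn' : (d : ℝ) < n := by exact_mod_cast hdn
  have harg : (d * gam n K P α + α * S) / 2 = y + f * π := by
    rw [hy]; unfold gam; field_simp; linear_combination (2 * π) * hfeR
  have hαK' : 0 < α * K := mul_pos hα hKR
  have hy0 : 0 < y := by
    rw [hy]; apply div_pos _ (by positivity)
    have ha : α * K * d ≤ α * K * (e * q) := mul_le_mul_of_nonneg_left h1R hαK'.le
    have hb : α * K * q * e < 2 * π * e := mul_lt_mul_of_pos_right hαK heR
    have hc : 0 ≤ α * (n * S) := by positivity
    nlinarith
  have hyπ : y < π := by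
    rw [hy, div_lt_iff₀ (by positivity)]
    have ha : α * K * (n - d) ≤ α * K * ((n - e) * q) := mul_le_mul_of_nonneg_left h2R hαK'.le
    have hb : α * K * q * (n - e) < 2 * π * (n - e) := mul_lt_mul_of_pos_right hαK henR
    have hc : α * (n * S) ≤ α * (n * K) := by gcongr
    nlinarith
  have hsg : sgnSin n P d = (-1) ^ f := by
    rw [sgnSin, if_neg hdn.ne]
  rw [hsg, harg, Real.sin_add_int_mul_pi, ← mul_assoc, negOne_zpow_mul_self, one_mul]
  exact Real.sin_pos_of_pos_of_lt_pi hy0 hyπ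

lemma CouplingData.sin_pos (D : CouplingData n K q P) (hα : 0 < α) (hαK : α * K * q < 2 * π)
    {S : ℝ} (hS : 0 < S) (hSK : S ≤ K) : 0 < Real.sin (α * S / 2) := by
  apply Real.sin_pos_of_pos_of_lt_pi (by positivity)
  have hq : (1 : ℝ) ≤ q := by exact_mod_cast D.one_le_inv
  have h1 : α * S ≤ α * K := by gcongr
  have h2 : α * K * 1 ≤ α * K * q := mul_le_mul_of_nonneg_left hq (by positivity)
  linarith

lemma CouplingData.sin_zero_pos (D : CouplingData n K q P) (hα : 0 < α)
    (hαK : α * K * q < 2 * π) {S : ℝ} (hS : 0 < S) (hSK : S ≤ K) :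
    0 < sgnSin n P 0 * Real.sin (((0 : ℕ) * gam n K P α + α * S) / 2) := by
  have hn : (0 : ℕ) ≠ n := by have := D.two_le; omega
  have := D.sin_pos hα hαK hS hSK
  simpa [sgnSin, hn] using this

lemma CouplingData.sin_last (D : CouplingData n K q P) (S : ℝ) :
    sgnSin n P n * Real.sin ((n * gam n K P α + α * S) / 2) = Real.sin (α * (K - S) / 2) := by
  have hnR : (n : ℝ) ≠ 0 := by have := D.two_le; exact_mod_cast (by omega : n ≠ 0)
  have h : (n * gam n K P α + α * S) / 2 = -(α * (K - S) / 2) + P * π := by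
    unfold gam; field_simp; ring
  rw [h, Real.sin_add_int_mul_pi, Real.sin_neg, sgnSin, if_pos rfl,
    zpow_sub_one₀ (by norm_num : (-1 : ℝ) ≠ 0)]
  have := negOne_zpow_mul_self P
  norm_num
  linear_combination (Real.sin (α * (K - S) / 2)) * this

lemma CouplingData.sgnSin_last_mul_sin_pos (D : CouplingData n K q P) (hα : 0 < α)
    (hαK : α * K * q < 2 * π) {S : ℝ} (hS : 0 ≤ S) (hSK : S < K) :
    0 < sgnSin n P n * Real.sin ((n * gam n K P α + α * S) / 2) := by
  rw [D.sin_last]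
  exact D.sin_pos hα hαK (by linarith) (by linarith)

end Signs

section Angles

variable {n : ℕ}

/-- The angles attached to the successive gaps `γ + α x_k`. -/
def ang (α γ : ℝ) (x : Fin n → ℝ) : Fin n → ℝ :=
  centre fun k => -((k : ℝ) * γ + α * ∑ i ∈ Iio k, x i)

lemma sum_ang [NeZero n] (α γ : ℝ) (x : Fin n → ℝ) : ∑ i, ang α γ x i = 0 := sum_centre _

lemma ang_sub (α γ : ℝ) (x : Fin n → ℝ) {i j : Fin n} (h : i ≤ j) :
    ang α γ x i - ang α γ x j = ((j : ℝ) - i) * γ + α * ∑ k ∈ Ico i j, x k := by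
  have h1 : ∑ k ∈ Iio j, x k = ∑ k ∈ Iio i, x k + ∑ k ∈ Ico i j, x k := by
    rw [← Finset.sum_union]
    · congr 1; ext k; simp only [Finset.mem_union, Finset.mem_Iio, Finset.mem_Ico]
      constructor
      · intro hk
        rcases lt_or_ge k i with h2 | h2
        · exact Or.inl h2
        · exact Or.inr ⟨h2, hk⟩
      · rintro (hk | hk)
        · exact hk.trans_le h
        · exact hk.2
    · rw [Finset.disjoint_left]; intro k hk hk'
      exact absurd (Finset.mem_Iio.1 hk) (not_lt.2 (Finset.mem_Ico.1 hk').1)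
  simp only [ang, centre, h1]
  ring

/-- The cyclic distance from `i` to `j`. -/
def cycD (i j : Fin n) : ℕ := if i < j then (j : ℕ) - i else n - (i - j)

/-- The sum of `x` over the cyclic interval from `i` to `j`. -/
def cycS (x : Fin n → ℝ) (i j : Fin n) : ℝ :=
  if i < j then ∑ k ∈ Ico i j, x k else ∑ k, x k - ∑ k ∈ Ico j i, x k

lemma cycD_eq_val_sub {i j : Fin n} (h : i ≠ j) : cycD i j = ((j - i : Fin n) : ℕ) := by
  unfold cycD
  split_ifs with h1
  · rw [Fin.coe_sub_iff_le.2 h1.le]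
  · have h2 : j < i := lt_of_le_of_ne (not_lt.1 h1) (Ne.symm h)
    rw [Fin.coe_sub_iff_lt.2 h2]
    have : (j : ℕ) < i := h2
    omega

lemma one_le_cycD {i j : Fin n} (h : i ≠ j) : 1 ≤ cycD i j := by
  have h' : (i : ℕ) ≠ j := fun hc => h (Fin.ext hc)
  unfold cycD
  split_ifs with h1
  · have : (i : ℕ) < j := h1
    omega
  · omega

lemma cycD_lt {i j : Fin n} (h : i ≠ j) : cycD i j < n := by
  have h' : (i : ℕ) ≠ j := fun hc => h (Fin.ext hc)
  unfold cycD
  split_ifs with h1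
  · have : (i : ℕ) < j := h1
    omega
  · have : ¬ (i : ℕ) < j := h1
    omega

lemma cycS_nonneg {x : Fin n → ℝ} (hx : ∀ k, 0 ≤ x k) (i j : Fin n) : 0 ≤ cycS x i j := by
  unfold cycS
  split_ifs
  · exact Finset.sum_nonneg fun k _ => hx k
  · exact sub_nonneg.2 (Finset.sum_le_sum_of_subset_of_nonneg (Finset.subset_univ _)
      fun k _ _ => hx k)

lemma cycS_le {x : Fin n → ℝ} (hx : ∀ k, 0 ≤ x k) (i j : Fin n) : cycS x i j ≤ ∑ k, x k := by
  unfold cycS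
  split_ifs
  · exact Finset.sum_le_sum_of_subset_of_nonneg (Finset.subset_univ _) fun k _ _ => hx k
  · exact sub_le_self _ (Finset.sum_nonneg fun k _ => hx k)

lemma val_add_one_eq [NeZero n] (hn : 2 ≤ n) (j : Fin n) :
    ((j + 1 : Fin n) : ℕ) = if (j : ℕ) + 1 = n then 0 else (j : ℕ) + 1 := by
  have h1 : ((1 : Fin n) : ℕ) = 1 := by
    rw [Fin.val_one', Nat.mod_eq_of_lt (by omega)]
  rw [Fin.val_add, h1]
  split_ifs with h
  · rw [h, Nat.mod_self]
  · exact Nat.mod_eq_of_lt (by have := j.2; omega)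

lemma add_one_ne_self [NeZero n] (hn : 2 ≤ n) (j : Fin n) : j + 1 ≠ j := by
  intro h
  have := congrArg Fin.val h
  rw [val_add_one_eq hn] at this
  split_ifs at this <;> omega

lemma cycD_add_one_eq_iff [NeZero n] (hn : 2 ≤ n) {i j : Fin n} (h : i ≠ j) :
    cycD i j + 1 = n ↔ i = j + 1 := by
  have h' : (i : ℕ) ≠ j := fun hc => h (Fin.ext hc)
  rw [Fin.ext_iff, val_add_one_eq hn]
  have := i.2
  have := j.2
  unfold cycD
  simp only [Fin.lt_def]
  split_ifs <;> omega

lemma cycS_add_one [NeZero n] (hn : 2 ≤ n) (x : Fin n → ℝ) (j : Fin n) :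
    cycS x (j + 1) j = ∑ k, x k - x j := by
  have hv := val_add_one_eq hn j
  unfold cycS
  simp only [Fin.lt_def, hv]
  split_ifs with h1 h2 h2
  · have : Ico (j + 1) j = univ.erase j := by
      ext k
      simp only [Finset.mem_Ico, Fin.le_def, Fin.lt_def, hv, h1, if_true, Finset.mem_erase,
        Finset.mem_univ, and_true, ne_eq, Fin.ext_iff]
      have := k.2
      omega
    rw [this, ← Finset.add_sum_erase univ x (Finset.mem_univ j)]
    ring
  · omega
  · omega
  · have : Ico j (j + 1) = {j} := by
      ext k
      simp only [Finset.mem_Ico, Fin.le_def, Fin.lt_def, hv, h1, if_false,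
        Finset.mem_singleton, Fin.ext_iff]
      omega
    rw [this, Finset.sum_singleton]

/-- The sign relating sines of differences of angles to sines of cyclic gaps. -/
def wrapSgn (P : ℤ) (i j : Fin n) : ℝ := if i < j then 1 else (-1) ^ P

lemma wrapSgn_ne_zero (P : ℤ) (i j : Fin n) : wrapSgn P i j ≠ 0 := by
  unfold wrapSgn
  split_ifs
  · exact one_ne_zero
  · exact zpow_ne_zero _ (by norm_num)

lemma sin_ang_sub_add {K : ℕ} {P : ℤ} (hn : 2 ≤ n) (α δ : ℝ) {x : Fin n → ℝ}
    (hx : ∑ k, x k = K) {i j : Fin n} (h : i ≠ j) :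
    Real.sin ((ang α (gam n K P α) x i - ang α (gam n K P α) x j + δ) / 2) =
      wrapSgn P i j * Real.sin ((cycD i j * gam n K P α + α * cycS x i j + δ) / 2) := by
  unfold wrapSgn cycD cycS
  split_ifs with h1
  · rw [ang_sub _ _ _ h1.le, one_mul, Nat.cast_sub (le_of_lt h1)]
  · have h2 : j < i := lt_of_le_of_ne (not_lt.1 h1) (Ne.symm h)
    have h3 := ang_sub α (gam n K P α) x h2.le
    have hnR : (n : ℝ) ≠ 0 := by exact_mod_cast (by omega : n ≠ 0)
    have h4 : n * gam n K P α = 2 * π * P - α * K := by unfold gam; field_simp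
    have h5 : (j : ℕ) < i := h2
    rw [← Real.sin_add_int_mul_pi, ← sub_eq_zero, ← sub_eq_zero, hx]
    rw [Nat.cast_sub (by omega), Nat.cast_sub (by omega)]
    have h6 : (ang α (gam n K P α) x i - ang α (gam n K P α) x j + δ) / 2 =
      ((n - ((i : ℝ) - j)) * gam n K P α + α * (K - ∑ k ∈ Ico j i, x k) + δ) / 2 - P * π := by
      linear_combination -h3 / 2 - h4 / 2
    rw [h6, sub_zero, sub_eq_zero, Real.sin_add_int_mul_pi, Real.sin_sub_int_mul_pi]

/-- The sign of a factor of the coefficients, as a function of the cyclic distance. -/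
def gapSgn (n : ℕ) (P : ℤ) (d : Fin n) : ℝ := sgnSin n P (d + 1) * sgnSin n P d

lemma gapSgn_ne_zero (P : ℤ) (d : Fin n) : gapSgn n P d ≠ 0 :=
  mul_ne_zero (sgnSin_ne_zero _ _ _) (sgnSin_ne_zero _ _ _)

variable {K q : ℕ} {P : ℤ} {α : ℝ}

lemma CouplingData.sin_ang_sub_ne_zero (D : CouplingData n K q P) (hα : 0 < α)
    (hαK : α * K * q < 2 * π) {x : Fin n → ℝ} (hx0 : ∀ k, 0 ≤ x k) (hx : ∑ k, x k = K)
    {i j : Fin n} (h : i ≠ j) :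
    Real.sin ((ang α (gam n K P α) x i - ang α (gam n K P α) x j) / 2) ≠ 0 := by
  have h1 := sin_ang_sub_add (P := P) D.two_le α 0 hx h
  rw [add_zero, add_zero] at h1
  rw [h1]
  have h2 := D.sgnSin_mul_sin_pos hα hαK (one_le_cycD h) (cycD_lt h) (cycS_nonneg hx0 i j)
    ((cycS_le hx0 i j).trans_eq hx)
  exact mul_ne_zero (wrapSgn_ne_zero _ _ _) (right_ne_zero_of_mul h2.ne')

lemma ratio_eq [NeZero n] (D : CouplingData n K q P) {x : Fin n → ℝ} (hx : ∑ k, x k = K)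
    {i j : Fin n} (h : i ≠ j) :
    gapSgn n P (j - i) *
      (Real.sin ((ang α (gam n K P α) x i - ang α (gam n K P α) x j + gam n K P α) / 2) /
        Real.sin ((ang α (gam n K P α) x i - ang α (gam n K P α) x j) / 2)) =
    (sgnSin n P (cycD i j + 1) *
      Real.sin (((cycD i j + 1 : ℕ) * gam n K P α + α * cycS x i j) / 2)) /
    (sgnSin n P (cycD i j) * Real.sin ((cycD i j * gam n K P α + α * cycS x i j) / 2)) := by
  have h1 := sin_ang_sub_add (P := P) D.two_le α 0 hx h
  rw [add_zero, add_zero] at h1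
  rw [h1, sin_ang_sub_add D.two_le α _ hx h, mul_div_mul_left _ _ (wrapSgn_ne_zero _ _ _)]
  have h2 : cycD i j * gam n K P α + α * cycS x i j + gam n K P α =
    (cycD i j + 1 : ℕ) * gam n K P α + α * cycS x i j := by push_cast; ring
  rw [h2, gapSgn, ← cycD_eq_val_sub h]
  have h4 := sgnSin_mul_self n P (cycD i j)
  have h5 : (sgnSin n P (cycD i j))⁻¹ = sgnSin n P (cycD i j) := inv_eq_of_mul_eq_one_left h4
  simp only [div_eq_mul_inv, mul_inv, h5]
  ring

lemma CouplingData.ratio_pos [NeZero n] (D : CouplingData n K q P) (hα : 0 < α)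
    (hαK : α * K * q < 2 * π) {x : Fin n → ℝ} (hx0 : ∀ k, 0 ≤ x k) (hx : ∑ k, x k = K)
    {i j : Fin n} (h : i ≠ j) (hij : i = j + 1 → 0 < x j) :
    0 < gapSgn n P (j - i) *
      (Real.sin ((ang α (gam n K P α) x i - ang α (gam n K P α) x j + gam n K P α) / 2) /
        Real.sin ((ang α (gam n K P α) x i - ang α (gam n K P α) x j) / 2)) := by
  rw [ratio_eq D hx h]
  apply div_pos _ (D.sgnSin_mul_sin_pos hα hαK (one_le_cycD h) (cycD_lt h) (cycS_nonneg hx0 i j)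
    ((cycS_le hx0 i j).trans_eq hx))
  by_cases hc : i = j + 1
  · rw [(cycD_add_one_eq_iff D.two_le h).2 hc]
    apply D.sgnSin_last_mul_sin_pos hα hαK (cycS_nonneg hx0 i j)
    have := hij hc
    rw [hc, cycS_add_one D.two_le, hx]
    linarith
  · have h1 : cycD i j + 1 ≠ n := fun h' => hc ((cycD_add_one_eq_iff D.two_le h).1 h')
    have h2 := cycD_lt h
    exact D.sgnSin_mul_sin_pos hα hαK (by omega) (by omega) (cycS_nonneg hx0 i j)
      ((cycS_le hx0 i j).trans_eq hx)

lemma CouplingData.ratio_eq_zero [NeZero n] (D : CouplingData n K q P) {x : Fin n → ℝ}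
    (hx : ∑ k, x k = K) {i j : Fin n} (hij : i = j + 1) (hxj : x j = 0) :
    Real.sin ((ang α (gam n K P α) x i - ang α (gam n K P α) x j + gam n K P α) / 2) /
        Real.sin ((ang α (gam n K P α) x i - ang α (gam n K P α) x j) / 2) = 0 := by
  have h : i ≠ j := by rw [hij]; exact add_one_ne_self D.two_le j
  have h1 := ratio_eq (α := α) D hx h
  rw [(cycD_add_one_eq_iff D.two_le h).2 hij, D.sin_last, hij, cycS_add_one D.two_le, hx, hxj] at h1
  rw [hij]
  simpa [gapSgn_ne_zero] using h1

/-- The sign of the coefficient `V_J` on the simplex. -/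
def stepSgn [NeZero n] (P : ℤ) (J : Finset (Fin n)) : ℝ :=
  ∏ i ∈ J, ∏ j ∈ Jᶜ, gapSgn n P (j - i)

lemma prod_prod_compl_sub [NeZero n] (F : Fin n → ℝ) (hF : ∀ d, F d ≠ 0) (J : Finset (Fin n)) :
    ∏ i ∈ J, ∏ j ∈ Jᶜ, F (j - i) = ∏ i ∈ Jᶜ, ∏ j ∈ J, F (j - i) := by
  have h0 : ∏ i ∈ J, ∏ j ∈ J, F (j - i) ≠ 0 :=
    Finset.prod_ne_zero_iff.2 fun i _ => Finset.prod_ne_zero_iff.2 fun j _ => hF _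
  apply mul_left_cancel₀ h0
  have h1 : ∀ i, ∏ j, F (j - i) = ∏ d, F d := fun i => Equiv.prod_comp (Equiv.subRight i) F
  have h2 : ∀ j, ∏ i, F (j - i) = ∏ d, F d := fun j => Equiv.prod_comp (Equiv.subLeft j) F
  have hl : (∏ i ∈ J, ∏ j ∈ J, F (j - i)) * ∏ i ∈ J, ∏ j ∈ Jᶜ, F (j - i) =
      ∏ i ∈ J, ∏ d, F d := by
    rw [← Finset.prod_mul_distrib]
    exact Finset.prod_congr rfl fun i _ => by
      rw [Finset.prod_mul_prod_compl J fun j => F (j - i), h1]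
  have hr : (∏ i ∈ J, ∏ j ∈ J, F (j - i)) * ∏ i ∈ Jᶜ, ∏ j ∈ J, F (j - i) =
      ∏ i ∈ J, ∏ d, F d := by
    rw [Finset.prod_comm (s := Jᶜ), Finset.prod_comm (s := J) (t := J),
      ← Finset.prod_mul_distrib]
    exact Finset.prod_congr rfl fun j _ => by
      rw [Finset.prod_mul_prod_compl J fun i => F (j - i), h2]
  rw [hl, hr]

lemma stepSgn_compl [NeZero n] (P : ℤ) (J : Finset (Fin n)) :
    stepSgn P Jᶜ = stepSgn P J := by
  unfold stepSgn
  rw [compl_compl, prod_prod_compl_sub _ (gapSgn_ne_zero P) J]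

lemma stepSgn_mul_self [NeZero n] (P : ℤ) (J : Finset (Fin n)) :
    stepSgn P J * stepSgn P J = 1 := by
  unfold stepSgn
  simp only [← Finset.prod_mul_distrib]
  refine Finset.prod_eq_one fun i _ => Finset.prod_eq_one fun j _ => ?_
  rw [gapSgn, mul_mul_mul_comm, sgnSin_mul_self, sgnSin_mul_self, one_mul]

lemma CouplingData.stepSgn_mul_coefV_pos [NeZero n] (D : CouplingData n K q P) (hα : 0 < α)
    (hαK : α * K * q < 2 * π) {x : Fin n → ℝ} (hx0 : ∀ k, 0 ≤ x k) (hx : ∑ k, x k = K)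
    {J : Finset (Fin n)} (hJ : ∀ j, j ∉ J → j + 1 ∈ J → 0 < x j) :
    0 < stepSgn P J * coefV (gam n K P α) J (ang α (gam n K P α) x) := by
  unfold stepSgn coefV
  simp only [← Finset.prod_mul_distrib]
  refine Finset.prod_pos fun i hi => Finset.prod_pos fun j hj => ?_
  rw [Finset.mem_compl] at hj
  refine D.ratio_pos hα hαK hx0 hx (fun h => hj (h ▸ hi)) fun h => hJ j hj (h ▸ hi)

lemma CouplingData.coefV_eq_zero [NeZero n] (D : CouplingData n K q P) {x : Fin n → ℝ}
    (hx : ∑ k, x k = K) {J : Finset (Fin n)} {j : Fin n} (hj : j ∉ J) (hj1 : j + 1 ∈ J)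
    (hxj : x j = 0) : coefV (gam n K P α) J (ang α (gam n K P α) x) = 0 :=
  Finset.prod_eq_zero hj1 (Finset.prod_eq_zero (Finset.mem_compl.2 hj)
    (D.ratio_eq_zero hx rfl hxj))

end Angles

section Steps

variable {n : ℕ} [NeZero n]

/-- `m'` is obtained from `m` by moving the particles labelled by `J`. -/
def Step (J : Finset (Fin n)) (m m' : Fin n → ℕ) : Prop :=
  ∀ k, m' k + (if k + 1 ∈ J then 1 else 0) = m k + (if k ∈ J then 1 else 0)

lemma Step.compl {J : Finset (Fin n)} {m m' : Fin n → ℕ} (h : Step J m m') : Step Jᶜ m' m := by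
  intro k
  have := h k
  simp only [Finset.mem_compl]
  split_ifs at this ⊢ <;> omega

lemma step_compl_iff {J : Finset (Fin n)} {m m' : Fin n → ℕ} : Step Jᶜ m' m ↔ Step J m m' :=
  ⟨fun h => by simpa using h.compl, Step.compl⟩

lemma Step.unique {J : Finset (Fin n)} {m m' m'' : Fin n → ℕ} (h : Step J m m')
    (h' : Step J m m'') : m' = m'' := by
  funext k
  have h1 := h k
  have h2 := h' k
  omega

lemma exists_step {K : ℕ} (m : Compos n K) (J : Finset (Fin n))
    (hJ : ∀ j, j ∉ J → j + 1 ∈ J → 0 < m.1 j) : ∃ m' : Compos n K, Step J m.1 m'.1 := by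
  have h1 : ∀ k, (m.1 k + (if k ∈ J then 1 else 0) - (if k + 1 ∈ J then 1 else 0)) +
      (if k + 1 ∈ J then 1 else 0) = m.1 k + (if k ∈ J then 1 else 0) := by
    intro k
    have := hJ k
    by_cases h1 : k ∈ J <;> by_cases h2 : k + 1 ∈ J <;> simp only [h1, h2, if_true, if_false]
    · omega
    · omega
    · have := this h1 h2
      omega
    · omega
  refine ⟨Compos.mk' (fun k => m.1 k + (if k ∈ J then 1 else 0) -
    (if k + 1 ∈ J then 1 else 0)) ?_, h1⟩
  have h2 := Finset.sum_congr (rfl : (univ : Finset (Fin n)) = univ) fun k _ => h1 k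
  have h3 : ∑ k : Fin n, (if k + 1 ∈ J then 1 else 0) = ∑ k : Fin n, if k ∈ J then 1 else 0 :=
    Equiv.sum_comp (Equiv.addRight (1 : Fin n)) fun k => if k ∈ J then 1 else 0
  rw [Finset.sum_add_distrib, Finset.sum_add_distrib, m.sum_eq, h3] at h2
  exact Nat.add_right_cancel h2

lemma Step.sum_Iio {J : Finset (Fin n)} {m m' : Fin n → ℕ} (h : Step J m m') (k : Fin n) :
    ∑ i ∈ Iio k, (m' i : ℝ) + indVec J k = ∑ i ∈ Iio k, (m i : ℝ) + indVec J 0 := by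
  obtain ⟨k, hk⟩ := k
  induction k with
  | zero =>
    have h0 : (⟨0, hk⟩ : Fin n) = 0 := Fin.ext (by simp)
    have h1 : Iio (0 : Fin n) = ∅ := by ext i; simp
    rw [h0, h1]; simp
  | succ k ih =>
    have hk' : k < n := by omega
    have h1 : (⟨k, hk'⟩ : Fin n) + 1 = ⟨k + 1, hk⟩ := by
      apply Fin.ext
      rw [val_add_one_eq (by omega)]
      simp only
      rw [if_neg (by omega)]
    have h2 : Iio (⟨k + 1, hk⟩ : Fin n) = insert ⟨k, hk'⟩ (Iio ⟨k, hk'⟩) := by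
      ext i
      simp only [Finset.mem_Iio, Finset.mem_insert, Fin.lt_def, Fin.ext_iff]
      omega
    have h3 := h ⟨k, hk'⟩
    rw [h1] at h3
    have h4 : (m' ⟨k, hk'⟩ : ℝ) + indVec J ⟨k + 1, hk⟩ = m ⟨k, hk'⟩ + indVec J ⟨k, hk'⟩ := by
      simp only [indVec]; exact_mod_cast h3
    rw [h2, Finset.sum_insert (by simp), Finset.sum_insert (by simp)]
    have := ih hk'
    linarith

lemma Step.ang_eq {J : Finset (Fin n)} {m m' : Fin n → ℕ} (h : Step J m m') (α γ : ℝ) :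
    ang α γ (fun k => (m' k : ℝ)) =
      fun i => ang α γ (fun k => (m k : ℝ)) i + α * indVec J i - α * (J.card / n) := by
  have hn : (n : ℝ) ≠ 0 := by exact_mod_cast NeZero.ne n
  have h0 := sum_mul_indVec J (fun _ => (1 : ℝ))
  simp only [one_mul, Finset.sum_const, nsmul_eq_mul, mul_one] at h0
  refine eq_of_sum_eq_zero_of_sub_eq (sum_ang _ _ _) ?_
    (α * (J.card / n) - α * indVec J 0 + (∑ j : Fin n, ((j : ℝ) * γ + α * ∑ i ∈ Iio j, (m' i : ℝ)))
      / n - (∑ j : Fin n, ((j : ℝ) * γ + α * ∑ i ∈ Iio j, (m i : ℝ))) / n) ?_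
  · simp only [Finset.sum_sub_distrib, Finset.sum_add_distrib, sum_ang, ← Finset.mul_sum, h0,
      Finset.sum_const, Finset.card_univ, Fintype.card_fin, nsmul_eq_mul]
    field_simp; ring
  · intro i
    have h1 := h.sum_Iio i
    simp only [ang, centre, Finset.sum_neg_distrib]
    linear_combination (-α) * h1

lemma Step.sum_Ico {J : Finset (Fin n)} {m m' : Fin n → ℕ} (h : Step J m m') {i j : Fin n}
    (hij : i ≤ j) : ∑ k ∈ Ico i j, m' k + (if j ∈ J then 1 else 0) =
      ∑ k ∈ Ico i j, m k + (if i ∈ J then 1 else 0) := by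
  have h1 := congrFun (h.ang_eq 1 0) i
  have h2 := congrFun (h.ang_eq 1 0) j
  have h3 := ang_sub 1 0 (fun k => (m k : ℝ)) hij
  have h4 := ang_sub 1 0 (fun k => (m' k : ℝ)) hij
  have h5 : ∑ k ∈ Ico i j, (m' k : ℝ) + indVec J j = ∑ k ∈ Ico i j, (m k : ℝ) + indVec J i := by
    linarith
  simp only [indVec] at h5
  exact_mod_cast h5

end Steps

section Gauge

variable {n : ℕ}

/-- The pair factor of the gauge function. -/
def gaugeFactor (α γ d : ℝ) (S : ℕ) : ℝ :=
  Real.sin ((d * γ + α * S) / 2) *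
    ∏ l ∈ range S, Real.sin (((d + 1) * γ + α * l) / 2) / Real.sin (((d - 1) * γ + α * (l + 1)) / 2)

/-- The gauge function relating the difference operators to self-adjoint ones. -/
def gaugeFun (α γ : ℝ) (m : Fin n → ℕ) : ℝ :=
  ∏ i : Fin n, ∏ k ∈ Ioi i, gaugeFactor α γ ((k : ℝ) - i) (∑ j ∈ Ico i k, m j)

lemma gaugeFactor_succ (α γ d : ℝ) (S : ℕ) (h1 : Real.sin ((d * γ + α * S) / 2) ≠ 0)
    (h2 : Real.sin ((d * γ + α * (S + 1)) / 2) ≠ 0)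
    (h3 : Real.sin (((d - 1) * γ + α * (S + 1)) / 2) ≠ 0) :
    Real.sin (((d + 1) * γ + α * S) / 2) / Real.sin ((d * γ + α * S) / 2) * gaugeFactor α γ d S =
      Real.sin (((d - 1) * γ + α * (S + 1)) / 2) / Real.sin ((d * γ + α * (S + 1)) / 2) *
        gaugeFactor α γ d (S + 1) := by
  unfold gaugeFactor
  rw [Finset.prod_range_succ]
  push_cast
  generalize (∏ l ∈ range S, Real.sin (((d + 1) * γ + α * l) / 2) /
    Real.sin (((d - 1) * γ + α * (l + 1)) / 2)) = Z
  generalize Real.sin (((d - 1) * γ + α * (S + 1)) / 2) = A at *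
  generalize Real.sin ((d * γ + α * (S + 1)) / 2) = B at *
  field_simp

variable {K q : ℕ} {P : ℤ} {α : ℝ}

lemma Compos.sum_Ico_le (m : Compos n K) (i k : Fin n) : ∑ j ∈ Ico i k, m.1 j ≤ K :=
  (Finset.sum_le_sum_of_subset (Finset.subset_univ _)).trans_eq m.sum_eq

lemma CouplingData.sin_gap_ne_zero (D : CouplingData n K q P) (hα : 0 < α)
    (hαK : α * K * q < 2 * π) {i k : Fin n} (h : i < k) {S : ℝ} (hS : 0 ≤ S) (hSK : S ≤ K) :
    Real.sin ((((k : ℝ) - i) * gam n K P α + α * S) / 2) ≠ 0 := by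
  have h' : (i : ℕ) < k := h
  have := D.sgnSin_mul_sin_pos hα hαK (d := (k : ℕ) - i) (by omega) (by omega) hS hSK
  rw [Nat.cast_sub h'.le] at this
  exact right_ne_zero_of_mul this.ne'

lemma CouplingData.sin_gap_pred_ne_zero (D : CouplingData n K q P) (hα : 0 < α)
    (hαK : α * K * q < 2 * π) {i k : Fin n} (h : i < k) {S : ℝ} (hS : 0 < S) (hSK : S ≤ K) :
    Real.sin ((((k : ℝ) - i - 1) * gam n K P α + α * S) / 2) ≠ 0 := by
  have h' : (i : ℕ) < k := h
  have h2 : 0 < sgnSin n P (k - i - 1) *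
      Real.sin (((k - i - 1 : ℕ) * gam n K P α + α * S) / 2) := by
    rcases Nat.eq_zero_or_pos ((k : ℕ) - i - 1) with h0 | h0
    · rw [h0]; exact D.sin_zero_pos hα hαK hS hSK
    · exact D.sgnSin_mul_sin_pos hα hαK h0 (by omega) hS.le hSK
  rw [Nat.cast_sub (by omega), Nat.cast_sub h'.le, Nat.cast_one] at h2
  exact right_ne_zero_of_mul h2.ne'

lemma CouplingData.sin_gap_succ_ne_zero (D : CouplingData n K q P) (hα : 0 < α)
    (hαK : α * K * q < 2 * π) {i k : Fin n} (h : i < k) {S : ℝ} (hS : 0 ≤ S) (hSK : S < K) :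
    Real.sin ((((k : ℝ) - i + 1) * gam n K P α + α * S) / 2) ≠ 0 := by
  have h' : (i : ℕ) < k := h
  have h2 : 0 < sgnSin n P (k - i + 1) *
      Real.sin (((k - i + 1 : ℕ) * gam n K P α + α * S) / 2) := by
    by_cases h0 : (k : ℕ) - i + 1 = n
    · rw [h0]; exact D.sgnSin_last_mul_sin_pos hα hαK hS hSK
    · exact D.sgnSin_mul_sin_pos hα hαK (by omega) (by omega) hS hSK.le
  rw [Nat.cast_add, Nat.cast_sub h'.le, Nat.cast_one] at h2
  exact right_ne_zero_of_mul h2.ne'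

lemma CouplingData.gauge_ne_zero (D : CouplingData n K q P) (hα : 0 < α)
    (hαK : α * K * q < 2 * π) (m : Compos n K) : gaugeFun α (gam n K P α) m.1 ≠ 0 := by
  unfold gaugeFun
  refine Finset.prod_ne_zero_iff.2 fun i _ => Finset.prod_ne_zero_iff.2 fun k hk => ?_
  have hik := Finset.mem_Ioi.1 hk
  have hS : ((∑ j ∈ Ico i k, m.1 j : ℕ) : ℝ) ≤ K := by exact_mod_cast m.sum_Ico_le i k
  refine mul_ne_zero (D.sin_gap_ne_zero hα hαK hik (Nat.cast_nonneg _) hS)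
    (Finset.prod_ne_zero_iff.2 fun l hl => div_ne_zero ?_ ?_)
  · have : (l : ℝ) + 1 ≤ ((∑ j ∈ Ico i k, m.1 j : ℕ) : ℝ) := by
      exact_mod_cast Finset.mem_range.1 hl
    exact D.sin_gap_succ_ne_zero hα hαK hik (Nat.cast_nonneg _) (by linarith)
  · have : (l : ℝ) + 1 ≤ ((∑ j ∈ Ico i k, m.1 j : ℕ) : ℝ) := by
      exact_mod_cast Finset.mem_range.1 hl
    exact D.sin_gap_pred_ne_zero hα hαK hik (by positivity) (by linarith)

/-- The angles of a lattice point. -/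
def latAng (P : ℤ) (α : ℝ) (m : Compos n K) : Fin n → ℝ :=
  ang α (gam n K P α) fun k => (m.1 k : ℝ)

/-- The value of the coefficient `V_J` at a lattice point. -/
def latCoef (P : ℤ) (α : ℝ) (J : Finset (Fin n)) (m : Compos n K) : ℝ :=
  coefV (gam n K P α) J (latAng P α m)

lemma sin_div_sin_neg (a b : ℝ) : Real.sin (-a) / Real.sin (-b) = Real.sin a / Real.sin b := by
  rw [Real.sin_neg, Real.sin_neg, neg_div_neg_eq]

lemma pairV_exchange (D : CouplingData n K q P) (hα : 0 < α)
    (hαK : α * K * q < 2 * π) {m m' : Compos n K} {J : Finset (Fin n)} {i k : Fin n} (h : i < k)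
    (hi : i ∈ J) (hk : k ∉ J)
    (hS : ∑ j ∈ Ico i k, m'.1 j = ∑ j ∈ Ico i k, m.1 j + 1) :
    pairV (gam n K P α) J (latAng P α m) i k * pairV (gam n K P α) J (latAng P α m) k i *
        gaugeFactor α (gam n K P α) ((k : ℝ) - i) (∑ j ∈ Ico i k, m.1 j) =
      pairV (gam n K P α) Jᶜ (latAng P α m') i k * pairV (gam n K P α) Jᶜ (latAng P α m') k i *
        gaugeFactor α (gam n K P α) ((k : ℝ) - i) (∑ j ∈ Ico i k, m'.1 j) := by
  set S := ∑ j ∈ Ico i k, m.1 j with hSdef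
  have e1 : latAng P α m i - latAng P α m k = ((k : ℝ) - i) * gam n K P α + α * S := by
    rw [latAng, ang_sub _ _ _ h.le, hSdef]; push_cast; rfl
  have e2 : latAng P α m' i - latAng P α m' k = ((k : ℝ) - i) * gam n K P α + α * (S + 1) := by
    rw [latAng, ang_sub _ _ _ h.le, ← Nat.cast_sum, hS]; push_cast; rfl
  have hSK : (S : ℝ) + 1 ≤ K := by
    have := m'.sum_Ico_le i k
    rw [hS] at this
    exact_mod_cast this
  have hS0 : (0 : ℝ) ≤ S := Nat.cast_nonneg _
  have key := gaugeFactor_succ α (gam n K P α) ((k : ℝ) - i) S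
    (D.sin_gap_ne_zero hα hαK h hS0 (by linarith))
    (D.sin_gap_ne_zero hα hαK h (by linarith) hSK)
    (D.sin_gap_pred_ne_zero hα hαK h (by linarith) hSK)
  rw [hS]
  simp only [pairV, hi, hk, Finset.mem_compl, not_true, not_false_iff,
    if_true, if_false, mul_one, one_mul, and_self]
  rw [e1, show (latAng P α m' k - latAng P α m' i) / 2 =
    -((((k : ℝ) - i) * gam n K P α + α * (S + 1)) / 2) by rw [← e2]; ring,
    show (latAng P α m' k - latAng P α m' i + gam n K P α) / 2 =
    -((((k : ℝ) - i - 1) * gam n K P α + α * (S + 1)) / 2) by linear_combination (-1 / 2) * e2,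
    sin_div_sin_neg, ← key]
  congr 4
  ring

lemma latCoef_mul_gauge [NeZero n] (D : CouplingData n K q P) (hα : 0 < α)
    (hαK : α * K * q < 2 * π) {m m' : Compos n K} {J : Finset (Fin n)} (h : Step J m.1 m'.1) :
    latCoef P α J m * gaugeFun α (gam n K P α) m.1 =
      latCoef P α Jᶜ m' * gaugeFun α (gam n K P α) m'.1 := by
  unfold latCoef gaugeFun
  rw [coefV_eq_prod_pairs, coefV_eq_prod_pairs]
  simp only [← Finset.prod_mul_distrib]
  refine Finset.prod_congr rfl fun i _ => Finset.prod_congr rfl fun k hk => ?_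
  have hik := Finset.mem_Ioi.1 hk
  have hS := h.sum_Ico hik.le
  by_cases hi : i ∈ J <;> by_cases hk : k ∈ J
  · simp only [hi, hk, if_true, add_left_inj] at hS
    simp [pairV, hi, hk, hS]
  · simp only [hi, hk, if_true, if_false, add_zero] at hS
    exact pairV_exchange D hα hαK hik hi hk hS
  · simp only [hi, hk, if_true, if_false, add_zero] at hS
    have := pairV_exchange D hα hαK (J := Jᶜ) hik (Finset.mem_compl.2 hi) (by simpa using hk)
      hS.symm
    rw [compl_compl] at this
    exact this.symm
  · simp only [hi, hk, if_false, add_zero] at hS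
    simp [pairV, hi, hk, hS]

end Gauge

section Operators

variable {n K q : ℕ} {P : ℤ} {α : ℝ}

lemma altSum_weylVec_ne_zero {θ : Fin n → ℝ}
    (h : ∀ i j : Fin n, i < j → Real.sin ((θ i - θ j) / 2) ≠ 0) : altSum (weylVec n) θ ≠ 0 := by
  rw [altSum_weylVec]
  refine Finset.prod_ne_zero_iff.2 fun i _ => Finset.prod_ne_zero_iff.2 fun j hj => ?_
  exact mul_ne_zero (mul_ne_zero two_ne_zero Complex.I_ne_zero)
    (Complex.ofReal_ne_zero.2 (h i j (Finset.mem_Ioi.1 hj)))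

lemma Compos.cast_sum_eq (m : Compos n K) : ∑ k, (m.1 k : ℝ) = K := by
  exact_mod_cast m.sum_eq

lemma CouplingData.sin_latAng_ne_zero (D : CouplingData n K q P) (hα : 0 < α)
    (hαK : α * K * q < 2 * π) (m : Compos n K) (i j : Fin n) (h : i < j) :
    Real.sin ((latAng P α m i - latAng P α m j) / 2) ≠ 0 :=
  D.sin_ang_sub_ne_zero hα hαK (fun _ => Nat.cast_nonneg _) m.cast_sum_eq h.ne

lemma CouplingData.altSum_latAng_ne_zero (D : CouplingData n K q P) (hα : 0 < α)
    (hαK : α * K * q < 2 * π) (m : Compos n K) : altSum (weylVec n) (latAng P α m) ≠ 0 :=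
  altSum_weylVec_ne_zero (D.sin_latAng_ne_zero hα hαK m)

variable [NeZero n]

/-- The difference operator with coefficients `V_J`. -/
def hopOp (P : ℤ) (α : ℝ) (r : ℕ) : (Compos n K → ℂ) →ₗ[ℂ] (Compos n K → ℂ) where
  toFun f m := ∑ J ∈ powersetCard r (univ : Finset (Fin n)), ∑ m' : Compos n K,
    if Step J m.1 m'.1 then (latCoef P α J m : ℂ) * f m' else 0
  map_add' f g := by
    funext m
    simp only [Pi.add_apply, ← Finset.sum_add_distrib]
    refine Finset.sum_congr rfl fun J _ => Finset.sum_congr rfl fun m' _ => ?_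
    split_ifs <;> ring
  map_smul' c f := by
    funext m
    simp only [Pi.smul_apply, smul_eq_mul, Finset.mul_sum, RingHom.id_apply]
    refine Finset.sum_congr rfl fun J _ => Finset.sum_congr rfl fun m' _ => ?_
    split_ifs <;> ring

/-- The Weyl character type quotient of alternants at a lattice point. -/
def schurAt (P : ℤ) (α : ℝ) (l : Fin n → ℝ) (m : Compos n K) : ℂ :=
  altSum (fun i => weylVec n i + l i) (latAng P α m) / altSum (weylVec n) (latAng P α m)

/-- The joint eigenvalues. -/
def eigVal (P : ℤ) (α : ℝ) (r : ℕ) (a : Compos n K) : ℂ :=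
  elemExp r fun i => gam n K P α * weylVec n i + α * domWeight a.1 i

/-- The squared length of the shifted weight. -/
def height (a : Compos n K) : ℝ := ∑ i, (weylVec n i + domWeight a.1 i) ^ 2

lemma symSum_add_const (κ θ : Fin n → ℝ) (c : ℝ) (hκ : ∑ i, κ i = 0) :
    symSum κ (fun i => θ i + c) = symSum κ θ := by
  unfold symSum
  refine Finset.sum_congr rfl fun w _ => ?_
  have : ∑ i, κ (w i) * (θ i + c) = ∑ i, κ (w i) * θ i := by
    simp only [mul_add, Finset.sum_add_distrib, ← Finset.sum_mul, Equiv.sum_comp w κ, hκ,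
      zero_mul, add_zero]
  rw [this]

lemma CouplingData.sum_step_mul (D : CouplingData n K q P) (F : (Fin n → ℝ) → ℂ)
    (hF : ∀ θ c, F (fun i => θ i + c) = F θ) (J : Finset (Fin n)) (m : Compos n K) :
    (∑ m' : Compos n K, if Step J m.1 m'.1 then (latCoef P α J m : ℂ) * F (latAng P α m') else 0) =
      latCoef P α J m * F fun i => latAng P α m i + α * indVec J i := by
  by_cases h : ∀ j, j ∉ J → j + 1 ∈ J → 0 < m.1 j
  · obtain ⟨m', hm'⟩ := exists_step m J h
    rw [Finset.sum_eq_single m']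
    · rw [if_pos hm']
      have := hm'.ang_eq α (gam n K P α)
      simp only [sub_eq_add_neg] at this
      rw [latAng, this, hF]
      rfl
    · intro m'' _ hne
      rw [if_neg fun h' => hne (Subtype.ext (h'.unique hm'))]
    · exact fun h' => absurd (Finset.mem_univ _) h'
  · push Not at h
    obtain ⟨j, hj, hj1, hj0⟩ := h
    have h0 : latCoef P α J m = 0 :=
      D.coefV_eq_zero m.cast_sum_eq hj hj1 (by exact_mod_cast Nat.le_zero.1 hj0)
    simp [h0]

lemma CouplingData.hopOp_symSum (D : CouplingData n K q P) (hα : 0 < α)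
    (hαK : α * K * q < 2 * π) (r : ℕ) (κ : Fin n → ℝ) (hκ : ∑ i, κ i = 0) (m : Compos n K) :
    hopOp P α r (fun m' => symSum κ (latAng P α m')) m =
      ∑ v : Equiv.Perm (Fin n), elemExp r (fun i => gam n K P α * weylVec n i + α * κ (v i)) *
        schurAt P α (κ ∘ v) m := by
  have h0 := D.altSum_latAng_ne_zero hα hαK m
  apply mul_right_cancel₀ h0
  have h1 := sum_altSum_mul_symSum r α (gam n K P α) κ (latAng P α m)
  rw [Finset.sum_mul]
  have h2 : ∀ v : Equiv.Perm (Fin n),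
      elemExp r (fun i => gam n K P α * weylVec n i + α * κ (v i)) * schurAt P α (κ ∘ v) m *
        altSum (weylVec n) (latAng P α m) =
      elemExp r (fun i => gam n K P α * weylVec n i + α * κ (v i)) *
        altSum (fun i => weylVec n i + κ (v i)) (latAng P α m) := by
    intro v
    rw [schurAt, mul_assoc, div_mul_cancel₀ _ h0]
    rfl
  rw [Finset.sum_congr rfl fun v _ => h2 v, ← h1]
  simp only [hopOp, LinearMap.coe_mk, AddHom.coe_mk]
  rw [Finset.sum_mul]
  refine Finset.sum_congr rfl fun J _ => ?_
  rw [D.sum_step_mul (symSum κ) (fun θ c => symSum_add_const κ θ c hκ),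
    ← coefV_mul_altSum _ _ _ (D.sin_latAng_ne_zero hα hαK m)]
  unfold latCoef
  ring

lemma hopOp_zero (f : Compos n K → ℂ) :
    hopOp P α 0 f = f := by
  funext m
  have hs : ∀ m' : Compos n K, Step ∅ m.1 m'.1 ↔ m' = m := fun m' =>
    ⟨fun h => Subtype.ext (funext fun k => by simpa using h k), fun h => by rw [h]; intro k; simp⟩
  simp [hopOp, hs, latCoef, coefV]

/-- Straightening of quotients of alternants. -/
lemma schurAt_eq_zero_or {k : ℕ} (hk : k ≤ K) (l : Fin n → ℝ)
    (hl : ∑ i, l i = 0) (t : Fin n → ℤ) (c : ℝ) (hlt : ∀ i, weylVec n i + l i = t i + c)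
    (hs : ∀ i j, (weylVec n i + l i) - (weylVec n j + l j) ≤ (n : ℝ) - 1 + k) :
    (∀ P α, schurAt (K := K) P α l = 0) ∨ ∃ (b : Compos n K) (ε : ℂ),
      (∀ P α, schurAt (K := K) P α l = ε • schurAt P α (domWeight b.1)) ∧
      (∀ i j, domWeight b.1 i - domWeight b.1 j ≤ k) ∧
      height b = ∑ i, (weylVec n i + l i) ^ 2 := by
  by_cases hinj : Function.Injective fun i => weylVec n i + l i
  · right
    obtain ⟨b, σ, h1, h2⟩ := exists_perm_eq_weylVec_add_domWeight hk (fun i => weylVec n i + l i)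
      (by rw [Finset.sum_add_distrib, sum_weylVec, hl, add_zero]) t c hlt hs hinj
    refine ⟨b, ((Equiv.Perm.sign σ : ℤ) : ℂ), fun P α => ?_, h2, ?_⟩
    · funext m
      have h3 := altSum_comp_perm (fun i => weylVec n i + l i) (latAng P α m) σ
      have h : ((Equiv.Perm.sign σ : ℤ) : ℂ) * ((Equiv.Perm.sign σ : ℤ) : ℂ) = 1 := by
        rw [← Int.cast_mul, ← Units.val_mul, Int.units_mul_self, Units.val_one, Int.cast_one]
      rw [h1] at h3
      simp only [schurAt, Pi.smul_apply, smul_eq_mul, h3]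
      rw [← mul_div_assoc, ← mul_assoc, h, one_mul]
    · unfold height
      rw [← Equiv.sum_comp σ fun i => (weylVec n i + l i) ^ 2]
      exact Finset.sum_congr rfl fun i _ => by rw [← congrFun h1 i]; rfl
  · left
    intro P α
    funext m
    simp [schurAt, altSum_eq_zero_of_not_injective _ _ hinj]

lemma weylVec_add_domWeight_comp_integral (a : Compos n K) (v : Fin n → Fin n) :
    ∃ (t : Fin n → ℤ) (c : ℝ), ∀ i, weylVec n i + domWeight a.1 (v i) = t i + c := by
  refine ⟨fun i => ∑ k ∈ Ici (v i), (a.1 k : ℤ) - (i : ℕ), ((n : ℝ) - 1) / 2 -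
    (∑ j, ∑ k ∈ Ici j, (a.1 k : ℝ)) / n, fun i => ?_⟩
  simp only [weylVec, domWeight, centre]
  push_cast
  ring

/-- The span of the quotients of alternants of smaller height. -/
def lowerSpan (P : ℤ) (α : ℝ) (a : Compos n K) : Submodule ℂ (Compos n K → ℂ) :=
  Submodule.span ℂ ((fun b : Compos n K => schurAt P α (domWeight b.1)) '' {b | height b < height a})

lemma schurAt_comp_mem_lowerSpan (a : Compos n K) (v : Equiv.Perm (Fin n))
    (hv : domWeight a.1 ∘ v ≠ domWeight a.1) :
    schurAt P α (domWeight a.1 ∘ v) ∈ lowerSpan P α a := by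
  obtain ⟨t, c, htc⟩ := weylVec_add_domWeight_comp_integral a v
  rcases schurAt_eq_zero_or (K := K) le_rfl (domWeight a.1 ∘ v)
    ((Equiv.sum_comp v (domWeight a.1)).trans (sum_domWeight _)) t c htc (fun i j => by
      have h1 := weylVec_sub_le i j
      have h2 := domWeight_sub_le a (v i) (v j)
      simp only [Function.comp_apply]
      linarith) with h | ⟨b, ε, h, -, hb⟩
  · rw [h]; exact Submodule.zero_mem _
  · rw [h]
    refine Submodule.smul_mem _ _ (Submodule.subset_span ⟨b, ?_, rfl⟩)
    show height b < height a
    rw [hb]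
    exact sum_sq_weylVec_add_comp_lt a.1 v hv

/-- The operators are triangular with respect to the height. -/
lemma CouplingData.hopOp_schurAt_mem (D : CouplingData n K q P) (hα : 0 < α)
    (hαK : α * K * q < 2 * π) (r : ℕ) (a : Compos n K) :
    hopOp P α r (schurAt P α (domWeight a.1)) - eigVal P α r a • schurAt P α (domWeight a.1) ∈
      lowerSpan P α a := by
  have hwf : WellFounded fun b a : Compos n K => height b < height a :=
    @Finite.wellFounded_of_trans_of_irrefl _ _ _
      ⟨fun _ _ _ h1 h2 => lt_trans h1 h2⟩ ⟨fun _ => lt_irrefl _⟩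
  induction a using hwf.induction with
  | _ a ih =>
  set κ := domWeight a.1 with hκ
  set A : Finset (Equiv.Perm (Fin n)) := univ.filter fun v => κ ∘ v = κ with hA
  have hsplit : ∀ r, ∃ L ∈ lowerSpan P α a,
      hopOp P α r (fun m' : Compos n K => symSum κ (latAng P α m')) =
        (A.card : ℂ) • eigVal P α r a • schurAt P α κ + L := by
    intro r
    refine ⟨∑ v ∈ univ.filter (fun v : Equiv.Perm (Fin n) => ¬ κ ∘ v = κ),
      elemExp r (fun i => gam n K P α * weylVec n i + α * κ (v i)) • schurAt P α (κ ∘ v), ?_, ?_⟩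
    · exact Submodule.sum_mem _ fun v hv => Submodule.smul_mem _ _
        (schurAt_comp_mem_lowerSpan a v (Finset.mem_filter.1 hv).2)
    · have h1 : hopOp P α r (fun m' : Compos n K => symSum κ (latAng P α m')) =
          ∑ v : Equiv.Perm (Fin n),
            elemExp r (fun i => gam n K P α * weylVec n i + α * κ (v i)) •
              schurAt P α (κ ∘ v) := by
        funext m
        rw [D.hopOp_symSum hα hαK r κ (sum_domWeight _) m, Finset.sum_apply]
        rfl
      rw [h1, ← Finset.sum_filter_add_sum_filter_not univ fun v : Equiv.Perm (Fin n) => κ ∘ v = κ]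
      congr 1
      have h2 : ∀ v ∈ A, elemExp r (fun i => gam n K P α * weylVec n i + α * κ (v i)) •
          schurAt (K := K) P α (κ ∘ v) = eigVal P α r a • schurAt P α κ := by
        intro v hv
        have h3 : κ ∘ v = κ := (Finset.mem_filter.1 hv).2
        have h4 : ∀ i, κ (v i) = κ i := congrFun h3
        rw [h3]
        simp only [h4]
        rfl
      rw [← hA, Finset.sum_congr rfl h2, Finset.sum_const, Nat.cast_smul_eq_nsmul]
  have hlow : ∀ x ∈ lowerSpan P α a, hopOp P α r x ∈ lowerSpan P α a := by
    intro x hx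
    refine Submodule.span_induction (p := fun x _ => hopOp P α r x ∈ lowerSpan P α a)
      ?_ ?_ ?_ ?_ hx
    · rintro _ ⟨b, hb, rfl⟩
      have h1 : lowerSpan P α b ≤ lowerSpan P α a := Submodule.span_mono
        (Set.image_mono fun c hc => show height c < height a from
          lt_trans (show height c < height b from hc) hb)
      have h2 : schurAt P α (domWeight b.1) ∈ lowerSpan P α a := Submodule.subset_span ⟨b, hb, rfl⟩
      have := (lowerSpan P α a).add_mem (h1 (ih b hb))
        ((lowerSpan P α a).smul_mem (eigVal P α r b) h2)
      simpa using this
    · simp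
    · intro x y _ _ hx hy; rw [map_add]; exact Submodule.add_mem _ hx hy
    · intro c x _ hx; rw [map_smul]; exact Submodule.smul_mem _ c hx
  obtain ⟨L0, hL0, h0⟩ := hsplit 0
  obtain ⟨L, hL, h1⟩ := hsplit r
  have hA0 : (A.card : ℂ) ≠ 0 := by
    have : 0 < A.card := Finset.card_pos.2 ⟨1, by simp [hA]⟩
    exact_mod_cast this.ne'
  have he0 : eigVal P α 0 a = 1 := by simp [eigVal, elemExp]
  rw [hopOp_zero, he0, one_smul] at h0
  rw [h0, map_add, map_smul] at h1
  have h2 : (A.card : ℂ) • (hopOp P α r (schurAt P α κ) - eigVal P α r a • schurAt P α κ) ∈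
      lowerSpan P α a := by
    rw [smul_sub, show (A.card : ℂ) • hopOp P α r (schurAt P α κ) =
      (A.card : ℂ) • eigVal P α r a • schurAt P α κ + L - hopOp P α r L0 from
      eq_sub_of_add_eq h1]
    have := Submodule.sub_mem _ hL (hlow L0 hL0)
    convert this using 1
    abel
  exact (Submodule.smul_mem_iff _ hA0).1 h2

end Operators

section Symmetrised

variable {n K q : ℕ} [NeZero n] {P : ℤ} {α : ℝ}

/-- The matrix elements of the symmetrised difference operators. -/
def symW (P : ℤ) (α : ℝ) (J : Finset (Fin n)) (m m' : Compos n K) : ℝ :=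
  if Step J m.1 m'.1 then stepSgn P J * √(latCoef P α J m * latCoef P α Jᶜ m') else 0

lemma symW_compl (J : Finset (Fin n)) (m m' : Compos n K) :
    symW P α Jᶜ m' m = symW P α J m m' := by
  unfold symW
  simp only [step_compl_iff, stepSgn_compl, compl_compl, mul_comm (latCoef P α Jᶜ m')]

/-- The symmetrised difference operator. -/
def symOp (P : ℤ) (α : ℝ) (r : ℕ) : (Compos n K → ℂ) →ₗ[ℂ] (Compos n K → ℂ) where
  toFun f m := ∑ J ∈ powersetCard r (univ : Finset (Fin n)), ∑ m' : Compos n K,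
    (symW P α J m m' : ℂ) * f m'
  map_add' f g := by
    funext m
    simp only [Pi.add_apply, ← Finset.sum_add_distrib, mul_add]
  map_smul' c f := by
    funext m
    simp only [Pi.smul_apply, smul_eq_mul, Finset.mul_sum, RingHom.id_apply]
    exact Finset.sum_congr rfl fun J _ => Finset.sum_congr rfl fun m' _ => by ring

lemma symOp_apply (r : ℕ) (f : Compos n K → ℂ) (m : Compos n K) :
    symOp P α r f m = ∑ J ∈ powersetCard r (univ : Finset (Fin n)), ∑ m' : Compos n K,
      (symW P α J m m' : ℂ) * f m' := rfl

lemma sum_symOp_mul_conj {r : ℕ} (hr : r ≤ n) (x y : Compos n K → ℂ) :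
    ∑ m, y m * starRingEnd ℂ (symOp P α r x m) =
      ∑ m, symOp P α (n - r) y m * starRingEnd ℂ (x m) := by
  simp only [symOp_apply, map_sum, map_mul, Complex.conj_ofReal, Finset.mul_sum, Finset.sum_mul]
  rw [Finset.sum_comm]
  conv_rhs => rw [Finset.sum_comm]
  refine Finset.sum_nbij' compl compl ?_ ?_ (fun _ _ => compl_compl _) (fun _ _ => compl_compl _) ?_
  · intro J hJ
    rw [Finset.mem_powersetCard_univ] at hJ ⊢
    rw [Finset.card_compl, Fintype.card_fin, hJ]
  · intro J hJ
    rw [Finset.mem_powersetCard_univ] at hJ ⊢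
    rw [Finset.card_compl, Fintype.card_fin, hJ]
    omega
  · intro J _
    rw [Finset.sum_comm]
    refine Finset.sum_congr rfl fun m _ => Finset.sum_congr rfl fun m' _ => ?_
    rw [symW_compl]
    ring

lemma Step.pos {J : Finset (Fin n)} {m m' : Fin n → ℕ} (h : Step J m m') (j : Fin n)
    (hj : j ∉ J) (hj1 : j + 1 ∈ J) : 0 < m j := by
  have := h j
  simp only [hj, hj1, if_true, if_false] at this
  omega

lemma CouplingData.stepSgn_mul_latCoef_pos (D : CouplingData n K q P) (hα : 0 < α)
    (hαK : α * K * q < 2 * π) {J : Finset (Fin n)} {m m' : Compos n K} (h : Step J m.1 m'.1) :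
    0 < stepSgn P J * latCoef P α J m :=
  D.stepSgn_mul_coefV_pos hα hαK (fun _ => Nat.cast_nonneg _) m.cast_sum_eq fun j hj hj1 => by
    exact_mod_cast h.pos j hj hj1

/-- The diagonal gauge factor. -/
def gaugeRoot (P : ℤ) (α : ℝ) (m : Compos n K) : ℝ := √|gaugeFun α (gam n K P α) m.1|

lemma CouplingData.gaugeRoot_pos (D : CouplingData n K q P) (hα : 0 < α)
    (hαK : α * K * q < 2 * π) (m : Compos n K) : 0 < gaugeRoot P α m :=
  Real.sqrt_pos.2 (abs_pos.2 (D.gauge_ne_zero hα hαK m))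

lemma CouplingData.symW_mul_gaugeRoot (D : CouplingData n K q P) (hα : 0 < α)
    (hαK : α * K * q < 2 * π) (J : Finset (Fin n)) (m m' : Compos n K) :
    symW P α J m m' * gaugeRoot P α m' =
      gaugeRoot P α m * if Step J m.1 m'.1 then latCoef P α J m else 0 := by
  unfold symW
  split_ifs with h
  · have h1 := D.stepSgn_mul_latCoef_pos hα hαK h
    have h2 := D.stepSgn_mul_latCoef_pos hα hαK h.compl
    rw [stepSgn_compl] at h2
    have h3 := latCoef_mul_gauge D hα hαK h
    have h4 := stepSgn_mul_self (n := n) P J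
    set ε := stepSgn P J
    set V := latCoef P α J m
    set V' := latCoef P α Jᶜ m'
    have hVV : V * V' = (ε * V) * (ε * V') := by linear_combination (-V * V') * h4
    have hsq : V * V' * |gaugeFun α (gam n K P α) m'.1| =
        (ε * V) ^ 2 * |gaugeFun α (gam n K P α) m.1| := by
      rw [hVV, mul_assoc, ← abs_of_pos h2, ← abs_mul, mul_assoc ε V', ← h3, ← mul_assoc, abs_mul,
        abs_of_pos h1]
      ring
    rw [mul_assoc, gaugeRoot, ← Real.sqrt_mul (by rw [hVV]; positivity), hsq,
      Real.sqrt_mul (sq_nonneg _), Real.sqrt_sq h1.le, gaugeRoot]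
    linear_combination (V * √|gaugeFun α (gam n K P α) m.1|) * h4
  · simp

lemma CouplingData.symOp_gaugeRoot_mul (D : CouplingData n K q P) (hα : 0 < α)
    (hαK : α * K * q < 2 * π) (r : ℕ) (f : Compos n K → ℂ) :
    symOp P α r (fun m => gaugeRoot P α m * f m) = fun m => gaugeRoot P α m * hopOp P α r f m := by
  funext m
  simp only [symOp_apply, hopOp, LinearMap.coe_mk, AddHom.coe_mk, Finset.mul_sum]
  refine Finset.sum_congr rfl fun J _ => Finset.sum_congr rfl fun m' _ => ?_
  have := congrArg (fun x : ℝ => (x : ℂ) * f m') (D.symW_mul_gaugeRoot hα hαK J m m')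
  simp only [Complex.ofReal_mul] at this
  rw [← mul_assoc, this]
  split_ifs <;> simp [mul_assoc]

/-- Orthonormal joint diagonalisation of the symmetrised operators. -/
def Diagonalisable (n K : ℕ) [NeZero n] (P : ℤ) (α : ℝ) : Prop :=
  ∃ Ψ : Compos n K → Compos n K → ℂ,
    (∀ a b, ∑ m, Ψ a m * starRingEnd ℂ (Ψ b m) = if a = b then 1 else 0) ∧
    ∀ r ≤ n, ∀ a m, symOp P α r (Ψ a) m = eigVal P α r a * Ψ a m

lemma exists_orthonormal_functions_of_triangular {ι ℛ : Type*} [Fintype ι]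
    (T : ℛ → (ι → ℂ) →ₗ[ℂ] (ι → ℂ)) (τ : ℛ → ℛ)
    (hadj : ∀ r (x y : ι → ℂ), ∑ m, y m * starRingEnd ℂ (T r x m) =
      ∑ m, T (τ r) y m * starRingEnd ℂ (x m)) (v : ι → ι → ℂ)
    (hv : LinearIndependent ℂ v) (h : ι → ℝ) (e : ℛ → ι → ℂ)
    (htri : ∀ r a, T r (v a) - e r a • v a ∈ Submodule.span ℂ (v '' {b | h b < h a})) :
    ∃ Ψ : ι → ι → ℂ, (∀ a b, ∑ m, Ψ a m * starRingEnd ℂ (Ψ b m) = if a = b then 1 else 0) ∧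
      ∀ r a m, T r (Ψ a) m = e r a * Ψ a m := by
  let E := WithLp.linearEquiv 2 ℂ (ι → ℂ)
  have hinner : ∀ x y : EuclideanSpace ℂ ι,
      inner ℂ x y = ∑ m, y m * starRingEnd ℂ (x m) := fun x y => by
    simp [PiLp.inner_apply]
  obtain ⟨Ψ, hΨ, hT⟩ := exists_orthonormal_eigenvectors_of_triangular
    (fun r => E.symm.toLinearMap ∘ₗ T r ∘ₗ E.toLinearMap) τ
    (fun r x y => by rw [hinner, hinner]; exact hadj r (E x) (E y))
    (fun a => E.symm (v a)) (hv.map' E.symm.toLinearMap E.symm.ker) h e (fun r a => by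
      have h4 := Submodule.mem_map_of_mem (f := E.symm.toLinearMap) (htri r a)
      rw [Submodule.map_span, ← Set.image_comp] at h4
      exact h4)
  refine ⟨fun a => E (Ψ a), fun a b => ?_, fun r a m => ?_⟩
  · have := orthonormal_iff_ite.1 hΨ b a
    rw [hinner] at this
    simp only [eq_comm (a := a)]
    exact this
  · exact congrFun (congrArg E (hT r a)) m

lemma CouplingData.diagonalisable_of_linearIndependent (D : CouplingData n K q P) (hα : 0 < α)
    (hαK : α * K * q < 2 * π)
    (hind : LinearIndependent ℂ fun b : Compos n K => schurAt (K := K) P α (domWeight b.1)) :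
    Diagonalisable n K P α := by
  let G : (Compos n K → ℂ) →ₗ[ℂ] (Compos n K → ℂ) :=
    { toFun := fun f m => gaugeRoot P α m * f m
      map_add' := fun f g => by funext m; simp [mul_add]
      map_smul' := fun c f => by funext m; simp; ring }
  have hG : ∀ r f, symOp P α r (G f) = G (hopOp P α r f) := D.symOp_gaugeRoot_mul hα hαK
  have hGinj : LinearMap.ker G = ⊥ := by
    rw [LinearMap.ker_eq_bot']
    intro f hf
    funext m
    have h1 : (gaugeRoot P α m : ℂ) * f m = 0 := congrFun hf m
    exact (mul_eq_zero.1 h1).resolve_left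
      (Complex.ofReal_ne_zero.2 (D.gaugeRoot_pos hα hαK m).ne')
  clear_value G
  obtain ⟨Ψ, hΨ, hT⟩ := exists_orthonormal_functions_of_triangular
    (fun r : Fin (n + 1) => symOp (n := n) (K := K) P α r) Fin.rev (fun r x y => by
      have := sum_symOp_mul_conj (P := P) (α := α) (Nat.lt_succ_iff.1 r.2) x y
      have h2 : ((Fin.rev r : Fin (n + 1)) : ℕ) = n - r := by rw [Fin.val_rev]; omega
      rw [h2]
      exact this)
    (fun a => G (schurAt P α (domWeight a.1))) (hind.map' G hGinj)
    height (fun r a => eigVal P α r a) (fun r a => by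
      have h1 := Submodule.mem_map_of_mem (f := G) (D.hopOp_schurAt_mem hα hαK r a)
      rw [lowerSpan, Submodule.map_span, ← Set.image_comp, map_sub, map_smul, ← hG] at h1
      exact h1)
  exact ⟨Ψ, fun a b => by convert hΨ a b, fun r hr a m => hT ⟨r, Nat.lt_succ_iff.2 hr⟩ a m⟩

end Symmetrised

section Multiplication

variable {n K q : ℕ} [NeZero n] {P : ℤ} {α : ℝ}

/-- The span of the quotients of alternants with dominant weight of spread at most `k`. -/
def spreadSpan (n K : ℕ) (P : ℤ) (α : ℝ) (k : ℕ) : Submodule ℂ (Compos n K → ℂ) :=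
  Submodule.span ℂ ((fun b : Compos n K => schurAt P α (domWeight b.1)) ''
    {b | ∀ i j, domWeight b.1 i - domWeight b.1 j ≤ k})

lemma spreadSpan_mono {k l : ℕ} (h : k ≤ l) : spreadSpan n K P α k ≤ spreadSpan n K P α l :=
  Submodule.span_mono (Set.image_mono fun b hb i j => (hb i j).trans (by exact_mod_cast h))

lemma schurAt_mem_spreadSpan {k : ℕ} (hk : k ≤ K) (l : Fin n → ℝ)
    (hl : ∑ i, l i = 0) (t : Fin n → ℤ) (c : ℝ) (hlt : ∀ i, weylVec n i + l i = t i + c)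
    (hs : ∀ i j, (weylVec n i + l i) - (weylVec n j + l j) ≤ (n : ℝ) - 1 + k) :
    schurAt P α l ∈ spreadSpan n K P α k := by
  rcases schurAt_eq_zero_or (K := K) hk l hl t c hlt hs with h | ⟨b, ε, h, hb, -⟩
  · rw [h]; exact Submodule.zero_mem _
  · rw [h]
    exact Submodule.smul_mem _ _ (Submodule.subset_span ⟨b, hb, rfl⟩)

lemma CouplingData.one_mem_spreadSpan (D : CouplingData n K q P) (hα : 0 < α)
    (hαK : α * K * q < 2 * π) : (fun _ => 1) ∈ spreadSpan n K P α 0 := by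
  have h := schurAt_mem_spreadSpan (P := P) (α := α) (Nat.zero_le K) (fun _ : Fin n => (0 : ℝ))
    (by simp) (fun i => -((i : ℕ) : ℤ)) (((n : ℝ) - 1) / 2)
    (fun i => by simp only [weylVec]; push_cast; ring)
    (fun i j => by simpa using weylVec_sub_le i j)
  convert h using 1
  funext m
  simp only [schurAt, add_zero]
  exact (div_self (D.altSum_latAng_ne_zero hα hαK m)).symm

/-- The characteristic polynomial of the lattice point, evaluated at `ξ`. -/
def charPolyAt (P : ℤ) (ξ : ℂ) (α : ℝ) (m : Compos n K) : ℂ :=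
  ∏ i, (ξ - Complex.exp (Complex.I * latAng P α m i))

lemma indVec_sub_le (J : Finset (Fin n)) (i j : Fin n) : indVec J i - indVec J j ≤ 1 := by
  simp only [indVec]; split_ifs <;> norm_num

lemma sum_indVec (J : Finset (Fin n)) : ∑ i, indVec J i = J.card := by
  simp [indVec]

lemma charPolyAt_mul_mem {k : ℕ} (hk : k + 1 ≤ K) (ξ : ℂ) {f : Compos n K → ℂ}
    (hf : f ∈ spreadSpan n K P α k) :
    (fun m => charPolyAt P ξ α m * f m) ∈ spreadSpan n K P α (k + 1) := by
  have hn : (n : ℝ) ≠ 0 := by exact_mod_cast NeZero.ne n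
  refine Submodule.span_induction
    (p := fun f _ => (fun m => charPolyAt P ξ α m * f m) ∈ spreadSpan n K P α (k + 1))
    ?_ ?_ ?_ ?_ hf
  · rintro _ ⟨b, hb, rfl⟩
    set l : Finset (Fin n) → Fin n → ℝ := fun J i => domWeight b.1 i + indVec J i + -(J.card / n : ℝ)
      with hl
    have h1 : (fun m : Compos n K => charPolyAt P ξ α m * schurAt P α (domWeight b.1) m) =
        ∑ J : Finset (Fin n), ((-1 : ℂ) ^ J.card * ξ ^ (n - J.card)) • schurAt P α (l J) := by
      funext m
      have hang : ∑ i, latAng P α m i = 0 := sum_ang _ _ _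
      rw [Finset.sum_apply, charPolyAt, schurAt, ← mul_div_assoc, prod_sub_exp_mul_altSum,
        Finset.sum_div]
      refine Finset.sum_congr rfl fun J _ => ?_
      rw [Pi.smul_apply, smul_eq_mul, schurAt, mul_div_assoc,
        ← altSum_add_const _ _ (-(J.card / n : ℝ)) hang]
      congr 3
      funext i
      simp only [hl]
      ring
    rw [h1]
    refine Submodule.sum_mem _ fun J _ => Submodule.smul_mem _ _ ?_
    obtain ⟨t, c, htc⟩ := weylVec_add_domWeight_comp_integral b id
    refine schurAt_mem_spreadSpan hk (l J) ?_ (fun i => t i + if i ∈ J then 1 else 0)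
      (c - J.card / n) ?_ ?_
    · simp only [hl, Finset.sum_add_distrib, sum_domWeight, sum_indVec, Finset.sum_const,
        Finset.card_univ, Fintype.card_fin, nsmul_eq_mul]
      field_simp
      ring
    · intro i
      have := htc i
      simp only [id] at this
      simp only [hl, indVec]
      push_cast
      linear_combination this
    · intro i j
      have h1 := hb i j
      have h2 := weylVec_sub_le i j
      have h3 := indVec_sub_le J i j
      simp only [hl]
      push_cast
      linarith
  · simp only [Pi.zero_apply, mul_zero]; exact Submodule.zero_mem _
  · intro x y _ _ hx hy
    simp only [Pi.add_apply, mul_add]; exact Submodule.add_mem _ hx hy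
  · intro c x _ hx
    simp only [Pi.smul_apply, smul_eq_mul, mul_left_comm _ c]
    exact Submodule.smul_mem _ c hx

lemma prod_mul_mem_spreadSpan {ι : Type*} (s : Finset ι) (L : ι → Compos n K → ℂ)
    (hL : ∀ i ∈ s, ∀ k, k + 1 ≤ K → ∀ f ∈ spreadSpan n K P α k,
      (fun m => L i m * f m) ∈ spreadSpan n K P α (k + 1))
    (h1 : (fun _ => 1) ∈ spreadSpan n K P α 0) (hs : s.card ≤ K) :
    (fun m => ∏ i ∈ s, L i m) ∈ spreadSpan n K P α s.card := by
  induction s using Finset.induction_on with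
  | empty => simpa using h1
  | insert a s ha ih =>
    rw [Finset.card_insert_of_notMem ha] at hs ⊢
    simp only [Finset.prod_insert ha]
    exact hL a (Finset.mem_insert_self _ _) _ hs _
      (ih (fun i hi => hL i (Finset.mem_insert_of_mem hi)) (by omega))

end Multiplication

section Interpolation

variable {n K q : ℕ} [NeZero n] {P : ℤ}

/-- The angles at `α = 0`. -/
def baseAng (n : ℕ) (P : ℤ) : Fin n → ℝ := ang 0 (2 * π * P / n) fun _ => 0

/-- The velocity of the angles of a lattice point with respect to `α`. -/
def velAng (m : Compos n K) : Fin n → ℝ := ang 1 (-(K / n)) fun k => (m.1 k : ℝ)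

lemma latAng_eq (P : ℤ) (α : ℝ) (m : Compos n K) (i : Fin n) :
    latAng P α m i = baseAng n P i + α * velAng m i := by
  have h : ∀ k : Fin n, -((k : ℝ) * gam n K P α + α * ∑ i ∈ Iio k, (m.1 i : ℝ)) =
      -((k : ℝ) * (2 * π * P / n) + 0 * ∑ i ∈ Iio k, (0 : ℝ)) +
        α * -((k : ℝ) * -(K / n : ℝ) + 1 * ∑ i ∈ Iio k, (m.1 i : ℝ)) := by
    intro k; rw [gam]; ring
  simp only [latAng, baseAng, velAng, ang, centre]
  rw [Finset.sum_congr rfl fun k _ => h k, h i, Finset.sum_add_distrib, ← Finset.mul_sum]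
  ring

lemma velAng_sub (hn2 : 2 ≤ n) (m : Compos n K) (k : Fin n) :
    velAng m k - velAng m (k + 1) = m.1 k - K / n := by
  have hn : (n : ℝ) ≠ 0 := by exact_mod_cast NeZero.ne n
  by_cases h : (k : ℕ) + 1 < n
  · have h1 : (((k + 1 : Fin n) : ℕ)) = k + 1 := by
      rw [val_add_one_eq (by omega), if_neg (by omega)]
    have h2 : Ico k (k + 1) = {k} := by
      ext i; simp only [Finset.mem_Ico, Finset.mem_singleton, Fin.le_def, Fin.lt_def, Fin.ext_iff, h1]
      omega
    have := ang_sub 1 (-(K / n)) (fun k => (m.1 k : ℝ)) (i := k) (j := k + 1)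
      (by rw [Fin.le_def, h1]; omega)
    rw [velAng, this, h2, h1]
    simp
    ring
  · have hk : (k : ℕ) + 1 = n := by omega
    have h1 : (k + 1 : Fin n) = 0 := by
      apply Fin.ext
      rw [val_add_one_eq (by omega), if_pos (by omega)]
      simp
    have h2 : ∑ i ∈ Ico 0 k, (m.1 i : ℝ) = K - m.1 k := by
      have h3 : (univ : Finset (Fin n)) = insert k (Ico 0 k) := by
        ext i
        simp only [Finset.mem_univ, Finset.mem_insert, Finset.mem_Ico, Fin.le_def, Fin.lt_def,
          Fin.ext_iff, Fin.val_zero, true_iff]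
        omega
      have h4 := m.cast_sum_eq
      have h5 : ∀ f : Fin n → ℝ, ∑ i, f i = f k + ∑ i ∈ Ico 0 k, f i := fun f => by
        rw [h3, Finset.sum_insert (by simp)]
      rw [h5] at h4
      linarith
    have := ang_sub 1 (-(K / n)) (fun k => (m.1 k : ℝ)) (i := 0) (j := k)
      (by rw [Fin.le_def]; simp)
    rw [h2] at this
    rw [h1, ← neg_sub, velAng, this]
    have hkR : (k : ℝ) = n - 1 := by
      have : ((k : ℕ) : ℝ) + 1 = n := by exact_mod_cast hk
      linarith
    rw [hkR]
    simp
    field_simp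
    ring

lemma CouplingData.exp_baseAng_injective (D : CouplingData n K q P) :
    Function.Injective fun i => Complex.exp (Complex.I * baseAng n P i) := by
  have hn : (n : ℂ) ≠ 0 := by exact_mod_cast NeZero.ne n
  intro i j h
  obtain ⟨N, hN⟩ := Complex.exp_eq_exp_iff_exists_int.1 h
  have h1 : baseAng n P i - baseAng n P j = ((j : ℝ) - i) * (2 * π * P / n) := by
    simp only [baseAng, ang, centre]; ring
  have h2 : ((baseAng n P i - baseAng n P j : ℝ) : ℂ) = N * (2 * π) := by
    push_cast
    apply mul_left_cancel₀ Complex.I_ne_zero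
    linear_combination hN
  rw [h1] at h2
  have hπ : (2 * π : ℂ) ≠ 0 := by exact_mod_cast Real.two_pi_pos.ne'
  have h3 : (((j : ℕ) : ℂ) - (i : ℕ)) * P = N * n := by
    push_cast at h2
    field_simp at h2
    apply mul_left_cancel₀ hπ
    linear_combination (2 * π : ℂ) * h2
  have h4 : (((j : ℕ) : ℤ) - (i : ℕ)) * P = N * n := by exact_mod_cast h3
  obtain ⟨c, hc⟩ := D.dvd
  have h5 : (n : ℤ) ∣ ((j : ℕ) : ℤ) - (i : ℕ) :=
    ⟨N * q - (((j : ℕ) : ℤ) - (i : ℕ)) * c, by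
      linear_combination (-(((j : ℕ) : ℤ) - (i : ℕ))) * hc + (q : ℤ) * h4⟩
  apply Fin.ext
  have h6 := i.2
  have h7 := j.2
  have := Int.eq_zero_of_abs_lt_dvd h5 (by rw [abs_lt]; omega)
  omega

lemma hasDerivAt_latAng (m : Compos n K) (i : Fin n) (α : ℝ) :
    HasDerivAt (fun α => latAng P α m i) (velAng m i) α := by
  simp only [latAng_eq]
  simpa using ((hasDerivAt_id α).mul_const (velAng m i)).const_add (baseAng n P i)

lemma analyticOnNhd_latAng (m : Compos n K) (i : Fin n) :
    AnalyticOnNhd ℝ (fun α => ((latAng P α m i : ℝ) : ℂ)) Set.univ := by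
  simp only [latAng_eq]
  intro x _
  have : AnalyticAt ℝ (fun α : ℝ => (α : ℂ)) x := Complex.ofRealCLM.analyticAt x
  push_cast
  fun_prop

end Interpolation

section Determinant

variable {n K q : ℕ} [NeZero n] {P : ℤ}

/-- The exponentials of the angles at `α = 0`. -/
def node (P : ℤ) (i : Fin n) : ℂ := Complex.exp (Complex.I * baseAng n P i)

/-- The normalising constants of the interpolating functions. -/
def nodeConst (P : ℤ) (i : Fin n) : ℂ :=
  -(Complex.I * node P i) * ∏ j ∈ univ.erase i, (node P i - node P j)

lemma CouplingData.nodeConst_ne_zero (D : CouplingData n K q P) (i : Fin n) :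
    nodeConst P i ≠ 0 := by
  refine mul_ne_zero (neg_ne_zero.2 (mul_ne_zero Complex.I_ne_zero (Complex.exp_ne_zero _)))
    (Finset.prod_ne_zero_iff.2 fun j hj => sub_ne_zero.2 fun h => ?_)
  exact (Finset.ne_of_mem_erase hj) (D.exp_baseAng_injective h.symm)

lemma exp_latAng_zero (m : Compos n K) (i : Fin n) :
    Complex.exp (Complex.I * latAng P 0 m i) = node P i := by
  rw [latAng_eq, zero_mul, add_zero, node]

lemma charPolyAt_node_zero (i : Fin n) (m : Compos n K) : charPolyAt P (node P i) 0 m = 0 :=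
  Finset.prod_eq_zero (Finset.mem_univ i) (by rw [exp_latAng_zero, sub_self])

lemma hasDerivAt_exp_latAng (m : Compos n K) (i : Fin n) (α : ℝ) :
    HasDerivAt (fun α => Complex.exp (Complex.I * latAng P α m i))
      (Complex.exp (Complex.I * latAng P α m i) * (Complex.I * velAng m i)) α :=
  (((hasDerivAt_latAng m i α).ofReal_comp).const_mul Complex.I).cexp

lemma hasDerivAt_charPolyAt_node (i : Fin n) (m : Compos n K) :
    HasDerivAt (fun α => charPolyAt P (node P i) α m) (nodeConst P i * velAng m i) 0 := by
  have h1 : (fun α => charPolyAt P (node P i) α m) = fun α =>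
      (node P i - Complex.exp (Complex.I * latAng P α m i)) *
        ∏ j ∈ univ.erase i, (node P i - Complex.exp (Complex.I * latAng P α m j)) := by
    funext α
    exact (Finset.mul_prod_erase univ
      (fun j => node P i - Complex.exp (Complex.I * latAng P α m j)) (Finset.mem_univ i)).symm
  have h2 : DifferentiableAt ℝ (fun α => ∏ j ∈ univ.erase i,
      (node P i - Complex.exp (Complex.I * latAng P α m j))) 0 :=
    DifferentiableAt.fun_finsetProd fun j _ =>
      ((hasDerivAt_exp_latAng m j 0).differentiableAt.const_sub _)
  have h3 := ((hasDerivAt_exp_latAng (P := P) m i 0).const_sub (node P i)).mul h2.hasDerivAt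
  rw [h1]
  refine h3.congr_deriv ?_
  simp only [exp_latAng_zero, sub_self, zero_mul, add_zero, nodeConst]
  ring

/-- A function vanishing at `α = 0` with derivative the coordinate `m_k`. -/
def linFun (P : ℤ) (k : Fin n) (α : ℝ) (m : Compos n K) : ℂ :=
  charPolyAt P (node P k) α m / nodeConst P k -
    charPolyAt P (node P (k + 1)) α m / nodeConst P (k + 1) + α * (K / n)

lemma CouplingData.hasDerivAt_linFun (D : CouplingData n K q P) (k : Fin n) (m : Compos n K) :
    HasDerivAt (fun α => linFun P k α m) (m.1 k) 0 := by
  have h1 := (((hasDerivAt_charPolyAt_node (P := P) k m).div_const (nodeConst P k)).sub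
    ((hasDerivAt_charPolyAt_node (P := P) (k + 1) m).div_const (nodeConst P (k + 1)))).add
    ((hasDerivAt_id (0 : ℝ)).ofReal_comp.mul_const (K / n : ℂ))
  refine h1.congr_deriv ?_
  rw [mul_div_cancel_left₀ _ (D.nodeConst_ne_zero k),
    mul_div_cancel_left₀ _ (D.nodeConst_ne_zero (k + 1))]
  have := congrArg (fun x : ℝ => (x : ℂ)) (velAng_sub D.two_le m k)
  push_cast at this ⊢
  linear_combination this

lemma analyticAt_charPolyAt (ξ : ℂ) (m : Compos n K) (α : ℝ) :
    AnalyticAt ℝ (fun α => charPolyAt P ξ α m) α := by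
  unfold charPolyAt
  refine Finset.analyticAt_fun_prod _ fun i _ => ?_
  have h1 : AnalyticAt ℝ (fun α => ((latAng P α m i : ℝ) : ℂ)) α :=
    analyticOnNhd_latAng m i α (Set.mem_univ _)
  exact analyticAt_const.sub (analyticAt_cexp.restrictScalars.fun_comp (analyticAt_const.mul h1))

lemma analyticAt_linFun (k : Fin n) (m : Compos n K) (α : ℝ) :
    AnalyticAt ℝ (fun α => linFun P k α m) α := by
  have h : AnalyticAt ℝ (fun α : ℝ => (α : ℂ)) α := Complex.ofRealCLM.analyticAt α
  unfold linFun
  exact (((analyticAt_charPolyAt _ m α).div_const).sub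
    ((analyticAt_charPolyAt _ m α).div_const)).add (h.mul analyticAt_const)

/-- The interpolation matrix. -/
def interp (n K : ℕ) [NeZero n] (P : ℤ) (α : ℝ) : Matrix (Compos n K) (Compos n K) ℂ :=
  Matrix.of fun m' m => ∏ x ∈ univ.sigma fun k => range (m'.1 k), (linFun P x.1 α m - α * x.2)

lemma card_sigma_range (m : Compos n K) : (univ.sigma fun k => range (m.1 k)).card = K := by
  rw [Finset.card_sigma]
  simp only [Finset.card_range]
  exact m.sum_eq

lemma analyticAt_det_interp (α : ℝ) : AnalyticAt ℝ (fun α => (interp n K P α).det) α := by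
  have h : AnalyticAt ℝ (fun α : ℝ => (α : ℂ)) α := Complex.ofRealCLM.analyticAt α
  simp only [Matrix.det_apply']
  refine Finset.analyticAt_fun_sum _ fun σ _ => analyticAt_const.mul
    (Finset.analyticAt_fun_prod _ fun m _ => ?_)
  exact Finset.analyticAt_fun_prod _ fun x _ =>
    (analyticAt_linFun _ _ _).sub (h.mul analyticAt_const)

open Topology Filter in
lemma CouplingData.tendsto_interp (D : CouplingData n K q P) (m' m : Compos n K) :
    Tendsto (fun α : ℝ => ((α : ℂ)⁻¹) ^ K * interp n K P α m' m) (𝓝[≠] 0)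
      (𝓝 (∏ x ∈ univ.sigma fun k => range (m'.1 k), ((m.1 x.1 : ℂ) - x.2))) := by
  have h1 : ∀ α : ℝ, ((α : ℂ)⁻¹) ^ K * interp n K P α m' m =
      ∏ x ∈ univ.sigma fun k => range (m'.1 k), ((α : ℂ)⁻¹ * (linFun P x.1 α m - α * x.2)) := by
    intro α
    rw [Finset.prod_mul_distrib, Finset.prod_const, card_sigma_range]
    rfl
  simp only [h1]
  refine tendsto_finsetProd _ fun x _ => ?_
  have h2 : HasDerivAt (fun α : ℝ => linFun P x.1 α m - α * x.2) ((m.1 x.1 : ℂ) - 1 * x.2) 0 :=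
    (D.hasDerivAt_linFun x.1 m).sub ((hasDerivAt_id (0 : ℝ)).ofReal_comp.mul_const _)
  have h3 := hasDerivAt_iff_tendsto_slope.1 h2
  rw [one_mul] at h3
  refine h3.congr fun α => ?_
  simp [slope, linFun, charPolyAt_node_zero]

lemma prod_sub_eq_zero {m m' : Compos n K} (h : m' ≠ m) :
    ∏ x ∈ univ.sigma fun k => range (m'.1 k), ((m.1 x.1 : ℂ) - x.2) = 0 := by
  have : ∃ k, m.1 k < m'.1 k := by
    by_contra hcon
    push Not at hcon
    apply h
    apply Subtype.ext
    funext k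
    exact (Finset.sum_eq_sum_iff_of_le fun i _ => hcon i).1 (m'.sum_eq.trans m.sum_eq.symm) k
      (Finset.mem_univ k)
  obtain ⟨k, hk⟩ := this
  exact Finset.prod_eq_zero (i := ⟨k, m.1 k⟩)
    (Finset.mem_sigma.2 ⟨Finset.mem_univ _, Finset.mem_range.2 hk⟩) (sub_self _)

lemma prod_sub_self_ne_zero (m : Compos n K) :
    ∏ x ∈ univ.sigma fun k => range (m.1 k), ((m.1 x.1 : ℂ) - x.2) ≠ 0 := by
  refine Finset.prod_ne_zero_iff.2 fun x hx => sub_ne_zero.2 fun h => ?_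
  have h1 := Finset.mem_range.1 (Finset.mem_sigma.1 hx).2
  have h2 : m.1 x.1 = x.2 := by exact_mod_cast h
  omega

open Topology Filter in
lemma CouplingData.eventually_det_interp_ne_zero (D : CouplingData n K q P) :
    ∀ᶠ α in 𝓝[≠] (0 : ℝ), (interp n K P α).det ≠ 0 := by
  set A0 : Matrix (Compos n K) (Compos n K) ℂ := Matrix.of fun m' m =>
    ∏ x ∈ univ.sigma fun k => range (m'.1 k), ((m.1 x.1 : ℂ) - x.2) with hA0
  have hdet : A0.det ≠ 0 := by
    have : A0 = Matrix.diagonal fun m => A0 m m := by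
      ext m' m
      by_cases h : m' = m
      · rw [h, Matrix.diagonal_apply_eq]
      · rw [Matrix.diagonal_apply_ne _ h]
        exact prod_sub_eq_zero h
    rw [this, Matrix.det_diagonal]
    exact Finset.prod_ne_zero_iff.2 fun m _ => prod_sub_self_ne_zero m
  have ht : Tendsto (fun α : ℝ => ((((α : ℂ)⁻¹) ^ K) • interp n K P α)) (𝓝[≠] 0) (𝓝 A0) := by
    exact tendsto_pi_nhds.2 fun m' => tendsto_pi_nhds.2 fun m => D.tendsto_interp m' m
  have hc : Continuous fun A : Matrix (Compos n K) (Compos n K) ℂ => A.det :=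
    continuous_id.matrix_det
  filter_upwards [((hc.tendsto A0).comp ht).eventually_ne hdet] with α h h0
  apply h
  simp [h0]

open Topology Filter in
lemma CouplingData.eventually_det_interp_ne_zero_nhdsNE (D : CouplingData n K q P) (α₀ : ℝ) :
    ∀ᶠ α in 𝓝[≠] α₀, (interp n K P α).det ≠ 0 := by
  by_contra hcon
  have h1 : ∃ᶠ α in 𝓝[≠] α₀, (interp n K P α).det = (fun _ => 0) α :=
    fun h => hcon h
  have h2 := AnalyticOnNhd.eq_of_frequently_eq (fun α _ => analyticAt_det_interp α)
    (fun α _ => analyticAt_const) h1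
  obtain ⟨α, hα⟩ := D.eventually_det_interp_ne_zero.exists
  exact hα (congrFun h2 α)

lemma linFun_sub_mul_mem {α : ℝ} {k : ℕ} (hk : k + 1 ≤ K) (i : Fin n) (c : ℂ)
    {f : Compos n K → ℂ} (hf : f ∈ spreadSpan n K P α k) :
    (fun m => (linFun P i α m - c) * f m) ∈ spreadSpan n K P α (k + 1) := by
  have h1 := (spreadSpan n K P α (k + 1)).smul_mem (nodeConst P i)⁻¹
    (charPolyAt_mul_mem hk (node P i) hf)
  have h2 := (spreadSpan n K P α (k + 1)).smul_mem (nodeConst P (i + 1))⁻¹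
    (charPolyAt_mul_mem hk (node P (i + 1)) hf)
  have h3 := (spreadSpan n K P α (k + 1)).smul_mem (α * (K / n) - c)
    (spreadSpan_mono (Nat.le_succ k) hf)
  convert Submodule.add_mem _ (Submodule.sub_mem _ h1 h2) h3 using 1
  funext m
  simp only [linFun, Pi.add_apply, Pi.sub_apply, Pi.smul_apply, smul_eq_mul]
  ring

lemma CouplingData.linearIndependent_schurAt (D : CouplingData n K q P) {α : ℝ} (hα : 0 < α)
    (hαK : α * K * q < 2 * π) (hdet : (interp n K P α).det ≠ 0) :
    LinearIndependent ℂ fun b : Compos n K => schurAt (K := K) P α (domWeight b.1) := by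
  have h1 : LinearIndependent ℂ (interp n K P α).row :=
    Matrix.linearIndependent_rows_of_det_ne_zero hdet
  have h2 : ⊤ ≤ Submodule.span ℂ (Set.range (interp n K P α).row) :=
    (h1.span_eq_top_of_card_eq_finrank' (by simp)).ge
  refine linearIndependent_of_top_le_span_of_card_eq_finrank (h2.trans ?_) (by simp)
  rw [Submodule.span_le]
  rintro _ ⟨m', rfl⟩
  have h3 := prod_mul_mem_spreadSpan (univ.sigma fun k => range (m'.1 k))
    (fun x m => linFun P x.1 α m - α * x.2) (P := P) (α := α) (K := K)
    (fun x _ k hk f hf => linFun_sub_mul_mem hk x.1 _ hf) (D.one_mem_spreadSpan hα hαK)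
    (card_sigma_range m').le
  exact Submodule.span_mono (Set.image_subset_range _ _) h3

open Topology Filter in
lemma CouplingData.eventually_diagonalisable (D : CouplingData n K q P) {α₀ : ℝ} (hα : 0 < α₀)
    (hαK : α₀ * K * q < 2 * π) : ∀ᶠ α in 𝓝[≠] α₀, Diagonalisable n K P α := by
  have h1 : ∀ᶠ α in 𝓝[≠] α₀, 0 < α ∧ α * K * q < 2 * π := by
    refine Filter.Eventually.filter_mono nhdsWithin_le_nhds ((lt_mem_nhds hα).and ?_)
    exact (Continuous.tendsto (by fun_prop : Continuous fun α : ℝ => α * K * q) α₀).eventually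
      (gt_mem_nhds hαK)
  filter_upwards [h1, D.eventually_det_interp_ne_zero_nhdsNE α₀] with α h h2
  exact D.diagonalisable_of_linearIndependent h.1 h.2 (D.linearIndependent_schurAt h.1 h.2 h2)

end Determinant

section Closure

variable {n K q : ℕ} [NeZero n] {P : ℤ}

lemma continuous_gam : Continuous fun α : ℝ => gam n K P α := by
  unfold gam; fun_prop

lemma continuous_eigVal (r : ℕ) (a : Compos n K) : Continuous fun α : ℝ => eigVal P α r a := by
  have := continuous_gam (n := n) (K := K) (P := P)
  unfold eigVal elemExp
  fun_prop

lemma CouplingData.continuousAt_latCoef (D : CouplingData n K q P) {α : ℝ} (hα : 0 < α)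
    (hαK : α * K * q < 2 * π) (J : Finset (Fin n)) (m : Compos n K) :
    ContinuousAt (fun α => latCoef P α J m) α := by
  have hg := (continuous_gam (n := n) (K := K) (P := P)).continuousAt (x := α)
  have hl : ∀ i, ContinuousAt (fun α => latAng P α m i) α := fun i =>
    (hasDerivAt_latAng m i α).continuousAt
  unfold latCoef coefV
  refine tendsto_finsetProd _ fun i hi => tendsto_finsetProd _ fun j hj => ?_
  have hij : i ≠ j := fun h => Finset.mem_compl.1 hj (h ▸ hi)
  refine ContinuousAt.div ?_ ?_
    (D.sin_ang_sub_ne_zero hα hαK (fun _ => Nat.cast_nonneg _) m.cast_sum_eq hij)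
  · exact Real.continuous_sin.continuousAt.comp ((((hl i).sub (hl j)).add hg).div_const 2)
  · exact Real.continuous_sin.continuousAt.comp (((hl i).sub (hl j)).div_const 2)

lemma CouplingData.continuousAt_symW (D : CouplingData n K q P) {α : ℝ} (hα : 0 < α)
    (hαK : α * K * q < 2 * π) (J : Finset (Fin n)) (m m' : Compos n K) :
    ContinuousAt (fun α => symW P α J m m') α := by
  unfold symW
  split_ifs
  · exact continuousAt_const.mul (Real.continuous_sqrt.continuousAt.comp
      ((D.continuousAt_latCoef hα hαK J m).mul (D.continuousAt_latCoef hα hαK Jᶜ m')))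
  · exact continuousAt_const

/-- The families of functions which are orthonormal. -/
def orthoFamilies (n K : ℕ) : Set (Compos n K → Compos n K → ℂ) :=
  {Ψ | ∀ a b, ∑ m, Ψ a m * starRingEnd ℂ (Ψ b m) = if a = b then 1 else 0}

lemma isCompact_orthoFamilies : IsCompact (orthoFamilies n K) := by
  refine Metric.isCompact_of_isClosed_isBounded ?_ ?_
  · simp only [orthoFamilies, Set.ofPred_forall]
    refine isClosed_iInter fun a => isClosed_iInter fun b => isClosed_eq ?_ continuous_const
    have : Continuous (starRingEnd ℂ) := Complex.continuous_conj
    fun_prop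
  · refine (Metric.isBounded_closedBall (x := 0) (r := 1)).subset ?_
    intro Ψ hΨ
    rw [mem_closedBall_zero_iff, pi_norm_le_iff_of_nonneg zero_le_one]
    intro a
    rw [pi_norm_le_iff_of_nonneg zero_le_one]
    intro m
    have h1 : ∑ m, ‖Ψ a m‖ ^ 2 = 1 := by
      have h2 := hΨ a a
      simp only [if_true, Complex.mul_conj'] at h2
      exact_mod_cast h2
    have h3 : ‖Ψ a m‖ ^ 2 ≤ 1 := h1 ▸ Finset.single_le_sum (f := fun m => ‖Ψ a m‖ ^ 2)
      (fun _ _ => sq_nonneg _) (Finset.mem_univ m)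
    exact (sq_le_one_iff₀ (norm_nonneg _)).1 h3

open Topology Filter in
theorem CouplingData.diagonalisable (D : CouplingData n K q P) {α₀ : ℝ} (hα : 0 < α₀)
    (hαK : α₀ * K * q < 2 * π) : Diagonalisable n K P α₀ := by
  obtain ⟨Φ, hΦ⟩ := (D.eventually_diagonalisable hα hαK).choice
  set U : Ultrafilter ℝ := Ultrafilter.of (𝓝[≠] α₀) with hU
  have hUle : (U : Filter ℝ) ≤ 𝓝[≠] α₀ := Ultrafilter.of_le _
  have hΦU := hΦ.filter_mono hUle
  have hUα : Tendsto id (U : Filter ℝ) (𝓝 α₀) := hUle.trans nhdsWithin_le_nhds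
  obtain ⟨Ψ, hΨ, hlim⟩ := isCompact_orthoFamilies.ultrafilter_le_nhds' (U.map Φ)
    (hΦU.mono fun α h => h.1)
  have hlim' : Tendsto Φ (U : Filter ℝ) (𝓝 Ψ) := hlim
  have hlim'' : ∀ a m, Tendsto (fun α => Φ α a m) (U : Filter ℝ) (𝓝 (Ψ a m)) := fun a m =>
    tendsto_pi_nhds.1 (tendsto_pi_nhds.1 hlim' a) m
  refine ⟨Ψ, hΨ, fun r hr a m => ?_⟩
  have h1 : Tendsto (fun α => symOp P α r (Φ α a) m) (U : Filter ℝ) (𝓝 (symOp P α₀ r (Ψ a) m)) := by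
    simp only [symOp_apply]
    refine tendsto_finsetSum _ fun J _ => tendsto_finsetSum _ fun m' _ => ?_
    exact ((Complex.continuous_ofReal.tendsto _).comp
      ((D.continuousAt_symW hα hαK J m m').tendsto.comp hUα)).mul (hlim'' a m')
  have h2 : Tendsto (fun α => eigVal P α r a * Φ α a m) (U : Filter ℝ)
      (𝓝 (eigVal P α₀ r a * Ψ a m)) :=
    (((continuous_eigVal r a).tendsto α₀).comp hUα).mul (hlim'' a m)
  exact tendsto_nhds_unique (h1.congr' (hΦU.mono fun α h => h.2 r hr a m)) h2

end Closure

section Coordinates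

variable {n p : ℕ} [NeZero n]

/-- The coordinate label with one-based index `j`. -/
def ix (n : ℕ) [NeZero n] (j : ℕ) : Fin n := ⟨(j - 1) % n, Nat.mod_lt _ (NeZero.pos n)⟩

lemma ix_val_add_one (i : Fin n) : ix n (i + 1) = i := by
  apply Fin.ext
  simp only [ix, Nat.add_sub_cancel]
  exact Nat.mod_eq_of_lt i.2

lemma ee_eq {j : ℕ} (hj : 1 ≤ j) : ee n j = fun i => if i = ix n j then (1 : ℝ) else 0 := by
  funext i
  obtain ⟨j, rfl⟩ : ∃ l, j = l + 1 := ⟨j - 1, by omega⟩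
  have h : ((i : ℕ) + 1) % n = (j + 1) % n ↔ i = ix n (j + 1) := by
    rw [Fin.ext_iff]
    simp only [ix, Nat.add_sub_cancel]
    constructor
    · intro h
      have h1 : (i : ℕ) ≡ j [MOD n] := Nat.ModEq.add_right_cancel' 1 h
      rw [← h1, Nat.mod_eq_of_lt i.2]
    · intro h
      rw [h, Nat.mod_add_mod]
  simp only [ee, h]

lemma inn_ee {j : ℕ} (hj : 1 ≤ j) (x : Fin n → ℝ) : inn (ee n j) x = x (ix n j) := by
  simp [inn, ee_eq hj]

lemma inn_sub_left (u v x : Fin n → ℝ) : inn (u - v) x = inn u x - inn v x := by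
  simp [inn, sub_mul, Finset.sum_sub_distrib]

lemma inn_aa {j : ℕ} (hj : 1 ≤ j) (x : Fin n → ℝ) :
    inn (aa n p j) x = x (ix n j) - x (ix n (j + p)) := by
  rw [aa, inn_sub_left, inn_ee hj, inn_ee (by omega)]

lemma prod_Icc_one_eq (f : ℕ → ℝ) : ∏ j ∈ Icc 1 n, f j = ∏ i : Fin n, f (i + 1) := by
  rw [Fin.prod_univ_eq_prod_range (fun i => f (i + 1)) n, ← Finset.Ico_add_one_right_eq_Icc,
    Finset.prod_Ico_eq_prod_range]
  simp [add_comm]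

/-- The weight of the set `J`, in the coordinates ordered by `E`. -/
def setWeight (E : Equiv.Perm (Fin n)) (J : Finset (Fin n)) : Fin n → ℝ :=
  fun i => indVec J (E.symm i) - J.card / n

lemma Vnu_setWeight (E : Equiv.Perm (Fin n)) (J : Finset (Fin n)) (α g σ : ℝ) (hσ : σ * σ = 1)
    (x : Fin n → ℝ) :
    Vnu n α g (setWeight E J) x = coefV (α * (σ * g)) J fun k => α * (σ * x (E k)) := by
  have h1 : ∀ i k : Fin n, (((i : ℕ) + 1 ≠ (k : ℕ) + 1) ∧
      inn (ee n (i + 1) - ee n (k + 1)) (setWeight E J) = 1) ↔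
        E.symm i ∈ J ∧ E.symm k ∉ J := by
    intro i k
    rw [inn_sub_left, inn_ee (by omega), inn_ee (by omega), ix_val_add_one, ix_val_add_one]
    simp only [setWeight, sub_sub_sub_cancel_right, indVec]
    constructor
    · rintro ⟨-, h⟩
      split_ifs at h with h1 h2 h2
      · norm_num at h
      · exact ⟨h1, h2⟩
      · norm_num at h
      · norm_num at h
    · rintro ⟨h1, h2⟩
      refine ⟨fun h => h2 ?_, by simp [h1, h2]⟩
      have : i = k := Fin.ext (by omega)
      rwa [← this]
  unfold Vnu coefV
  simp only [prod_Icc_one_eq, h1]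
  rw [← Equiv.prod_comp E]
  have h2 : ∀ i : Fin n, i ∈ (univ : Finset (Fin n)) →
      (∏ k : Fin n, if E.symm (E i) ∈ J ∧ E.symm k ∉ J then
        Real.sin (α * (inn (ee n ((E i : ℕ) + 1) - ee n (k + 1)) x + g) / 2) /
          Real.sin (α * inn (ee n ((E i : ℕ) + 1) - ee n (k + 1)) x / 2) else 1) =
      if i ∈ J then ∏ k ∈ Jᶜ,
        Real.sin ((α * (σ * x (E i)) - α * (σ * x (E k)) + α * (σ * g)) / 2) /
          Real.sin ((α * (σ * x (E i)) - α * (σ * x (E k))) / 2) else 1 := by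
    intro i _
    rw [← Equiv.prod_comp E]
    split_ifs with hi
    · rw [← Finset.prod_subset (Finset.subset_univ Jᶜ)]
      · refine Finset.prod_congr rfl fun k hk => ?_
        rw [Finset.mem_compl] at hk
        rw [if_pos (by simpa using ⟨hi, hk⟩), inn_sub_left, inn_ee (by omega), inn_ee (by omega),
          ix_val_add_one, ix_val_add_one]
        rcases mul_self_eq_one_iff.1 hσ with rfl | rfl
        · congr 2 <;> ring
        · rw [← sin_div_sin_neg]
          congr 2 <;> ring
      · intro k _ hk
        rw [Finset.mem_compl, not_not] at hk
        rw [if_neg (by simp [hk])]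
    · exact Finset.prod_eq_one fun k _ => by rw [if_neg (by simp [hi])]
  rw [Finset.prod_congr rfl h2]
  simp

lemma coefV_neg (γ : ℝ) (J : Finset (Fin n)) (θ : Fin n → ℝ) :
    coefV γ J (fun i => -θ i) = coefV γ Jᶜ θ := by
  unfold coefV
  rw [compl_compl, Finset.prod_comm]
  refine Finset.prod_congr rfl fun i _ => Finset.prod_congr rfl fun j _ => ?_
  congr 2 <;> ring

lemma coefV_congr_of_shift (γ : ℝ) (J : Finset (Fin n)) {θ θ' : Fin n → ℝ} (N : Fin n → ℤ) (c : ℝ)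
    (h : ∀ i, θ i = θ' i + N i * (2 * π) + c) : coefV γ J θ = coefV γ J θ' := by
  unfold coefV
  refine Finset.prod_congr rfl fun i _ => Finset.prod_congr rfl fun j _ => ?_
  have h1 : (θ i - θ j + γ) / 2 = (θ' i - θ' j + γ) / 2 + (N i - N j : ℤ) * π := by
    rw [h, h]; push_cast; ring
  have h2 : (θ i - θ j) / 2 = (θ' i - θ' j) / 2 + (N i - N j : ℤ) * π := by
    rw [h, h]; push_cast; ring
  rw [h1, h2, Real.sin_add_int_mul_pi, Real.sin_add_int_mul_pi]
  exact mul_div_mul_left _ _ (zpow_ne_zero _ (by norm_num))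

lemma exists_shift {θ θ' : Fin n → ℝ} (z : Fin n → ℤ)
    (h : ∀ k : Fin n, (k : ℕ) + 1 < n →
      θ k - θ (k + 1) = θ' k - θ' (k + 1) + z k * (2 * π)) :
    ∃ (N : Fin n → ℤ) (c : ℝ), ∀ i, θ i = θ' i + N i * (2 * π) + c := by
  have key : ∀ (k : ℕ) (hk : k < n), ∃ N : ℤ,
      θ ⟨k, hk⟩ = θ' ⟨k, hk⟩ + N * (2 * π) + (θ 0 - θ' 0) := by
    intro k
    induction k with
    | zero =>
      intro hk
      have : (⟨0, hk⟩ : Fin n) = 0 := Fin.ext (by simp)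
      exact ⟨0, by rw [this]; push_cast; ring⟩
    | succ k ih =>
      intro hk
      obtain ⟨N, hN⟩ := ih (by omega)
      have h1 : (⟨k, by omega⟩ : Fin n) + 1 = ⟨k + 1, hk⟩ := by
        apply Fin.ext
        rw [val_add_one_eq (by omega)]
        simp only
        rw [if_neg (by omega)]
      have h2 := h ⟨k, by omega⟩ hk
      rw [h1] at h2
      refine ⟨N - z ⟨k, by omega⟩, ?_⟩
      push_cast
      linarith
  choose N hN using fun i : Fin n => key i i.2
  exact ⟨N, θ 0 - θ' 0, hN⟩

lemma exists_cyclic_order (hn : 2 ≤ n) (hp : 1 ≤ p) (hcop : Nat.Coprime p n) :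
    ∃ E : Equiv.Perm (Fin n), (∀ k, (E (k + 1) : ℕ) = (E k + p) % n) ∧
      ∀ k, (E k : ℕ) + 1 = n ↔ (k : ℕ) + 1 = n := by
  let f : Fin n → Fin n := fun k => ⟨(((k : ℕ) + 1) * p + (n - 1)) % n, Nat.mod_lt _ (by omega)⟩
  have hf : Function.Injective f := by
    intro i j h
    have h1 : ((i : ℕ) + 1) * p + (n - 1) ≡ ((j : ℕ) + 1) * p + (n - 1) [MOD n] :=
      Fin.ext_iff.1 h
    have h2 : (i : ℕ) + 1 ≡ j + 1 [MOD n] :=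
      Nat.ModEq.cancel_right_of_coprime hcop.symm (Nat.ModEq.add_right_cancel' _ h1)
    have h3 : (i : ℕ) ≡ j [MOD n] := Nat.ModEq.add_right_cancel' 1 h2
    exact Fin.ext (Nat.ModEq.eq_of_lt_of_lt h3 i.2 j.2)
  have hlast : ∀ k : Fin n, (k : ℕ) + 1 = n → (f k : ℕ) + 1 = n := by
    intro k hk
    simp only [f, hk]
    rw [Nat.mul_add_mod, Nat.mod_eq_of_lt (by omega)]
    omega
  refine ⟨Equiv.ofBijective f (Finite.injective_iff_bijective.1 hf), fun k => ?_, fun k => ?_⟩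
  · show (((((k + 1 : Fin n) : ℕ)) + 1) * p + (n - 1)) % n =
      ((((k : ℕ) + 1) * p + (n - 1)) % n + p) % n
    rw [Nat.mod_add_mod]
    have h1 : ((k + 1 : Fin n) : ℕ) ≡ k + 1 [MOD n] := by
      rw [val_add_one_eq (by omega)]
      split_ifs with h
      · rw [h]; exact (Nat.modEq_zero_iff_dvd.2 dvd_rfl).symm
      · rfl
    have h2 := ((h1.add_right 1).mul_right p).add_right (n - 1)
    refine h2.trans ?_
    have : ((k : ℕ) + 1 + 1) * p + (n - 1) = ((k : ℕ) + 1) * p + (n - 1) + p := by ring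
    rw [this]
  · show (f k : ℕ) + 1 = n ↔ _
    refine ⟨fun h => ?_, hlast k⟩
    have h1 := hlast ⟨n - 1, by omega⟩ (by simp only; omega)
    have h2 : f k = f ⟨n - 1, by omega⟩ := Fin.ext (by omega)
    rw [hf h2]
    simp only
    omega

end Coordinates

section Inner

variable {n : ℕ}

lemma inn_add_right (u x y : Fin n → ℝ) : inn u (x + y) = inn u x + inn u y := by
  simp [inn, mul_add, Finset.sum_add_distrib]

lemma inn_smul_right (u : Fin n → ℝ) (c : ℝ) (x : Fin n → ℝ) : inn u (c • x) = c * inn u x := by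
  simp only [inn, Pi.smul_apply, smul_eq_mul, Finset.mul_sum]
  exact Finset.sum_congr rfl fun i _ => by ring

lemma inn_sum_right (u : Fin n → ℝ) (s : Finset ℕ) (f : ℕ → Fin n → ℝ) :
    inn u (∑ j ∈ s, f j) = ∑ j ∈ s, inn u (f j) := by
  simp only [inn, Finset.sum_apply, Finset.mul_sum]
  rw [Finset.sum_comm]

lemma sum_sum_smul_eq_zero (s : Finset ℕ) (c : ℕ → ℝ) (f : ℕ → Fin n → ℝ)
    (h : ∀ j ∈ s, ∑ i, f j i = 0) : ∑ i, (∑ j ∈ s, c j • f j) i = 0 := by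
  simp only [Finset.sum_apply, Pi.smul_apply, smul_eq_mul]
  rw [Finset.sum_comm]
  exact Finset.sum_eq_zero fun j hj => by rw [← Finset.mul_sum, h j hj, mul_zero]

end Inner

section Lattice

variable {n p K : ℕ} [NeZero n] {P : ℤ} {α g σ : ℝ} {E : Equiv.Perm (Fin n)} {ω : ℕ → Fin n → ℝ}

/-- The simplicial lattice data, with coordinates reordered along the steps of length `p`. -/
structure LatticeData (n p K : ℕ) [NeZero n] (P : ℤ) (α g σ : ℝ) (E : Equiv.Perm (Fin n))
    (ω : ℕ → Fin n → ℝ) : Prop where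
  two_le : 2 ≤ n
  one_le : 1 ≤ p
  lt : p < n
  pos : 0 < α
  sgn_eq : Real.sign (2 * π * p / α - n * g) = σ
  abs_eq : |2 * π * p / α - n * g| = K
  level_eq : 2 * π * p / α - n * g = σ * K
  sgn_mul_self : σ * σ = 1
  cast_eq : (P : ℝ) = σ * p
  next : ∀ k, (E (k + 1) : ℕ) = (E k + p) % n
  last : ∀ k, (E k : ℕ) + 1 = n ↔ (k : ℕ) + 1 = n
  sum_weight : ∀ k : ℕ, 1 ≤ k → k ≤ n - 1 → ∑ i, ω k i = 0
  inn_weight : ∀ j : ℕ, 1 ≤ j → j ≤ n - 1 → ∀ k : ℕ, 1 ≤ k → k ≤ n - 1 →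
    inn (aa n p j) (ω k) = if j = k then (1 : ℝ) else 0

/-- The weight with prescribed labels `y`, in the coordinates ordered by `E`. -/
def lamVec (E : Equiv.Perm (Fin n)) (y : Fin n → ℝ) : Fin n → ℝ :=
  fun i => centre (fun i => ∑ k ∈ Ici i, y k) (E.symm i)

lemma sum_lamVec (y : Fin n → ℝ) : ∑ i, lamVec E y i = 0 :=
  (Equiv.sum_comp E.symm _).trans (sum_centre _)

lemma val_succ_eq {k : Fin n} (hn : 2 ≤ n) (hk : (k : ℕ) + 1 < n) :
    ((k + 1 : Fin n) : ℕ) = k + 1 := by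
  rw [val_add_one_eq hn, if_neg (by omega)]

lemma lamVec_sub (hn : 2 ≤ n) (y : Fin n → ℝ) {k : Fin n} (hk : (k : ℕ) + 1 < n) :
    lamVec E y (E k) - lamVec E y (E (k + 1)) = y k := by
  have h : Ici k = insert k (Ici (k + 1)) := by
    ext i
    simp only [Finset.mem_insert, Finset.mem_Ici, Fin.le_def, Fin.ext_iff, val_succ_eq hn hk]
    omega
  have h' : k ∉ Ici (k + 1) := by
    simp only [Finset.mem_Ici, Fin.le_def, val_succ_eq hn hk]
    omega
  simp only [lamVec, Equiv.symm_apply_apply, centre]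
  rw [h, Finset.sum_insert h']
  ring

/-- Mean-zero vectors are determined by their consecutive differences. -/
lemma eq_of_sub_eq (hn : 2 ≤ n) {x x' : Fin n → ℝ} (hx : ∑ i, x i = 0) (hx' : ∑ i, x' i = 0)
    (h : ∀ k : Fin n, (k : ℕ) + 1 < n → x (E k) - x (E (k + 1)) = x' (E k) - x' (E (k + 1))) :
    x = x' := by
  have key : ∀ (k : ℕ) (hk : k < n), x (E ⟨k, hk⟩) = x' (E ⟨k, hk⟩) + (x (E 0) - x' (E 0)) := by
    intro k
    induction k with
    | zero =>
      intro hk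
      have : (⟨0, hk⟩ : Fin n) = 0 := Fin.ext (by simp)
      rw [this]; ring
    | succ k ih =>
      intro hk
      have h1 : (⟨k, by omega⟩ : Fin n) + 1 = ⟨k + 1, hk⟩ := Fin.ext (val_succ_eq hn hk)
      have h2 := h ⟨k, by omega⟩ hk
      rw [h1, ih (by omega)] at h2
      linarith
  refine eq_of_sum_eq_zero_of_sub_eq hx hx' (x (E 0) - x' (E 0)) fun i => ?_
  have := key (E.symm i) (E.symm i).2
  simpa using this

end Lattice

namespace LatticeData

variable {n p K : ℕ} [NeZero n] {P : ℤ} {α g σ : ℝ} {E : Equiv.Perm (Fin n)} {ω : ℕ → Fin n → ℝ}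

variable (L : LatticeData n p K P α g σ E ω)
include L

lemma ix_add (k : Fin n) : ix n ((E k : ℕ) + 1 + p) = E (k + 1) := by
  apply Fin.ext
  rw [L.next]
  simp only [ix]
  congr 1
  omega

lemma inn_aa_perm (x : Fin n → ℝ) (k : Fin n) :
    inn (aa n p ((E k : ℕ) + 1)) x = x (E k) - x (E (k + 1)) := by
  rw [inn_aa (by omega), ix_val_add_one, L.ix_add]

lemma label_le {k : Fin n} (hk : (k : ℕ) + 1 < n) : (E k : ℕ) + 1 ≤ n - 1 := by
  have := (L.last k).not.2 (by omega)
  have := (E k).2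
  omega

lemma gamma_eq : gam n K P α = α * (σ * g) := by
  have h1 := L.level_eq
  have h2 := L.sgn_mul_self
  have h3 := L.pos
  have hn : (n : ℝ) ≠ 0 := by exact_mod_cast NeZero.ne n
  rw [gam, L.cast_eq, div_eq_iff hn]
  field_simp at h1
  have h4 : (K : ℝ) = σ * (σ * K) := by rw [← mul_assoc, h2, one_mul]
  have h5 : α * (σ * K) = 2 * π * p - α * (n * g) := by linarith
  have h6 : α * K = σ * (α * (σ * K)) := by linear_combination α * h4
  rw [h6, h5]
  ring

/-- The jump of the quasi-periodic coordinate. -/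
lemma coord_sub (x : Fin n → ℝ) (k : Fin n) :
    coord α x ((E k : ℕ) + 1) - coord α x ((E k : ℕ) + 1 + p) =
      x (E k) - x (E (k + 1)) + if n < (E k : ℕ) + 1 + p then 2 * π / α else 0 := by
  have hn := NeZero.pos n
  have hE := (E k).2
  have hp := L.lt
  have h1 : (((E k : ℕ) + 1 - 1) / n : ℕ) = 0 := Nat.div_eq_of_lt (by omega)
  have h2 : (((E k : ℕ) + 1 + p - 1) / n : ℕ) = if n < (E k : ℕ) + 1 + p then 1 else 0 := by
    split_ifs with h
    · exact Nat.div_eq_of_lt_le (by omega) (by omega)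
    · exact Nat.div_eq_of_lt (by omega)
  have h3 := L.ix_add k
  have h4 := ix_val_add_one (E k)
  simp only [ix] at h3 h4
  simp only [coord, hn, dif_pos, h1, h2, h3, h4]
  split_ifs <;> push_cast <;> ring

lemma sum_wrap (c : ℝ) : ∑ k, (if n < (E k : ℕ) + 1 + p then c else 0) = p * c := by
  rw [Equiv.sum_comp E fun i => if n < (i : ℕ) + 1 + p then c else 0,
    Fin.sum_univ_eq_sum_range (fun i => if n < i + 1 + p then c else 0) n]
  have h1 : Finset.range n = Finset.range ((n - p) + p) := by
    congr 1; have := L.lt; omega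
  rw [h1, Finset.sum_range_add]
  have hp := L.lt
  rw [Finset.sum_eq_zero fun i hi => if_neg ?_, Finset.sum_congr rfl fun i hi => if_pos ?_]
  · simp
  · omega
  · rw [Finset.mem_range] at hi; omega

lemma sum_gap {x : Fin n → ℝ} (hx : ∑ i, x i = 0) :
    ∑ k, (coord α x ((E k : ℕ) + 1) - coord α x ((E k : ℕ) + 1 + p) - g) = σ * K := by
  rw [← L.level_eq]
  simp only [L.coord_sub, Finset.sum_sub_distrib, Finset.sum_add_distrib, L.sum_wrap]
  have h : ∑ k, x (E (k + 1)) = ∑ i, x i :=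
    (Equiv.sum_comp (Equiv.addRight (1 : Fin n)) (fun k => x (E k))).trans (Equiv.sum_comp E x)
  rw [h, Equiv.sum_comp E x, hx]
  simp
  ring

lemma sum_rho : ∑ i, rhoP n p α g ω i = 0 := by
  have h : ∀ s ⊆ Icc 1 (n - 1), ∑ i, (∑ j ∈ s, ω j) i = 0 := by
    intro s hs
    simp only [Finset.sum_apply]
    rw [Finset.sum_comm]
    exact Finset.sum_eq_zero fun j hj => L.sum_weight j (Finset.mem_Icc.1 (hs hj)).1
      (Finset.mem_Icc.1 (hs hj)).2
  simp only [rhoP, Pi.add_apply, Pi.smul_apply, smul_eq_mul, Finset.sum_add_distrib,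
    ← Finset.mul_sum]
  rw [h _ (Finset.Icc_subset_Icc_right (by have := L.one_le; omega)),
    h _ (Finset.Icc_subset_Icc_left (by omega))]
  simp

lemma inn_sum_weight {j : ℕ} (hj1 : 1 ≤ j) (hj : j ≤ n - 1) {s : Finset ℕ}
    (hs : s ⊆ Icc 1 (n - 1)) (c : ℕ → ℝ) :
    inn (aa n p j) (∑ k ∈ s, c k • ω k) = if j ∈ s then c j else 0 := by
  rw [inn_sum_right, Finset.sum_congr rfl fun k hk => by
    rw [inn_smul_right, L.inn_weight j hj1 hj k (Finset.mem_Icc.1 (hs hk)).1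
      (Finset.mem_Icc.1 (hs hk)).2]]
  simp

lemma rho_sub {k : Fin n} (hk : (k : ℕ) + 1 < n) :
    rhoP n p α g ω (E k) - rhoP n p α g ω (E (k + 1)) =
      g - if n < (E k : ℕ) + 1 + p then 2 * π / α else 0 := by
  have hE := L.label_le hk
  have h1 := L.one_le
  have h2 := L.lt
  have e : ∀ s ⊆ Icc 1 (n - 1), inn (aa n p ((E k : ℕ) + 1)) (∑ j ∈ s, ω j) =
      if (E k : ℕ) + 1 ∈ s then 1 else 0 := fun s hs => by
    have := L.inn_sum_weight (j := (E k : ℕ) + 1) (by omega) hE hs fun _ => 1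
    simpa using this
  rw [← L.inn_aa_perm, rhoP, inn_add_right, inn_smul_right, inn_smul_right,
    e _ (Finset.Icc_subset_Icc_right (by omega)), e _ (Finset.Icc_subset_Icc_left (by omega))]
  by_cases h : n < (E k : ℕ) + 1 + p
  · rw [if_neg (by rw [Finset.mem_Icc]; omega), if_pos (by rw [Finset.mem_Icc]; omega), if_pos h]
    ring
  · rw [if_pos (by rw [Finset.mem_Icc]; omega), if_neg (by rw [Finset.mem_Icc]; omega), if_neg h]
    ring

end LatticeData

/-- The point of the simplex with barycentric labels `y`. -/
def simplexPt (n p : ℕ) [NeZero n] (α g σ : ℝ) (E : Equiv.Perm (Fin n)) (ω : ℕ → Fin n → ℝ)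
    (y : Fin n → ℝ) : Fin n → ℝ := rhoP n p α g ω + σ • lamVec E y

namespace LatticeData

variable {n p K : ℕ} [NeZero n] {P : ℤ} {α g σ : ℝ} {E : Equiv.Perm (Fin n)} {ω : ℕ → Fin n → ℝ}

variable (L : LatticeData n p K P α g σ E ω)
include L

lemma sum_simplexPt (y : Fin n → ℝ) : ∑ i, simplexPt n p α g σ E ω y i = 0 := by
  simp only [simplexPt, Pi.add_apply, Pi.smul_apply, smul_eq_mul, Finset.sum_add_distrib,
    ← Finset.mul_sum, L.sum_rho, sum_lamVec]
  simp

lemma simplexPt_sub (y : Fin n → ℝ) {k : Fin n} (hk : (k : ℕ) + 1 < n) :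
    simplexPt n p α g σ E ω y (E k) - simplexPt n p α g σ E ω y (E (k + 1)) =
      (g - if n < (E k : ℕ) + 1 + p then 2 * π / α else 0) + σ * y k := by
  rw [← L.rho_sub hk, ← lamVec_sub L.two_le y hk (E := E)]
  simp only [simplexPt, Pi.add_apply, Pi.smul_apply, smul_eq_mul]
  ring

lemma eq_of_sum_eq {u v : Fin n → ℝ} (h : ∀ k : Fin n, (k : ℕ) + 1 < n → u k = v k)
    (hs : ∑ k, u k = ∑ k, v k) : u = v := by
  have hn := L.two_le
  have h1 : ∀ w : Fin n → ℝ, ∑ k, w k = w ⟨n - 1, by omega⟩ +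
      ∑ k ∈ univ.erase ⟨n - 1, by omega⟩, w k := fun w =>
    (Finset.add_sum_erase _ _ (Finset.mem_univ _)).symm
  funext k
  by_cases hk : (k : ℕ) + 1 < n
  · exact h k hk
  · have h2 : k = ⟨n - 1, by omega⟩ := Fin.ext (by simp only; omega)
    rw [h1 u, h1 v, Finset.sum_congr rfl fun i hi => h i ?_] at hs
    · rw [h2]; linarith
    · have := i.2
      have h3 : ¬ (i : ℕ) = n - 1 := fun hc => (Finset.mem_erase.1 hi).1 (Fin.ext hc)
      omega

lemma gap_simplexPt {y : Fin n → ℝ} (hy : ∑ k, y k = K) (k : Fin n) :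
    coord α (simplexPt n p α g σ E ω y) ((E k : ℕ) + 1) -
      coord α (simplexPt n p α g σ E ω y) ((E k : ℕ) + 1 + p) - g = σ * y k := by
  refine congrFun (L.eq_of_sum_eq (u := fun k => coord α (simplexPt n p α g σ E ω y) ((E k : ℕ) + 1) -
      coord α (simplexPt n p α g σ E ω y) ((E k : ℕ) + 1 + p) - g) (v := fun k => σ * y k)
      (fun k hk => ?_) ?_) k
  · rw [L.coord_sub, L.simplexPt_sub y hk]
    ring
  · rw [L.sum_gap (L.sum_simplexPt y), ← Finset.mul_sum, hy]

lemma simplexPt_mem {y : Fin n → ℝ} (hy : ∑ k, y k = K) (hy0 : ∀ k, 0 < y k) :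
    simplexPt n p α g σ E ω y ∈ SigmaInt n p α g := by
  refine ⟨L.sum_simplexPt y, fun j hj => ?_⟩
  obtain ⟨hj1, hjn⟩ := Finset.mem_Icc.1 hj
  have h := L.gap_simplexPt hy (E.symm ⟨j - 1, by omega⟩)
  rw [Equiv.apply_symm_apply] at h
  simp only [Nat.sub_add_cancel hj1] at h
  rw [h, L.sgn_eq, ← mul_assoc, L.sgn_mul_self, one_mul]
  exact hy0 _

lemma exists_shift_ang (y : Fin n → ℝ) : ∃ (N : Fin n → ℤ) (c : ℝ), ∀ k,
    α * (σ * simplexPt n p α g σ E ω y (E k)) =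
      ang α (gam n K P α) y k + N k * (2 * π) + c := by
  obtain ⟨τ, hτ⟩ : ∃ τ : ℤ, σ = τ := by
    rcases mul_self_eq_one_iff.1 L.sgn_mul_self with h | h
    · exact ⟨1, by simp [h]⟩
    · exact ⟨-1, by simp [h]⟩
  refine exists_shift (θ := fun k => α * (σ * simplexPt n p α g σ E ω y (E k)))
    (fun k => if n < (E k : ℕ) + 1 + p then -τ else 0) fun k hk => ?_
  have hn := L.two_le
  have h1 : Ico k (k + 1) = {k} := by
    ext i
    simp only [Finset.mem_Ico, Finset.mem_singleton, Fin.le_def, Fin.lt_def, Fin.ext_iff,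
      val_succ_eq hn hk]
    omega
  have h2 : k ≤ k + 1 := by
    rw [Fin.le_def, val_succ_eq hn hk]; omega
  rw [ang_sub _ _ _ h2, h1, Finset.sum_singleton, L.gamma_eq, ← mul_sub, ← mul_sub,
    L.simplexPt_sub y hk, val_succ_eq hn hk]
  have h3 : α * (2 * π / α) = 2 * π := mul_div_cancel₀ _ L.pos.ne'
  have h4 := L.sgn_mul_self
  split_ifs
  · push_cast
    rw [← hτ]
    linear_combination (α * y k) * h4 - σ * h3
  · push_cast
    linear_combination (α * y k) * h4

lemma Vnu_simplexPt (J : Finset (Fin n)) (y : Fin n → ℝ) :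
    Vnu n α g (setWeight E J) (simplexPt n p α g σ E ω y) =
      coefV (gam n K P α) J (ang α (gam n K P α) y) := by
  obtain ⟨N, c, h⟩ := L.exists_shift_ang y
  rw [Vnu_setWeight E J α g σ L.sgn_mul_self, ← L.gamma_eq]
  exact coefV_congr_of_shift _ _ N c h

lemma Vnu_neg_simplexPt (J : Finset (Fin n)) (y : Fin n → ℝ) :
    Vnu n α g (setWeight E J) (-simplexPt n p α g σ E ω y) =
      coefV (gam n K P α) Jᶜ (ang α (gam n K P α) y) := by
  obtain ⟨N, c, h⟩ := L.exists_shift_ang y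
  rw [Vnu_setWeight E J α g σ L.sgn_mul_self, ← L.gamma_eq,
    ← coefV_congr_of_shift _ _ N c h, ← coefV_neg]
  simp

end LatticeData

section Orbits

variable {n : ℕ} [NeZero n]

lemma sum_setWeight (E : Equiv.Perm (Fin n)) (J : Finset (Fin n)) :
    ∑ i, setWeight E J i = 0 := by
  have hn : (n : ℝ) ≠ 0 := by exact_mod_cast NeZero.ne n
  simp only [setWeight, Finset.sum_sub_distrib]
  rw [Equiv.sum_comp E.symm (indVec J), sum_indVec]
  simp
  field_simp
  ring

omit [NeZero n] in
lemma setWeight_sub (E : Equiv.Perm (Fin n)) (J : Finset (Fin n)) (k l : Fin n) :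
    setWeight E J (E k) - setWeight E J (E l) = indVec J k - indVec J l := by
  simp [setWeight]

omit [NeZero n] in
lemma indVec_injective : Function.Injective (indVec (n := n)) := by
  intro J J' h
  ext k
  have := congrFun h k
  simp only [indVec] at this
  split_ifs at this with h1 h2 h2
  · simp [h1, h2]
  · norm_num at this
  · norm_num at this
  · simp [h1, h2]

omit [NeZero n] in
lemma setWeight_injOn (E : Equiv.Perm (Fin n)) (r : ℕ) :
    Set.InjOn (setWeight E) (powersetCard r (univ : Finset (Fin n))) := by
  intro J hJ J' hJ' h
  have h1 : J.card = r := (Finset.mem_powersetCard.1 hJ).2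
  have h2 : J'.card = r := (Finset.mem_powersetCard.1 hJ').2
  refine indVec_injective (funext fun k => ?_)
  have := congrFun h (E k)
  simpa [setWeight, h1, h2] using this

omit [NeZero n] in
lemma card_filter_succ_le {r : ℕ} (hr : r ≤ n) :
    (univ.filter fun i : Fin n => (i : ℕ) + 1 ≤ r).card = r := by
  have h := Fin.card_filter_val_lt (n := n) (m := r)
  rw [min_eq_right hr] at h
  simp only [Nat.succ_le_iff]
  convert h

omit [NeZero n] in
lemma exists_setWeight_eq (E : Equiv.Perm (Fin n)) {r : ℕ} (hr : r ≤ n)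
    (τ : Equiv.Perm (Fin n)) : ∃ J ∈ powersetCard r (univ : Finset (Fin n)),
      setWeight E J = fun i => omegaStd n r (τ i) := by
  have hc : (univ.filter fun k => (τ (E k) : ℕ) + 1 ≤ r).card = r := by
    refine Eq.trans ?_ (card_filter_succ_le hr)
    exact Finset.card_equiv (E.trans τ) fun i => by
      simp only [Finset.mem_filter, Finset.mem_univ, true_and, Equiv.trans_apply]
  refine ⟨univ.filter fun k => (τ (E k) : ℕ) + 1 ≤ r, Finset.mem_powersetCard_univ.2 hc, ?_⟩
  funext i
  rw [setWeight, hc]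
  simp only [omegaStd, indVec, Finset.mem_filter, Finset.mem_univ, true_and,
    Equiv.apply_symm_apply]

omit [NeZero n] in
lemma inOrbit_setWeight (E : Equiv.Perm (Fin n)) {r : ℕ} (hr : r ≤ n) {J : Finset (Fin n)}
    (hJ : J ∈ powersetCard r (univ : Finset (Fin n))) : inOrbit n r (setWeight E J) := by
  rw [Finset.mem_powersetCard_univ] at hJ
  have hc : Fintype.card {i // E.symm i ∈ J} = Fintype.card {i : Fin n // (i : ℕ) + 1 ≤ r} := by
    rw [Fintype.card_subtype, Fintype.card_subtype, card_filter_succ_le hr, ← hJ]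
    exact Finset.card_equiv E.symm (by simp)
  let e := Fintype.equivOfCardEq hc
  refine ⟨e.extendSubtype, funext fun i => ?_⟩
  simp only [setWeight, omegaStd, indVec, hJ]
  by_cases h : E.symm i ∈ J
  · rw [if_pos h, if_pos (e.extendSubtype_mem i h)]
  · rw [if_neg h, if_neg (e.extendSubtype_not_mem i h)]

omit [NeZero n] in
lemma orbitF_eq (E : Equiv.Perm (Fin n)) {r : ℕ} (hr : r ≤ n) :
    orbitF n r = (powersetCard r (univ : Finset (Fin n))).image (setWeight E) := by
  ext ν
  simp only [orbitF, Finset.mem_image, Finset.mem_univ, true_and]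
  constructor
  · rintro ⟨τ, rfl⟩
    obtain ⟨J, hJ, h⟩ := exists_setWeight_eq E hr τ
    exact ⟨J, hJ, h⟩
  · rintro ⟨J, hJ, rfl⟩
    obtain ⟨τ, h⟩ := inOrbit_setWeight E hr hJ
    exact ⟨τ, h.symm⟩

lemma sum_orbitF (E : Equiv.Perm (Fin n)) {r : ℕ} (hr : r ≤ n) (F : (Fin n → ℝ) → ℂ) :
    ∑ ν ∈ orbitF n r, F ν =
      ∑ J ∈ powersetCard r (univ : Finset (Fin n)), F (setWeight E J) := by
  rw [orbitF_eq E hr, Finset.sum_image (setWeight_injOn E r)]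

omit [NeZero n] in
lemma inn_setWeight (J : Finset (Fin n)) {u : Fin n → ℝ} (hu : ∑ i, u i = 0) :
    inn (setWeight 1 J) u = ∑ j ∈ J, u j := by
  have h : ∀ i, setWeight 1 J i * u i = (if i ∈ J then u i else 0) - (J.card / n : ℝ) * u i := by
    intro i
    simp only [setWeight, indVec, Equiv.Perm.coe_one, sub_mul, ite_mul, one_mul, zero_mul,
      ← Equiv.Perm.inv_def, inv_one, id]
  simp only [inn, h, Finset.sum_sub_distrib, ← Finset.mul_sum, hu, mul_zero, sub_zero]
  simp

lemma calE_eq {r : ℕ} (hr : r ≤ n) (α : ℝ) {u : Fin n → ℝ} (hu : ∑ i, u i = 0) :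
    calE n r α u = elemExp r fun i => α * u i := by
  unfold calE elemExp
  rw [sum_orbitF 1 hr]
  refine Finset.sum_congr rfl fun J _ => ?_
  rw [inn_setWeight J hu, ← Finset.mul_sum]
  push_cast
  ring_nf

omit [NeZero n] in
lemma sum_omegaStd : ∑ k ∈ Icc 1 (n - 1), omegaStd n k = weylVec n := by
  funext i
  have hi := i.2
  have hn : (n : ℝ) ≠ 0 := by exact_mod_cast (by omega : n ≠ 0)
  simp only [Finset.sum_apply, omegaStd, Finset.sum_sub_distrib, weylVec, ← Finset.sum_div]
  have h1 : ∑ k ∈ Icc 1 (n - 1), (if (i : ℕ) + 1 ≤ k then (1 : ℝ) else 0) = n - 1 - i := by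
    rw [Finset.sum_boole, show (Icc 1 (n - 1)).filter (fun k => (i : ℕ) + 1 ≤ k) =
      Icc ((i : ℕ) + 1) (n - 1) by
        ext k; simp only [Finset.mem_filter, Finset.mem_Icc]; omega, Nat.card_Icc]
    rw [Nat.cast_sub (by omega), Nat.cast_add, Nat.cast_sub (by omega)]
    push_cast; ring
  have h2 : ∑ k ∈ Icc 1 (n - 1), (k : ℝ) = n * (n - 1) / 2 := by
    have h3 : ∀ N : ℕ, ∑ k ∈ Icc 1 N, (k : ℝ) = (N + 1) * N / 2 := by
      intro N
      induction N with
      | zero => simp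
      | succ N ih =>
        rw [Finset.sum_Icc_succ_top (by omega), ih]
        push_cast
        ring
    rw [h3, Nat.cast_sub (by omega)]
    push_cast
    ring
  rw [h1, h2]
  field_simp
  ring

end Orbits

/-- The dominant weight of a composition, in the coordinates ordered by `E`. -/
def wt {n K : ℕ} (E : Equiv.Perm (Fin n)) (m : Compos n K) : Fin n → ℝ :=
  lamVec E fun k => (m.1 k : ℝ)

namespace LatticeData

variable {n p K : ℕ} [NeZero n] {P : ℤ} {α g σ : ℝ} {E : Equiv.Perm (Fin n)} {ω : ℕ → Fin n → ℝ}

variable (L : LatticeData n p K P α g σ E ω)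
include L

lemma succ_lt_iff (k : Fin n) : (E k : ℕ) + 1 < n ↔ (k : ℕ) + 1 < n := by
  have h := L.last k
  have := (E k).2
  have := k.2
  omega

lemma sum_labels (F : ℕ → ℕ) (S : ℕ) :
    ∑ k : Fin n, (if (k : ℕ) + 1 < n then F ((E k : ℕ) + 1) else S) =
      ∑ j ∈ Icc 1 (n - 1), F j + S := by
  rw [Finset.sum_congr rfl fun k _ => if_congr (L.succ_lt_iff k).symm rfl rfl,
    Equiv.sum_comp E fun i => if (i : ℕ) + 1 < n then F ((i : ℕ) + 1) else S,
    Fin.sum_univ_eq_sum_range (fun i => if i + 1 < n then F (i + 1) else S) n]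
  obtain ⟨N, rfl⟩ : ∃ N, n = N + 1 := ⟨n - 1, by have := L.two_le; omega⟩
  rw [Finset.sum_range_succ, if_neg (lt_irrefl _), Nat.add_sub_cancel,
    ← Finset.Ico_add_one_right_eq_Icc, Finset.sum_Ico_eq_sum_range, Nat.add_sub_cancel]
  congr 1
  refine Finset.sum_congr rfl fun i hi => ?_
  rw [if_pos (by rw [Finset.mem_range] at hi; omega), add_comm]

lemma wt_eq_sum (m : Compos n K) (c : ℕ → ℕ)
    (h : ∀ k : Fin n, (k : ℕ) + 1 < n → c ((E k : ℕ) + 1) = m.1 k) :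
    wt E m = ∑ j ∈ Icc 1 (n - 1), (c j : ℝ) • ω j := by
  refine eq_of_sub_eq (E := E) L.two_le (sum_lamVec _)
    (sum_sum_smul_eq_zero _ _ _ fun j hj => L.sum_weight j (Finset.mem_Icc.1 hj).1
      (Finset.mem_Icc.1 hj).2) fun k hk => ?_
  rw [wt, lamVec_sub L.two_le _ hk, ← L.inn_aa_perm, L.inn_sum_weight (by omega) (L.label_le hk)
    subset_rfl, if_pos (Finset.mem_Icc.2 ⟨by omega, L.label_le hk⟩), h k hk]

lemma Lam_eq_range : Lam n (K : ℝ) ω = Set.range fun m : Compos n K => wt E m := by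
  ext μ
  constructor
  · rintro ⟨c, hc, rfl⟩
    have hc' : ∑ j ∈ Icc 1 (n - 1), c j ≤ K := by exact_mod_cast hc
    refine ⟨Compos.mk' (fun k : Fin n => if (k : ℕ) + 1 < n then c ((E k : ℕ) + 1) else
      K - ∑ j ∈ Icc 1 (n - 1), c j) ?_, L.wt_eq_sum _ c fun k hk => ?_⟩
    · rw [L.sum_labels]; omega
    · simp only [Compos.mk', hk, if_true]
  · rintro ⟨m, rfl⟩
    have h1 : ∀ k : Fin n, m.1 (E.symm (ix n ((E k : ℕ) + 1))) = m.1 k := fun k => by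
      rw [ix_val_add_one, Equiv.symm_apply_apply]
    refine ⟨fun j => m.1 (E.symm (ix n j)), ?_, L.wt_eq_sum m _ fun k _ => h1 k⟩
    have h2 := L.sum_labels (fun j => m.1 (E.symm (ix n j))) 0
    simp only [h1, add_zero] at h2
    rw [← Nat.cast_sum, ← h2]
    have h3 := m.sum_eq
    refine Nat.cast_le.2 (le_trans (Finset.sum_le_sum fun k _ => ?_) h3.le)
    split_ifs
    · exact le_rfl
    · exact Nat.zero_le _

lemma wt_injective : Function.Injective fun m : Compos n K => wt E m := by
  intro m m' h
  have h1 : (fun k => (m.1 k : ℝ)) = fun k => (m'.1 k : ℝ) := by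
    refine L.eq_of_sum_eq (fun k hk => ?_) ?_
    · rw [← lamVec_sub (E := E) L.two_le (fun k => (m.1 k : ℝ)) hk,
        ← lamVec_sub (E := E) L.two_le (fun k => (m'.1 k : ℝ)) hk]
      have h2 : lamVec E (fun k => (m.1 k : ℝ)) = lamVec E fun k => (m'.1 k : ℝ) := h
      rw [h2]
    · rw [m.cast_sum_eq, m'.cast_sum_eq]
  exact Subtype.ext (funext fun k => by exact_mod_cast congrFun h1 k)

lemma step_iff (J : Finset (Fin n)) (m m' : Compos n K) :
    wt E m + setWeight E J = wt E m' ↔ Step J m.1 m'.1 := by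
  have hcast : ∀ k, ((m'.1 k : ℝ) = m.1 k + (indVec J k - indVec J (k + 1))) ↔
      m'.1 k + (if k + 1 ∈ J then 1 else 0) = m.1 k + (if k ∈ J then 1 else 0) := by
    intro k
    rw [← Nat.cast_inj (R := ℝ)]
    simp only [indVec]
    push_cast
    constructor <;> intro h <;> linarith
  have hsub : ∀ k : Fin n, (k : ℕ) + 1 < n →
      (wt E m + setWeight E J) (E k) - (wt E m + setWeight E J) (E (k + 1)) =
        m.1 k + (indVec J k - indVec J (k + 1)) := fun k hk => by
    have h := lamVec_sub (E := E) L.two_le (fun k => (m.1 k : ℝ)) hk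
    rw [← setWeight_sub E, ← h]
    simp only [wt, Pi.add_apply]
    ring
  constructor
  · intro h k
    rw [← hcast]
    refine congrFun (L.eq_of_sum_eq (u := fun k => (m'.1 k : ℝ))
      (v := fun k => m.1 k + (indVec J k - indVec J (k + 1))) (fun k hk => ?_) ?_) k
    · rw [← hsub k hk, h]
      exact (lamVec_sub (E := E) L.two_le (fun k => (m'.1 k : ℝ)) hk).symm
    · rw [Finset.sum_add_distrib, Finset.sum_sub_distrib,
        show ∑ k, indVec J (k + 1) = ∑ k, indVec J k from
          Equiv.sum_comp (Equiv.addRight (1 : Fin n)) (indVec J), m.cast_sum_eq, m'.cast_sum_eq]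
      ring
  · intro h
    refine eq_of_sub_eq (E := E) L.two_le ?_ (sum_lamVec _) fun k hk => ?_
    · simp only [Pi.add_apply, Finset.sum_add_distrib, sum_setWeight, add_zero]
      exact sum_lamVec _
    · rw [hsub k hk, ← (hcast k).2 (h k)]
      exact (lamVec_sub (E := E) L.two_le (fun k => (m'.1 k : ℝ)) hk).symm

lemma weight_comp {k : Fin n} (hk : (k : ℕ) + 1 < n) (i : Fin n) :
    ω ((E k : ℕ) + 1) (E i) = omegaStd n (k + 1) i := by
  have hn : (n : ℝ) ≠ 0 := by exact_mod_cast NeZero.ne n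
  refine congrFun (eq_of_sub_eq (E := 1) (x := fun i => ω ((E k : ℕ) + 1) (E i)) L.two_le
    ?_ ?_ fun l hl => ?_) i
  · rw [Equiv.sum_comp E (ω ((E k : ℕ) + 1))]
    exact L.sum_weight _ (by omega) (L.label_le hk)
  · simp only [omegaStd, Finset.sum_sub_distrib, Finset.sum_boole, Finset.sum_const]
    rw [card_filter_succ_le hk.le]
    simp
    field_simp
    ring
  · simp only [Equiv.Perm.coe_one, id]
    rw [← L.inn_aa_perm, L.inn_weight _ (by omega) (L.label_le hl) _ (by omega) (L.label_le hk)]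
    simp only [omegaStd, val_succ_eq L.two_le hl, Nat.add_right_cancel_iff, ← Fin.ext_iff,
      E.injective.eq_iff, sub_sub_sub_cancel_right]
    rcases lt_trichotomy (l : ℕ) k with h | h | h
    · rw [if_neg (by rw [Fin.ext_iff]; omega), if_pos (by omega), if_pos (by omega)]; ring
    · rw [if_pos (Fin.ext h), if_pos (by omega), if_neg (by omega)]; ring
    · rw [if_neg (by rw [Fin.ext_iff]; omega), if_neg (by omega), if_neg (by omega)]; ring

/-- The coordinate permutation carrying the weights to the standard ones is unique. -/
lemma perm_eq {σp : Equiv.Perm (Fin n)}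
    (h : ∀ j : ℕ, 1 ≤ j → j ≤ n - 1 → ∃ k : ℕ, 1 ≤ k ∧ k ≤ n - 1 ∧
      (fun i => ω j (σp i)) = omegaStd n k) : σp = E := by
  have hn0 : (0 : ℝ) < n := by exact_mod_cast NeZero.pos n
  have h1 : ∀ k : Fin n, (k : ℕ) + 1 < n → ∀ i,
      omegaStd n (k + 1) (E.symm (σp i)) = omegaStd n (k + 1) i := by
    intro k hk
    obtain ⟨k', hk1, -, hk'⟩ := h ((E k : ℕ) + 1) (by omega) (L.label_le hk)
    have h2 : ∀ i, omegaStd n (k + 1) (E.symm (σp i)) = omegaStd n k' i := fun i => by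
      rw [← L.weight_comp hk, Equiv.apply_symm_apply]
      exact congrFun hk' i
    have hle : ∀ (r : ℕ) (i : Fin n), omegaStd n r i ≤ 1 - r / n := fun r i => by
      simp only [omegaStd]; split_ifs <;> linarith
    have hz : ∀ r : ℕ, 1 ≤ r → omegaStd n r 0 = 1 - r / n := fun r hr => by
      simp [omegaStd]; omega
    have h3 := h2 0
    have h4 := h2 (σp.symm (E 0))
    rw [Equiv.apply_symm_apply, Equiv.symm_apply_apply, hz _ (by omega)] at h4
    rw [hz _ hk1] at h3
    have h5 := hle (k + 1) (E.symm (σp 0))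
    have h6 := hle k' (σp.symm (E 0))
    have h7 : ((k + 1 : ℕ) : ℝ) / n = (k' : ℝ) / n := by linarith
    have h8 : ((k : ℕ) + 1) = k' := by
      rw [div_left_inj' hn0.ne'] at h7
      exact_mod_cast h7
    intro i
    rw [h2, h8]
  have h2 : ∀ k : Fin n, (k : ℕ) + 1 < n → ∀ i : Fin n,
      (E.symm (σp i) : ℕ) ≤ k ↔ (i : ℕ) ≤ k := by
    intro k hk i
    have := h1 k hk i
    simp only [omegaStd, Nat.add_le_add_iff_right] at this
    constructor
    · intro ha
      by_contra hb
      rw [if_pos ha, if_neg hb] at this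
      norm_num at this
    · intro ha
      by_contra hb
      rw [if_neg hb, if_pos ha] at this
      linarith
  refine Equiv.ext fun i => ?_
  rw [← Equiv.symm_apply_eq]
  apply Fin.ext
  apply le_antisymm
  · by_cases hi : (i : ℕ) + 1 < n
    · exact (h2 i hi i).2 le_rfl
    · have := (E.symm (σp i)).2
      omega
  · by_cases hi : (E.symm (σp i) : ℕ) + 1 < n
    · exact (h2 _ hi i).1 le_rfl
    · have := i.2
      omega

lemma calE_wt {r : ℕ} (hr : r ≤ n) (a : Compos n K) :
    calE n r α ((σ * g) • (∑ k ∈ Icc 1 (n - 1), omegaStd n k) + fun i => wt E a (E i)) =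
      eigVal P α r a := by
  have h1 : (fun i => wt E a (E i)) = domWeight a.1 := funext fun i => by
    simp [wt, lamVec, domWeight]
  rw [h1, sum_omegaStd, calE_eq hr, eigVal, L.gamma_eq]
  · congr 1
    funext i
    simp only [Pi.add_apply, Pi.smul_apply, smul_eq_mul]
    ring
  · simp only [Pi.add_apply, Pi.smul_apply, smul_eq_mul, Finset.sum_add_distrib,
      ← Finset.mul_sum, sum_weylVec, sum_domWeight]
    simp

end LatticeData

instance {n K : ℕ} [NeZero n] : Nonempty (Compos n K) :=
  ⟨Compos.mk' (fun k => if k = 0 then K else 0) (by simp)⟩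

namespace LatticeData

variable {n p K q : ℕ} [NeZero n] {P : ℤ} {α g σ : ℝ} {E : Equiv.Perm (Fin n)}
  {ω : ℕ → Fin n → ℝ} {s : (Fin n → ℝ) → ℝ}

lemma sign_eq_stepSgn (L : LatticeData n p K P α g σ E ω) (D : CouplingData n K q P)
    (hαK : α * K * q < 2 * π)
    (hs : ∀ r : ℕ, 1 ≤ r → r ≤ n - 1 → ∀ ν : Fin n → ℝ, inOrbit n r ν →
      ∀ x ∈ SigmaInt n p α g, s ν = Real.sign (Vnu n α g ν x))
    {r : ℕ} (hr1 : 1 ≤ r) (hr : r ≤ n - 1) {J : Finset (Fin n)}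
    (hJ : J ∈ powersetCard r (univ : Finset (Fin n))) :
    s (setWeight E J) = stepSgn P J := by
  have hn : (0 : ℝ) < n := by exact_mod_cast NeZero.pos n
  have hK : (0 : ℝ) < K := by exact_mod_cast D.one_le_level
  have hy : ∑ _k : Fin n, (K : ℝ) / n = K := by
    simp
    field_simp
  have hy0 : ∀ _k : Fin n, (0 : ℝ) < K / n := fun _ => div_pos hK hn
  rw [hs r hr1 hr _ (inOrbit_setWeight E (by omega) hJ) _ (L.simplexPt_mem hy hy0),
    L.Vnu_simplexPt]
  have h1 := D.stepSgn_mul_coefV_pos L.pos hαK (fun k => (hy0 k).le) hy (J := J)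
    fun k _ _ => hy0 k
  rcases mul_self_eq_one_iff.1 (stepSgn_mul_self P J) with h2 | h2
  · rw [h2, one_mul] at h1
    rw [h2, Real.sign_of_pos h1]
  · rw [h2, neg_one_mul, neg_pos] at h1
    rw [h2, Real.sign_of_neg h1]

lemma Wmu_mul (L : LatticeData n p K P α g σ E ω) {J : Finset (Fin n)}
    (hsJ : s (setWeight E J) = stepSgn P J) (m : Compos n K) (F : (Fin n → ℝ) → ℂ) :
    (Wmu n p α g ω s (wt E m) (setWeight E J) : ℂ) * F (wt E m + setWeight E J) =
      ∑ m' : Compos n K, (symW P α J m m' : ℂ) * F (wt E m') := by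
  unfold Wmu
  rw [L.sgn_eq, L.abs_eq, L.Lam_eq_range]
  by_cases h : wt E m + setWeight E J ∈ Set.range fun m' : Compos n K => wt E m'
  · obtain ⟨m', hm'⟩ := h
    have hstep : Step J m.1 m'.1 := (L.step_iff J m m').1 hm'.symm
    have hneg : -(rhoP n p α g ω) - σ • wt E m' =
        -simplexPt n p α g σ E ω fun k => (m'.1 k : ℝ) := by
      simp only [simplexPt, wt]
      abel
    rw [← hm', if_pos ⟨m', rfl⟩, hneg, L.Vnu_neg_simplexPt, hsJ, Finset.sum_eq_single m']
    · congr 2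
      rw [symW, if_pos hstep]
      congr 3
      exact L.Vnu_simplexPt J fun k => (m.1 k : ℝ)
    · intro m'' _ hne
      rw [symW, if_neg fun h => hne (Subtype.ext (h.unique hstep)), Complex.ofReal_zero, zero_mul]
    · exact fun h => absurd (Finset.mem_univ _) h
  · rw [if_neg h, Complex.ofReal_zero, zero_mul]
    refine (Finset.sum_eq_zero fun m' _ => ?_).symm
    rw [symW, if_neg fun hst => h ⟨m', ((L.step_iff J m m').2 hst).symm⟩, Complex.ofReal_zero,
      zero_mul]

lemma ip_eq (L : LatticeData n p K P α g σ E ω) (φ ψ : (Fin n → ℝ) → ℂ) :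
    ip n p α g ω φ ψ = ∑ m : Compos n K,
      φ (rhoP n p α g ω + σ • wt E m) * starRingEnd ℂ (ψ (rhoP n p α g ω + σ • wt E m)) := by
  unfold ip
  rw [L.sgn_eq, L.abs_eq, L.Lam_eq_range, finsum_mem_range L.wt_injective,
    finsum_eq_sum_of_fintype]

lemma exists_eigenbasis (L : LatticeData n p K P α g σ E ω) (D : CouplingData n K q P)
    (hαK : α * K * q < 2 * π)
    (hs : ∀ r : ℕ, 1 ≤ r → r ≤ n - 1 → ∀ ν : Fin n → ℝ, inOrbit n r ν →
      ∀ x ∈ SigmaInt n p α g, s ν = Real.sign (Vnu n α g ν x)) :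
    ∃ Ψ : (Fin n → ℝ) → (Fin n → ℝ) → ℂ,
      (∀ a b : Compos n K, ip n p α g ω (Ψ (wt E a)) (Ψ (wt E b)) =
        if wt E a = wt E b then 1 else 0) ∧
      ∀ r : ℕ, 1 ≤ r → r ≤ n - 1 → ∀ a m : Compos n K,
        SOp n p r α g ω s (Ψ (wt E a)) (rhoP n p α g ω + σ • wt E m) =
          eigVal P α r a * Ψ (wt E a) (rhoP n p α g ω + σ • wt E m) := by
  obtain ⟨Φ, hΦ, hS⟩ := D.diagonalisable L.pos hαK
  let inv : (Fin n → ℝ) → Compos n K := Function.invFun fun m => wt E m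
  have hinv : ∀ m : Compos n K, inv (wt E m) = m :=
    Function.leftInverse_invFun L.wt_injective
  have hpt : ∀ x : Fin n → ℝ, σ • (rhoP n p α g ω + σ • x - rhoP n p α g ω) = x := fun x => by
    rw [add_sub_cancel_left, smul_smul, L.sgn_mul_self, one_smul]
  refine ⟨fun l x => Φ (inv l) (inv (σ • (x - rhoP n p α g ω))), fun a b => ?_,
    fun r hr1 hr a m => ?_⟩
  · rw [L.ip_eq]
    simp only [hpt, hinv, hΦ, L.wt_injective.eq_iff]
  · simp only [hpt, hinv]
    rw [← hS r (by omega) a m, symOp_apply]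
    unfold SOp
    rw [L.sgn_eq, sum_orbitF E (by omega)]
    refine Finset.sum_congr rfl fun J hJ => ?_
    have h := L.Wmu_mul (L.sign_eq_stepSgn D hαK hs hr1 hr hJ) m fun x => Φ a (inv x)
    simp only [hinv] at h
    rw [← h, hpt, add_assoc, ← smul_add]
    simp only [hpt]

end LatticeData

lemma TypeI.mul_lt {n p q : ℕ} {α g M : ℝ} (hn : 2 ≤ n) (hα : 0 < α) (h : TypeI n p q α g)
    (hM : 2 * π * p / α - n * g = M) :
    (0 < M → α * M * q < 2 * π) ∧ (M < 0 → α * (-M) * (n - q) < 2 * π) := by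
  obtain ⟨hq1, hqn, -, h⟩ := h
  have hn0 : (0 : ℝ) < n := by exact_mod_cast (by omega : 0 < n)
  have hq0 : (0 : ℝ) < q := by exact_mod_cast hq1
  have hnq : (0 : ℝ) < n - q := sub_pos.2 (by exact_mod_cast (by omega : q < n))
  have hg : g = 2 * π / α * (p / n) - M / n := by
    rw [← hM]; field_simp; ring
  have key : ∀ t : ℝ, 0 < t → ∀ x : ℝ, x / n < 2 * π / α * (1 / (n * t)) → α * x * t < 2 * π := by
    intro t ht x hx
    have h1 : 2 * π / α * (1 / (n * t)) = 2 * π / (α * t) / n := by field_simp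
    rw [h1, div_lt_div_iff_of_pos_right hn0, lt_div_iff₀ (mul_pos hα ht)] at hx
    linarith
  constructor
  · intro hM0
    refine key q hq0 M ?_
    have h1 := div_pos hM0 hn0
    rcases h with ⟨h2, -⟩ | ⟨h2, -⟩
    · rw [hg, mul_sub] at h2
      linarith
    · linarith
  · intro hM0
    refine key (n - q) hnq (-M) ?_
    have h1 := div_neg_of_neg_of_pos hM0 hn0
    rcases h with ⟨-, h2⟩ | ⟨-, h2⟩
    · linarith
    · rw [hg, mul_add] at h2
      rw [neg_div]
      linarith

/-- Theorem 3.7 together with Eq. (3.24): there is an orthonormal family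
`(Ψ_λ)_{λ∈Λ⁺_{p,|M|}}` of lattice functions which are joint eigenfunctions of the
operators `Ŝ_{r,M}` with eigenvalues `ℰ_r(ρ(sgn(M)g) + σ_p(λ))`. -/
theorem statement19 (n p q : ℕ) (α g : ℝ)
    (hn : 2 ≤ n) (hα : 0 < α) (hp1 : 1 ≤ p) (hpn : p ≤ n - 1) (hcop : Nat.Coprime p n)
    (htype : TypeI n p q α g)
    (Mz : ℤ) (hMz : 2 * π * p / α - n * g = (Mz : ℝ)) (hMz0 : Mz ≠ 0)
    (ω : ℕ → Fin n → ℝ)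
    (hωE : ∀ k : ℕ, 1 ≤ k → k ≤ n - 1 → ∑ i, ω k i = 0)
    (hωδ : ∀ j : ℕ, 1 ≤ j → j ≤ n - 1 → ∀ k : ℕ, 1 ≤ k → k ≤ n - 1 →
      inn (aa n p j) (ω k) = if j = k then (1 : ℝ) else 0)
    (s : (Fin n → ℝ) → ℝ)
    (hs : ∀ r : ℕ, 1 ≤ r → r ≤ n - 1 → ∀ ν : Fin n → ℝ, inOrbit n r ν →
      ∀ x ∈ SigmaInt n p α g, s ν = Real.sign (Vnu n α g ν x))
    (σp : Equiv.Perm (Fin n))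
    (hσp : {v : Fin n → ℝ | ∃ j : ℕ, 1 ≤ j ∧ j ≤ n - 1 ∧ v = fun i => ω j (σp i)} =
      {v : Fin n → ℝ | ∃ k : ℕ, 1 ≤ k ∧ k ≤ n - 1 ∧ v = omegaStd n k}) :
    ∃ Ψ : (Fin n → ℝ) → (Fin n → ℝ) → ℂ,
      (∀ lam ∈ Lam n |2 * π * p / α - n * g| ω,
        ∀ μ ∈ Lam n |2 * π * p / α - n * g| ω,
          ip n p α g ω (Ψ lam) (Ψ μ) = if lam = μ then 1 else 0) ∧
      (∀ r : ℕ, 1 ≤ r → r ≤ n - 1 →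
        ∀ lam ∈ Lam n |2 * π * p / α - n * g| ω,
          ∀ μ ∈ Lam n |2 * π * p / α - n * g| ω,
            SOp n p r α g ω s (Ψ lam)
                (rhoP n p α g ω + Real.sign (2 * π * p / α - n * g) • μ) =
              calE n r α
                  ((Real.sign (2 * π * p / α - n * g) * g) •
                      (∑ k ∈ Icc 1 (n - 1), omegaStd n k) +
                    fun i => lam (σp i)) *
                Ψ lam (rhoP n p α g ω + Real.sign (2 * π * p / α - n * g) • μ)) := by
  have : NeZero n := ⟨by omega⟩
  have hlt := htype.mul_lt hn hα hMz
  obtain ⟨hq1, hqn, hpq, -⟩ := htype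
  obtain ⟨E, hE, hlast⟩ := exists_cyclic_order hn hp1 hcop
  have hpq' : (n : ℤ) ∣ p * q - 1 := by
    have h : p * q ≡ 1 [MOD n] := hpq
    exact_mod_cast (Nat.modEq_iff_dvd.1 h.symm)
  obtain ⟨σ, P, Q, hσ, hP, hsgn, hlev, hQ1, hdvd, hsmall⟩ : ∃ (σ : ℝ) (P : ℤ) (Q : ℕ),
      σ * σ = 1 ∧ (P : ℝ) = σ * p ∧ Real.sign (Mz : ℝ) = σ ∧ (Mz : ℝ) = σ * Mz.natAbs ∧
      1 ≤ Q ∧ (n : ℤ) ∣ P * Q - 1 ∧ α * Mz.natAbs * Q < 2 * π := by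
    rcases lt_or_gt_of_ne hMz0 with h | h
    · have hR : (Mz : ℝ) < 0 := by exact_mod_cast h
      have habs : ((Mz.natAbs : ℕ) : ℝ) = -Mz := by
        rw [Nat.cast_natAbs, Int.cast_abs, abs_of_neg hR]
      refine ⟨-1, -p, n - q, by norm_num, by push_cast; ring, Real.sign_of_neg hR,
        by rw [habs]; ring, by omega, ?_, ?_⟩
      · rw [Nat.cast_sub (by omega)]
        have h1 : (-(p : ℤ)) * ((n : ℤ) - q) - 1 = (p * q - 1) - n * p := by ring
        rw [h1]
        exact dvd_sub hpq' (dvd_mul_right _ _)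
      · rw [habs, Nat.cast_sub (by omega)]
        exact hlt.2 hR
    · have hR : (0 : ℝ) < Mz := by exact_mod_cast h
      have habs : ((Mz.natAbs : ℕ) : ℝ) = Mz := by
        rw [Nat.cast_natAbs, Int.cast_abs, abs_of_pos hR]
      refine ⟨1, p, q, by norm_num, by push_cast; ring, Real.sign_of_pos hR,
        by rw [habs]; ring, hq1, hpq', ?_⟩
      rw [habs]
      exact hlt.1 hR
  have hK : 1 ≤ Mz.natAbs := Int.natAbs_pos.2 hMz0
  have L : LatticeData n p Mz.natAbs P α g σ E ω :=
    { two_le := hn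
      one_le := hp1
      lt := by omega
      pos := hα
      sgn_eq := by rw [hMz, hsgn]
      abs_eq := by rw [hMz, Nat.cast_natAbs, Int.cast_abs]
      level_eq := by rw [hMz, hlev]
      sgn_mul_self := hσ
      cast_eq := hP
      next := hE
      last := hlast
      sum_weight := hωE
      inn_weight := hωδ }
  have hperm : σp = E := L.perm_eq fun j hj1 hj => by
    have h : (fun i => ω j (σp i)) ∈ {v : Fin n → ℝ | ∃ k : ℕ, 1 ≤ k ∧ k ≤ n - 1 ∧
        v = omegaStd n k} := by
      rw [← hσp]
      exact ⟨j, hj1, hj, rfl⟩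
    exact h
  obtain ⟨Ψ, h1, h2⟩ := L.exists_eigenbasis ⟨hn, hK, hQ1, hdvd⟩ hsmall hs
  rw [L.abs_eq, L.Lam_eq_range, L.sgn_eq, hperm]
  refine ⟨Ψ, ?_, ?_⟩
  · rintro _ ⟨a, rfl⟩ _ ⟨b, rfl⟩
    exact h1 a b
  · rintro r hr1 hr _ ⟨a, rfl⟩ _ ⟨m, rfl⟩
    rw [L.calE_wt (by omega)]
    exact h2 r hr1 hr a m
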